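/- arXiv:1703.09524 — 9 statements merged into one kernel-verified Lean document; each statement's English description precedes it below -/
import Mathlib

section
/- (Wasow's criterion.) Let X ⊆ ℂᵈ be open, let A, B : X → Mat(n×n,ℂ) be holomorphic, let ξ ∈ X, and let Φ ∈ Mat(n×n,ℂ) satisfy ΦB(ξ) = A(ξ)Φ. Suppose the dimension of the complex vector space {Θ ∈ Mat(n×n,ℂ) : ΘB(ζ) = A(ζ)Θ} is the same for all ζ in some neighborhood of ξ. Then there exist a neighborhood U of ξ and a holomorphic map H : U → Mat(n×n,ℂ) such that H(ξ) = Φ and H(ζ)B(ζ) = A(ζ)H(ζ) for all ζ ∈ U. -/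
/-- The space of intertwiners `{Θ ∈ Mat(n×n,ℂ) : ΘΨ = ΦΘ}` (for the statement below,
`Φ = A(ζ)` and `Ψ = B(ζ)`), as a complex linear subspace of `Mat(n×n,ℂ)`. -/
noncomputable def intertwiners (n : ℕ) (Φ Ψ : Matrix (Fin n) (Fin n) ℂ) :
    Submodule ℂ (Matrix (Fin n) (Fin n) ℂ) where
  carrier := {Θ | Θ * Ψ = Φ * Θ}
  add_mem' := by
    intro a b ha hb
    simp only [Set.mem_setOf_eq] at *
    rw [Matrix.mul_add, Matrix.add_mul, ha, hb]
  zero_mem' := by simp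
  smul_mem' := by
    intro c a ha
    simp only [Set.mem_setOf_eq] at *
    rw [Matrix.mul_smul, Matrix.smul_mul, ha]

/-- Over a division ring every linear map has a generalized inverse. -/
theorem LinearMap.exists_generalizedInverse {K V W : Type*} [DivisionRing K]
    [AddCommGroup V] [Module K V] [AddCommGroup W] [Module K W] (L : V →ₗ[K] W) :
    ∃ S : W →ₗ[K] V, ∀ v, L (S (L v)) = L v := by
  obtain ⟨R, hR⟩ := L.rangeRestrict.exists_rightInverse_of_surjective L.range_rangeRestrict
  obtain ⟨S, hS⟩ := R.exists_extend
  refine ⟨S, fun v => ?_⟩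
  have h₁ : S (L v) = R (L.rangeRestrict v) := LinearMap.congr_fun hS (L.rangeRestrict v)
  have h₂ := LinearMap.congr_fun hR (L.rangeRestrict v)
  rw [h₁]
  exact congrArg Subtype.val h₂

/-- A family of linear maps on a finite-dimensional space that is pointwise differentiable is
differentiable in operator norm. -/
theorem differentiableOn_toContinuousLinearMap {E F : Type*} [NormedAddCommGroup E]
    [NormedSpace ℂ E] [NormedAddCommGroup F] [NormedSpace ℂ F] [FiniteDimensional ℂ F]
    {V : Set E} {T : E → F →ₗ[ℂ] F} (hT : ∀ v, DifferentiableOn ℂ (fun ζ => T ζ v) V) :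
    DifferentiableOn ℂ (fun ζ => LinearMap.toContinuousLinearMap (T ζ)) V := by
  let b := Module.finBasis ℂ F
  let c : (Fin (Module.finrank ℂ F) → F) →ₗ[ℂ] (F →L[ℂ] F) :=
    LinearMap.toContinuousLinearMap.toLinearMap ∘ₗ (b.constr ℂ).toLinearMap
  have h : (fun ζ => LinearMap.toContinuousLinearMap (T ζ)) = fun ζ =>
      LinearMap.toContinuousLinearMap c (fun i => T ζ (b i)) := by
    ext ζ v
    simp only [c, LinearMap.coe_toContinuousLinearMap', LinearMap.comp_apply,
      LinearEquiv.coe_coe]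
    exact (LinearMap.congr_fun ((b.constr ℂ).apply_symm_apply (T ζ)) v).symm
  rw [h]
  exact (LinearMap.toContinuousLinearMap c).differentiable.comp_differentiableOn
    (differentiableOn_pi.2 fun i => hT (b i))

/-- If a holomorphic family of endomorphisms has kernels of constant dimension, then every vector
of the kernel at a point extends to a local holomorphic section of the kernels. -/
theorem exists_holomorphic_section_ker {E F : Type*} [NormedAddCommGroup E]
    [NormedSpace ℂ E] [NormedAddCommGroup F] [NormedSpace ℂ F] [FiniteDimensional ℂ F]
    {V : Set E} (hV : IsOpen V) {T : E → F →ₗ[ℂ] F}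
    (hT : ∀ v, DifferentiableOn ℂ (fun ζ => T ζ v) V) {ξ : E} (hξ : ξ ∈ V)
    (hdim : ∀ ζ ∈ V, Module.finrank ℂ (LinearMap.ker (T ζ)) =
      Module.finrank ℂ (LinearMap.ker (T ξ))) {φ : F} (hφ : T ξ φ = 0) :
    ∃ U : Set E, IsOpen U ∧ ξ ∈ U ∧ U ⊆ V ∧ ∃ h : E → F, DifferentiableOn ℂ h U ∧
      h ξ = φ ∧ ∀ ζ ∈ U, T ζ (h ζ) = 0 := by
  have : CompleteSpace F := FiniteDimensional.complete ℂ F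
  obtain ⟨S, hS⟩ := (T ξ).exists_generalizedInverse
  let G : E → F →L[ℂ] F := fun ζ =>
    LinearMap.toContinuousLinearMap (LinearMap.id + S ∘ₗ (T ζ - T ξ))
  have hG (ζ : E) (v : F) : G ζ v = v + S (T ζ v - T ξ v) := rfl
  have hGdiff : DifferentiableOn ℂ G V := by
    refine differentiableOn_toContinuousLinearMap fun v => ?_
    exact (((LinearMap.toContinuousLinearMap S).differentiable.comp_differentiableOn
      ((hT v).sub_const (T ξ v))).const_add v)
  have hGξ : G ξ = 1 := by
    ext v
    simp [hG]
  refine ⟨V ∩ G ⁻¹' {g | IsUnit g}, hGdiff.continuousOn.isOpen_inter_preimage hV Units.isOpen,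
    ⟨hξ, by simp [hGξ]⟩, Set.inter_subset_left, fun ζ => Ring.inverse (G ζ) φ, ?_,
    by simp [hGξ], ?_⟩
  · rintro ζ ⟨hζ, u, hu⟩
    have hinv : DifferentiableWithinAt ℂ (fun ζ => Ring.inverse (G ζ))
        (V ∩ G ⁻¹' {g | IsUnit g}) ζ := by
      refine DifferentiableAt.comp_differentiableWithinAt (g := Ring.inverse) ζ ?_
        ((hGdiff ζ hζ).mono Set.inter_subset_left)
      rw [← hu]
      exact differentiableAt_inverse u.isUnit
    exact hinv.clm_apply (differentiableWithinAt_const φ)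
  · rintro ζ ⟨hζ, hunit⟩
    have hleft (v : F) : Ring.inverse (G ζ) (G ζ v) = v :=
      DFunLike.congr_fun (Ring.inverse_mul_cancel _ hunit) v
    have hmaps : ∀ v ∈ LinearMap.ker (T ζ), (G ζ : F →ₗ[ℂ] F) v ∈ LinearMap.ker (T ξ) := by
      intro v hv
      rw [LinearMap.mem_ker] at hv ⊢
      simp [hG, hv, hS]
    have hinj : Function.Injective ((G ζ : F →ₗ[ℂ] F).restrict hmaps) := by
      intro v w hvw
      have hvw' : G ζ v = G ζ w := congrArg Subtype.val hvw
      exact Subtype.ext (by rw [← hleft v, hvw', hleft])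
    obtain ⟨w, hw⟩ :=
      (LinearMap.injective_iff_surjective_of_finrank_eq_finrank (hdim ζ hζ)).1 hinj ⟨φ, hφ⟩
    have hw' : G ζ w = φ := congrArg Subtype.val hw
    change T ζ (Ring.inverse (G ζ) φ) = 0
    rw [← hw', hleft]
    exact w.2

/-- Wasow's criterion: if `A, B : X → Mat(n×n,ℂ)` are holomorphic on an open `X ⊆ ℂᵈ`,
`ΦB(ξ) = A(ξ)Φ`, and the dimension of `{Θ : ΘB(ζ) = A(ζ)Θ}` is constant near `ξ`, then
there is a holomorphic `H` near `ξ` with `H(ξ) = Φ` and `HB = AH`. -/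
theorem wasow_criterion (d n : ℕ) (X : Set (Fin d → ℂ)) (hX : IsOpen X)
    (A B : (Fin d → ℂ) → Matrix (Fin n) (Fin n) ℂ)
    (hA : ∀ i j, DifferentiableOn ℂ (fun ζ => A ζ i j) X)
    (hB : ∀ i j, DifferentiableOn ℂ (fun ζ => B ζ i j) X)
    (ξ : Fin d → ℂ) (hξ : ξ ∈ X)
    (Φ : Matrix (Fin n) (Fin n) ℂ) (hΦ : Φ * B ξ = A ξ * Φ)
    (hdim : ∃ V : Set (Fin d → ℂ), IsOpen V ∧ ξ ∈ V ∧ V ⊆ X ∧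
      ∀ ζ ∈ V, Module.finrank ℂ (intertwiners n (A ζ) (B ζ)) =
        Module.finrank ℂ (intertwiners n (A ξ) (B ξ))) :
    ∃ U : Set (Fin d → ℂ), IsOpen U ∧ ξ ∈ U ∧ U ⊆ X ∧
      ∃ H : (Fin d → ℂ) → Matrix (Fin n) (Fin n) ℂ,
        (∀ i j, DifferentiableOn ℂ (fun ζ => H ζ i j) U) ∧
        H ξ = Φ ∧ ∀ ζ ∈ U, H ζ * B ζ = A ζ * H ζ := by
  obtain ⟨V, hV, hξV, hVX, hfr⟩ := hdim
  letI : NormedAddCommGroup (Matrix (Fin n) (Fin n) ℂ) := Matrix.normedAddCommGroup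
  letI : NormedSpace ℂ (Matrix (Fin n) (Fin n) ℂ) := Matrix.normedSpace
  let T : (Fin d → ℂ) → Matrix (Fin n) (Fin n) ℂ →ₗ[ℂ] Matrix (Fin n) (Fin n) ℂ := fun ζ =>
    LinearMap.mulRight ℂ (B ζ) - LinearMap.mulLeft ℂ (A ζ)
  have hTapply (ζ : Fin d → ℂ) (Θ : Matrix (Fin n) (Fin n) ℂ) : T ζ Θ = Θ * B ζ - A ζ * Θ := rfl
  have hker (ζ : Fin d → ℂ) : LinearMap.ker (T ζ) = intertwiners n (A ζ) (B ζ) := by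
    ext Θ
    rw [LinearMap.mem_ker, hTapply, sub_eq_zero]
    rfl
  have hT : ∀ Θ, DifferentiableOn ℂ (fun ζ => T ζ Θ) V := by
    intro Θ
    refine differentiableOn_pi.2 fun i => differentiableOn_pi.2 fun j => ?_
    have hA' := fun i j => (hA i j).mono hVX
    have hB' := fun i j => (hB i j).mono hVX
    simp only [hTapply, Matrix.sub_apply, Matrix.mul_apply]
    fun_prop
  obtain ⟨U, hU, hξU, hUV, H, hH, hHξ, hHT⟩ := exists_holomorphic_section_ker hV hT hξV
    (fun ζ hζ => by rw [hker, hker, hfr ζ hζ]) (φ := Φ) (by rw [hTapply, hΦ, sub_self])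
  exact ⟨U, hU, hξU, hUV.trans hVX, H,
    fun i j => differentiableOn_pi.1 (differentiableOn_pi.1 hH i) j, hHξ,
    fun ζ hζ => sub_eq_zero.1 (hHT ζ hζ)⟩
end

section
/- (Smith's criterion.) Let X ⊆ ℂ be open, let A, B : X → Mat(n×n,ℂ) be holomorphic, let ξ ∈ X, and let Φ ∈ Mat(n×n,ℂ). Suppose there exist a neighborhood V of ξ in X and a continuous map C : V → Mat(n×n,ℂ) such that C(ζ) is invertible for every ζ ∈ V, C(ξ) = Φ, and C(ζ)B(ζ) = A(ζ)C(ζ) for all ζ ∈ V. Then there exist a neighborhood U of ξ and a holomorphic map H : U → Mat(n×n,ℂ) such that H(ξ) = Φ and H(ζ)B(ζ) = A(ζ)H(ζ) for all ζ ∈ U. -/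
open Filter Topology

/-- Germs of analytic functions of one variable form a valuation ring: divisibility is
detected by the order of vanishing. -/
theorem AnalyticAt.exists_eventuallyEq_mul_of_analyticOrderAt_le {f g : ℂ → ℂ} {ξ : ℂ}
    (hf : AnalyticAt ℂ f ξ) (hg : AnalyticAt ℂ g ξ)
    (h : analyticOrderAt f ξ ≤ analyticOrderAt g ξ) :
    ∃ c : ℂ → ℂ, AnalyticAt ℂ c ξ ∧ ∀ᶠ z in 𝓝 ξ, g z = f z * c z := by
  by_cases hf_top : analyticOrderAt f ξ = ⊤
  · refine ⟨0, analyticAt_const, ?_⟩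
    rw [hf_top, top_le_iff, analyticOrderAt_eq_top] at h
    filter_upwards [h] with z hz
    simp [hz]
  · obtain ⟨m, hm⟩ := ENat.ne_top_iff_exists.mp hf_top
    obtain ⟨u, hu, hu_ne, hfu⟩ := hf.analyticOrderAt_eq_natCast.mp hm.symm
    obtain ⟨v, hv, hgv⟩ := (natCast_le_analyticOrderAt hg).mp (hm.trans_le h)
    refine ⟨fun z => v z / u z, hv.div hu hu_ne, ?_⟩
    filter_upwards [hfu, hgv, hu.continuousAt.eventually_ne hu_ne] with z h₁ h₂ h₃
    rw [h₁, h₂, smul_eq_mul, smul_eq_mul]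
    field_simp

/-- The value at `ξ` of a continuous solution of a homogeneous linear system with analytic
coefficients is also the value at `ξ` of an analytic solution. -/
theorem exists_analyticAt_solution {ι κ : Type*} [DecidableEq ι] {ξ : ℂ} (s : Finset ι)
    (a : κ → ι → ℂ → ℂ) (ha : ∀ k j, AnalyticAt ℂ (a k j) ξ)
    (h : ι → ℂ → ℂ) (hh : ∀ j, ContinuousAt (h j) ξ)
    (hah : ∀ k, ∀ᶠ z in 𝓝 ξ, ∑ j ∈ s, a k j z * h j z = 0) :
    ∃ g : ι → ℂ → ℂ, (∀ j, AnalyticAt ℂ (g j) ξ) ∧ (∀ j, g j ξ = h j ξ) ∧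
      ∀ k, ∀ᶠ z in 𝓝 ξ, ∑ j ∈ s, a k j z * g j z = 0 := by
  induction s using Finset.strongInduction generalizing a with
  | H s ih =>
  by_cases hzero : ∀ k, ∀ j ∈ s, ∀ᶠ z in 𝓝 ξ, a k j z = 0
  · refine ⟨fun j _ => h j ξ, fun j => analyticAt_const, fun j => rfl, fun k => ?_⟩
    filter_upwards [(eventually_all_finset s).mpr (hzero k)] with z hz
    exact Finset.sum_eq_zero fun j hj => by rw [hz j hj, zero_mul]
  push Not at hzero
  obtain ⟨k₀, j₁, hj₁, hne₁⟩ := hzero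
  obtain ⟨j₀, hj₀, hmin⟩ :=
    s.exists_min_image (fun j => analyticOrderAt (a k₀ j) ξ) ⟨j₁, hj₁⟩
  have hne₀ : ∀ᶠ z in 𝓝[≠] ξ, a k₀ j₀ z ≠ 0 := by
    refine (ha k₀ j₀).eventually_eq_zero_or_eventually_ne_zero.resolve_left fun h₀ => ?_
    have := hmin j₁ hj₁
    rw [analyticOrderAt_eq_top.mpr h₀, top_le_iff] at this
    exact hne₁ ((analyticOrderAt_eq_top.mp this).mono fun z hz => not_not.mpr hz)
  have hdiv : ∀ j, ∃ c : ℂ → ℂ, AnalyticAt ℂ c ξ ∧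
      (j ∈ s → ∀ᶠ z in 𝓝 ξ, a k₀ j z = a k₀ j₀ z * c z) := by
    intro j
    by_cases hj : j ∈ s
    · obtain ⟨c, hc, hac⟩ :=
        (ha k₀ j₀).exists_eventuallyEq_mul_of_analyticOrderAt_le (ha k₀ j) (hmin j hj)
      exact ⟨c, hc, fun _ => hac⟩
    · exact ⟨0, analyticAt_const, fun hj' => absurd hj' hj⟩
  choose c hc hac using hdiv
  have hcont : ContinuousAt (fun z => h j₀ z + ∑ j ∈ s.erase j₀, c j z * h j z) ξ :=
    (hh j₀).add (tendsto_finsetSum _ fun j _ => (hc j).continuousAt.mul (hh j))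
  have hpunct : ∀ᶠ z in 𝓝[≠] ξ, h j₀ z + ∑ j ∈ s.erase j₀, c j z * h j z = 0 := by
    filter_upwards [hne₀, (hah k₀).filter_mono nhdsWithin_le_nhds,
      ((eventually_all_finset s).mpr hac).filter_mono nhdsWithin_le_nhds] with z hz h₁ h₂
    refine (mul_eq_zero.mp ?_).resolve_left hz
    rw [← h₁, ← Finset.add_sum_erase s _ hj₀, mul_add, Finset.mul_sum]
    congr 1
    refine Finset.sum_congr rfl fun j hj => ?_
    rw [h₂ j (Finset.mem_of_mem_erase hj), mul_assoc]
  have hat : h j₀ ξ + ∑ j ∈ s.erase j₀, c j ξ * h j ξ = 0 :=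
    tendsto_nhds_unique (hcont.tendsto.mono_left nhdsWithin_le_nhds)
      (tendsto_const_nhds.congr' (hpunct.mono fun z hz => hz.symm))
  have hpivot : ∀ᶠ z in 𝓝 ξ, h j₀ z + ∑ j ∈ s.erase j₀, c j z * h j z = 0 := by
    filter_upwards [eventually_nhdsWithin_iff.mp hpunct] with z hz
    rcases eq_or_ne z ξ with rfl | hzξ
    exacts [hat, hz hzξ]
  obtain ⟨g, hg, hgξ, hag⟩ := ih (s.erase j₀) (Finset.erase_ssubset hj₀)
    (fun k j z => a k j z - a k j₀ z * c j z)
    (fun k j => (ha k j).sub ((ha k j₀).mul (hc j))) (fun k => by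
      filter_upwards [hah k, hpivot] with z h₁ h₂
      rw [← Finset.add_sum_erase s _ hj₀] at h₁
      simp only [sub_mul, Finset.sum_sub_distrib, mul_assoc, ← Finset.mul_sum]
      linear_combination h₁ - a k j₀ z * h₂)
  refine ⟨Function.update g j₀ (fun z => -∑ j ∈ s.erase j₀, c j z * g j z), fun j => ?_,
    fun j => ?_, fun k => ?_⟩
  · rcases eq_or_ne j j₀ with rfl | hj
    · rw [Function.update_self]
      exact (Finset.analyticAt_fun_sum _ fun i _ => (hc i).mul (hg i)).neg
    · rw [Function.update_of_ne hj]
      exact hg j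
  · rcases eq_or_ne j j₀ with rfl | hj
    · rw [Function.update_self]
      simp only [hgξ]
      linear_combination -hat
    · rw [Function.update_of_ne hj]
      exact hgξ j
  · filter_upwards [hag k] with z hz
    have hupd : ∀ v, ∑ j ∈ s.erase j₀, a k j z * Function.update g j₀ v j z =
        ∑ j ∈ s.erase j₀, a k j z * g j z := fun v =>
      Finset.sum_congr rfl fun j hj => by
        rw [Function.update_of_ne (Finset.ne_of_mem_erase hj)]
    rw [← Finset.add_sum_erase s _ hj₀, Function.update_self, hupd]
    simp only [sub_mul, Finset.sum_sub_distrib, mul_assoc, ← Finset.mul_sum] at hz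
    linear_combination hz

/-- The intertwining relation `M * Q = P * M` as a linear system in the entries of `M`. -/
theorem Matrix.sum_intertwining_coeff_mul {n : ℕ} (P Q M : Matrix (Fin n) (Fin n) ℂ)
    (p q : Fin n) :
    ∑ x : Fin n × Fin n, ((if x.1 = p then Q x.2 q else 0) -
      (if x.2 = q then P p x.1 else 0)) * M x.1 x.2 = (M * Q) p q - (P * M) p q := by
  simp only [sub_mul, Finset.sum_sub_distrib, Fintype.sum_prod_type, ite_mul, zero_mul,
    Matrix.mul_apply]
  congr 1
  · rw [Finset.sum_comm]
    simp [mul_comm]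
  · simp


/-- Smith's criterion: if `A, B : X → Mat(n×n,ℂ)` are holomorphic on an open `X ⊆ ℂ`, and
near `ξ ∈ X` there is a continuous invertible-valued `C` with `C(ξ) = Φ` and `CB = AC`,
then there is a holomorphic `H` near `ξ` with `H(ξ) = Φ` and `HB = AH`. -/
theorem smith_criterion (n : ℕ) (X : Set ℂ) (hX : IsOpen X)
    (A B : ℂ → Matrix (Fin n) (Fin n) ℂ)
    (hA : ∀ i j, DifferentiableOn ℂ (fun ζ => A ζ i j) X)
    (hB : ∀ i j, DifferentiableOn ℂ (fun ζ => B ζ i j) X)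
    (ξ : ℂ) (hξ : ξ ∈ X)
    (Φ : Matrix (Fin n) (Fin n) ℂ)
    (hC : ∃ V : Set ℂ, IsOpen V ∧ ξ ∈ V ∧ V ⊆ X ∧
      ∃ C : ℂ → Matrix (Fin n) (Fin n) ℂ, ContinuousOn C V ∧
        (∀ ζ ∈ V, IsUnit (C ζ)) ∧ C ξ = Φ ∧ ∀ ζ ∈ V, C ζ * B ζ = A ζ * C ζ) :
    ∃ U : Set ℂ, IsOpen U ∧ ξ ∈ U ∧ U ⊆ X ∧
      ∃ H : ℂ → Matrix (Fin n) (Fin n) ℂ,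
        (∀ i j, DifferentiableOn ℂ (fun ζ => H ζ i j) U) ∧
        H ξ = Φ ∧ ∀ ζ ∈ U, H ζ * B ζ = A ζ * H ζ := by
  obtain ⟨V, hV, hξV, hVX, C, hCc, -, hCξ, hCBA⟩ := hC
  have hVξ : V ∈ 𝓝 ξ := hV.mem_nhds hξV
  have hAan : ∀ i j, AnalyticAt ℂ (fun ζ => A ζ i j) ξ := fun i j =>
    (hA i j).analyticAt (hX.mem_nhds hξ)
  have hBan : ∀ i j, AnalyticAt ℂ (fun ζ => B ζ i j) ξ := fun i j =>
    (hB i j).analyticAt (hX.mem_nhds hξ)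
  obtain ⟨g, hg, hgξ, hsol⟩ := exists_analyticAt_solution (ξ := ξ) Finset.univ
    (fun (k x : Fin n × Fin n) ζ => (if x.1 = k.1 then B ζ x.2 k.2 else 0) -
      (if x.2 = k.2 then A ζ k.1 x.1 else 0))
    (fun k x => by
      refine AnalyticAt.sub ?_ ?_
      · split_ifs
        exacts [hBan _ _, analyticAt_const]
      · split_ifs
        exacts [hAan _ _, analyticAt_const])
    (fun x ζ => C ζ x.1 x.2)
    (fun x => ((continuous_id.matrix_elem x.1 x.2).continuousAt).comp (hCc.continuousAt hVξ))
    (fun k => by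
      filter_upwards [hVξ] with ζ hζ
      rw [Matrix.sum_intertwining_coeff_mul, hCBA ζ hζ, sub_self])
  have hev : ∀ᶠ ζ in 𝓝 ξ, ζ ∈ X ∧ (∀ x, AnalyticAt ℂ (g x) ζ) ∧
      ∀ k : Fin n × Fin n, ∑ x : Fin n × Fin n, ((if x.1 = k.1 then B ζ x.2 k.2 else 0) -
        (if x.2 = k.2 then A ζ k.1 x.1 else 0)) * g x ζ = 0 :=
    (hX.eventually_mem hξ).and ((eventually_all.mpr fun x => (hg x).eventually_analyticAt).and
      (eventually_all.mpr hsol))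
  obtain ⟨U, hU, hUo, hξU⟩ := eventually_nhds_iff.mp hev
  refine ⟨U, hUo, hξU, fun ζ hζ => (hU ζ hζ).1, fun ζ => Matrix.of fun i j => g (i, j) ζ,
    fun i j ζ hζ => ((hU ζ hζ).2.1 (i, j)).differentiableAt.differentiableWithinAt, ?_,
    fun ζ hζ => ?_⟩
  · ext i j
    exact (hgξ (i, j)).trans (by rw [hCξ])
  · ext p q
    rw [← sub_eq_zero, ← Matrix.sum_intertwining_coeff_mul]
    exact (hU ζ hζ).2.2 (p, q)
end

section
/- (Spallek's criterion.) Let X ⊆ ℂᵈ be open, let A, B : X → Mat(n×n,ℂ) be holomorphic, let ξ ∈ X, and let Φ ∈ Mat(n×n,ℂ). Suppose there exist an open neighborhood V of ξ in X and a map T : V → Mat(n×n,ℂ) which is C^∞ in the real sense (infinitely real-differentiable, viewing ℂᵈ as ℝ^{2d}) such that T(ξ) = Φ and T(ζ)B(ζ) = A(ζ)T(ζ) for all ζ ∈ V. Then there exist a neighborhood U of ξ and a holomorphic map H : U → Mat(n×n,ℂ) such that H(ξ) = Φ and H(ζ)B(ζ) = A(ζ)H(ζ) for all ζ ∈ U.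 -/
section

open Metric Set MeasureTheory

theorem norm_fderiv_le_of_norm_le_on_ball {E : Type*} [NormedAddCommGroup E] [NormedSpace ℂ E]
    {f : E → ℂ} {z : E} {r C : ℝ} (hr : 0 < r) (hf : DifferentiableOn ℂ f (ball z r))
    (hC : ∀ w ∈ ball z r, ‖f w‖ ≤ C) : ‖fderiv ℂ f z‖ ≤ 2 * C / r := by
  refine Complex.norm_fderiv_le_div_of_mapsTo_ball hf (fun w hw => ?_) hr
  rw [mem_closedBall, dist_eq_norm]
  linarith [norm_sub_le (f w) (f z), hC w hw, hC z (mem_ball_self hr)]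

theorem cons_mem_ball {d : ℕ} {R : ℝ} (hR : 0 < R) {w : ℂ} {z : Fin d → ℂ} :
    (Fin.cons w z : Fin (d + 1) → ℂ) ∈ ball 0 R ↔ ‖w‖ < R ∧ z ∈ ball 0 R := by
  simp only [mem_ball_zero_iff, pi_norm_lt_iff hR, Fin.forall_fin_succ, Fin.cons_zero,
    Fin.cons_succ]

theorem hasFDerivAt_cons {d : ℕ} (w : ℂ) (z : Fin d → ℂ) :
    HasFDerivAt (fun z : Fin d → ℂ => (Fin.cons w z : Fin (d + 1) → ℂ))
      ((Fin.consEquivL ℂ (fun _ : Fin (d + 1) => ℂ)).toContinuousLinearMap ∘L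
        ContinuousLinearMap.inr ℂ ℂ (Fin d → ℂ)) z := by
  have h1 := (hasFDerivAt_prodMk_right (𝕜 := ℂ) w z)
  exact ((Fin.consEquivL ℂ (fun _ : Fin (d + 1) => ℂ)).toContinuousLinearMap.hasFDerivAt).comp z h1

theorem differentiableOn_circleIntegral_cons {d : ℕ} {f : (Fin (d + 1) → ℂ) → ℂ} {R M r : ℝ}
    (hr : 0 < r) (hrR : r < R) (hf : DifferentiableOn ℂ f (ball 0 R))
    (hM : ∀ z ∈ ball 0 R, ‖f z‖ ≤ M) (k : ℕ) :
    DifferentiableOn ℂ (fun z : Fin d → ℂ =>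
      ∮ w in C(0, r), w⁻¹ ^ k * (w⁻¹ * f (Fin.cons w z))) (ball 0 R) := by
  have hR : 0 < R := hr.trans hrR
  intro z₀ hz₀
  refine DifferentiableAt.differentiableWithinAt ?_
  have hz₀' := mem_ball_zero_iff.1 hz₀
  set δ : ℝ := (R - ‖z₀‖) / 2 with hδ
  have hδ0 : 0 < δ := by rw [hδ]; linarith
  set φ : ℝ → ℂ := fun θ => deriv (circleMap 0 r) θ * ((circleMap 0 r θ)⁻¹ ^ k *
    (circleMap 0 r θ)⁻¹) with hφ
  have hne : ∀ θ, circleMap 0 r θ ≠ 0 := fun θ => circleMap_ne_center hr.ne'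
  have hφc : Continuous φ := by
    have h1 : Continuous fun θ => (circleMap 0 r θ)⁻¹ := (continuous_circleMap 0 r).inv₀ hne
    simp only [hφ, deriv_circleMap]
    fun_prop
  have hnorm : ∀ θ, ‖circleMap 0 r θ‖ = r := fun θ => by simp [abs_of_pos hr]
  have hmem : ∀ θ, ∀ z ∈ ball (0 : Fin d → ℂ) R,
      (Fin.cons (circleMap 0 r θ) z : Fin (d + 1) → ℂ) ∈ ball 0 R := fun θ z hz =>
    (cons_mem_ball hR).2 ⟨by rw [hnorm]; exact hrR, hz⟩
  have hconsc : Continuous fun p : ℝ × (Fin d → ℂ) =>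
      (Fin.cons (circleMap 0 r p.1) p.2 : Fin (d + 1) → ℂ) := by
    refine continuous_pi fun i => ?_
    refine Fin.cases ?_ (fun j => ?_) i
    · simp only [Fin.cons_zero]; exact (continuous_circleMap 0 r).comp continuous_fst
    · simp only [Fin.cons_succ]; fun_prop
  set L := ((Fin.consEquivL ℂ (fun _ : Fin (d + 1) => ℂ)).toContinuousLinearMap ∘L
        ContinuousLinearMap.inr ℂ ℂ (Fin d → ℂ))
  have hsub : ∀ z ∈ ball z₀ δ, ball z δ ⊆ ball 0 R := by
    intro z hz y hy
    rw [mem_ball_zero_iff]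
    rw [mem_ball, dist_eq_norm] at hz hy
    have : ‖y‖ ≤ ‖y - z‖ + (‖z - z₀‖ + ‖z₀‖) := by
      calc ‖y‖ = ‖(y - z) + ((z - z₀) + z₀)‖ := by congr 1; abel
        _ ≤ _ := (norm_add_le _ _).trans (by gcongr; exact norm_add_le _ _)
    rw [hδ] at hz hy
    linarith
  have hd : ∀ θ, ∀ z ∈ ball (0 : Fin d → ℂ) R, HasFDerivAt
      (fun z : Fin d → ℂ => f (Fin.cons (circleMap 0 r θ) z))
      ((fderiv ℂ f (Fin.cons (circleMap 0 r θ) z)) ∘L L) z := by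
    intro θ z hz
    exact ((hf.differentiableAt (isOpen_ball.mem_nhds (hmem θ z hz))).hasFDerivAt).comp z
      (hasFDerivAt_cons _ z)
  obtain ⟨Cφ, hCφ⟩ := (isCompact_Icc (a := (0 : ℝ)) (b := 2 * Real.pi)).exists_bound_of_continuousOn
    hφc.continuousOn
  have hcont : ∀ z ∈ ball (0 : Fin d → ℂ) R,
      Continuous fun θ => φ θ * f (Fin.cons (circleMap 0 r θ) z) := by
    intro z hz
    refine hφc.mul ?_
    exact hf.continuousOn.comp_continuous
      (hconsc.comp (Continuous.prodMk continuous_id continuous_const)) (fun θ => hmem θ z hz)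
  have key := hasFDerivAt_integral_of_dominated_of_fderiv_le (𝕜 := ℂ)
    (μ := volume.restrict (Ioc (0 : ℝ) (2 * Real.pi))) (x₀ := z₀) (s := ball z₀ δ)
    (F := fun z θ => φ θ * f (Fin.cons (circleMap 0 r θ) z))
    (F' := fun z θ => φ θ • ((fderiv ℂ f (Fin.cons (circleMap 0 r θ) z)) ∘L L))
    (bound := fun _ => Cφ * (2 * M / δ)) (ball_mem_nhds _ hδ0) ?_ ?_ ?_ ?_ ?_ ?_
  · refine key.differentiableAt.congr_of_eventuallyEq (Filter.Eventually.of_forall fun z => ?_)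
    simp only [circleIntegral, intervalIntegral.integral_of_le Real.two_pi_pos.le, hφ, smul_eq_mul,
      mul_assoc]
  · filter_upwards [isOpen_ball.mem_nhds hz₀] with z hz
    exact (hcont z hz).aestronglyMeasurable
  · exact ((hcont z₀ hz₀).integrableOn_Icc).mono_set Ioc_subset_Icc_self
  · refine Measurable.aestronglyMeasurable ?_
    refine hφc.measurable.smul ?_
    have h1 : Continuous fun A : (Fin (d + 1) → ℂ) →L[ℂ] ℂ => A ∘L L := by fun_prop
    exact h1.measurable.comp ((measurable_fderiv ℂ f).comp
      (hconsc.comp (Continuous.prodMk continuous_id continuous_const)).measurable)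
  · refine (ae_restrict_iff' measurableSet_Ioc).2 (Filter.Eventually.of_forall fun θ hθ z hz => ?_)
    rw [norm_smul]
    have hz' : z ∈ ball (0 : Fin d → ℂ) R := hsub z hz (mem_ball_self hδ0)
    gcongr
    · exact (norm_nonneg _).trans (hCφ θ (Ioc_subset_Icc_self hθ))
    · exact hCφ θ (Ioc_subset_Icc_self hθ)
    · rw [← (hd θ z hz').fderiv]
      exact norm_fderiv_le_of_norm_le_on_ball hδ0
        (fun y hy => ((hd θ y (hsub z hz hy)).differentiableAt).differentiableWithinAt)
        (fun y hy => hM _ (hmem θ y (hsub z hz hy)))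
  · exact integrable_const _
  · refine Filter.Eventually.of_forall fun θ z hz => ?_
    exact (hd θ z (hsub z hz (mem_ball_self hδ0))).const_mul (φ θ)

theorem summable_prod_pow_of_lt_one {d : ℕ} (q : Fin d → ℝ) (h0 : ∀ i, 0 ≤ q i)
    (h1 : ∀ i, q i < 1) : Summable fun α : Fin d → ℕ => ∏ i, q i ^ α i := by
  induction d with
  | zero => exact (hasSum_fintype _).summable
  | succ d ih =>
    rw [← (Fin.consEquiv fun _ : Fin (d + 1) => ℕ).summable_iff]
    have h := (summable_geometric_of_lt_one (h0 0) (h1 0)).mul_of_nonneg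
      (ih (fun i => q i.succ) (fun i => h0 _) (fun i => h1 _)) (fun k => pow_nonneg (h0 0) k)
      (fun α => Finset.prod_nonneg fun i _ => pow_nonneg (h0 _) _)
    refine h.congr fun p => ?_
    simp [Fin.consEquiv, Fin.prod_univ_succ]

theorem exists_hasSum_monomials_of_differentiableOn_ball {d : ℕ} {f : (Fin d → ℂ) → ℂ}
    {R M r : ℝ} (hr : 0 < r) (hrR : r < R) (hf : DifferentiableOn ℂ f (ball 0 R))
    (hM : ∀ z ∈ ball 0 R, ‖f z‖ ≤ M) :
    ∃ c : (Fin d → ℕ) → ℂ, (∀ α, ‖c α‖ * r ^ (∑ i, α i) ≤ M) ∧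
      ∀ z ∈ ball 0 r, HasSum (fun α => c α * ∏ i, z i ^ α i) (f z) := by
  have hR : 0 < R := hr.trans hrR
  induction d generalizing M with
  | zero =>
    refine ⟨fun _ => f 0, fun α => ?_, fun z _ => ?_⟩
    · simpa only [Finset.univ_eq_empty, Finset.sum_empty, pow_zero, mul_one] using
        hM 0 (mem_ball_self hR)
    · simp [Subsingleton.elim z 0]
  | succ d ih =>
    set g : ℕ → (Fin d → ℂ) → ℂ := fun k z => (2 * Real.pi * Complex.I : ℂ)⁻¹ •
      ∮ w in C(0, r), w⁻¹ ^ k * (w⁻¹ * f (Fin.cons w z)) with hg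
    have hgd : ∀ k, DifferentiableOn ℂ (g k) (ball 0 R) := fun k =>
      (differentiableOn_circleIntegral_cons hr hrR hf hM k).fun_const_smul _
    have hgM : ∀ k, ∀ z ∈ ball 0 R, ‖g k z‖ ≤ M * r⁻¹ ^ k := by
      intro k z hz
      have := circleIntegral.norm_two_pi_i_inv_smul_integral_le_of_norm_le_const (c := 0)
        (f := fun w => w⁻¹ ^ k * (w⁻¹ * f (Fin.cons w z))) (C := r⁻¹ ^ k * (r⁻¹ * M)) hr.le ?_
      · refine this.trans_eq ?_
        field_simp
      · intro w hw
        rw [mem_sphere_zero_iff_norm] at hw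
        rw [norm_mul, norm_mul, norm_pow, norm_inv, hw]
        gcongr
        exact hM _ ((cons_mem_ball hR).2 ⟨hw ▸ hrR, hz⟩)
    choose c hcM hc using fun k => ih (hgd k) (hgM k)
    let e := Fin.consEquiv fun _ : Fin (d + 1) => ℕ
    refine ⟨fun α => c (α 0) (Fin.tail α), fun α => ?_, fun z hz => ?_⟩
    · have := hcM (α 0) (Fin.tail α)
      rw [Fin.sum_univ_succ, pow_add, mul_left_comm]
      calc _ ≤ r ^ α 0 * (M * r⁻¹ ^ α 0) := mul_le_mul_of_nonneg_left this (by positivity)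
        _ = M := by rw [inv_pow]; field_simp
    · obtain ⟨w, z, rfl⟩ : ∃ w y, z = Fin.cons w y := ⟨z 0, Fin.tail z, (Fin.cons_self_tail z).symm⟩
      obtain ⟨hw, hz'⟩ := (cons_mem_ball hr).1 hz
      have hzR : z ∈ ball (0 : Fin d → ℂ) R := ball_subset_ball hrR.le hz'
      rw [← e.hasSum_iff]
      have hterm : ((fun α : Fin (d + 1) → ℕ => c (α 0) (Fin.tail α) *
          ∏ i, (Fin.cons w z : Fin (d + 1) → ℂ) i ^ α i) ∘ e) =
          fun p : ℕ × (Fin d → ℕ) => w ^ p.1 * (c p.1 p.2 * ∏ i, z i ^ p.2 i) := by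
        funext p
        simp [e, Fin.consEquiv, Fin.prod_univ_succ]
        ring
      rw [hterm]
      have hsum : Summable fun p : ℕ × (Fin d → ℕ) =>
          w ^ p.1 * (c p.1 p.2 * ∏ i, z i ^ p.2 i) := by
        have h0 := (summable_geometric_of_lt_one (div_nonneg (norm_nonneg w) hr.le)
          ((div_lt_one hr).2 hw)).mul_of_nonneg (summable_prod_pow_of_lt_one
            (fun i => ‖z i‖ / r) (fun i => div_nonneg (norm_nonneg _) hr.le)
            (fun i => (div_lt_one hr).2 ((pi_norm_lt_iff hr).1 (mem_ball_zero_iff.1 hz') i)))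
            (fun k => by positivity) (fun α => by positivity)
        refine Summable.of_norm_bounded (h0.mul_left M) fun p => ?_
        have := hcM p.1 p.2
        simp only [norm_mul, norm_pow, norm_prod, div_pow, Finset.prod_div_distrib,
          Finset.prod_pow_eq_pow_sum]
        have h2 : ‖c p.1 p.2‖ ≤ M * r⁻¹ ^ p.1 / r ^ (∑ i, p.2 i) := by
          rwa [le_div_iff₀ (by positivity)]
        calc _ ≤ ‖w‖ ^ p.1 * (M * r⁻¹ ^ p.1 / r ^ (∑ i, p.2 i) * ∏ i, ‖z i‖ ^ p.2 i) := by
              gcongr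
          _ = _ := by rw [inv_pow]; field_simp
      have h1 := hsum.hasSum.prod_fiberwise (fun k => (hc k z hz').mul_left (w ^ k))
      have hci : CircleIntegrable (fun w => f (Fin.cons w z)) 0 r := by
        refine ContinuousOn.circleIntegrable hr.le (hf.continuousOn.comp ?_ ?_)
        · refine (continuous_pi fun i => ?_).continuousOn
          refine Fin.cases ?_ (fun j => ?_) i
          · simp only [Fin.cons_zero]; exact continuous_id
          · simp only [Fin.cons_succ]; fun_prop
        · intro w hw
          rw [mem_sphere_zero_iff_norm] at hw
          exact (cons_mem_ball hR).2 ⟨hw ▸ hrR, hzR⟩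
      have hdiff : DifferentiableOn ℂ (fun w => f (Fin.cons w z)) (closedBall 0 r) := by
        refine hf.comp ?_ ?_
        · refine (differentiable_pi.2 fun i => ?_).differentiableOn
          refine Fin.cases ?_ (fun j => ?_) i
          · simp only [Fin.cons_zero]; exact differentiable_id
          · simp only [Fin.cons_succ]; fun_prop
        · intro w hw
          rw [mem_closedBall_zero_iff] at hw
          exact (cons_mem_ball hR).2 ⟨hw.trans_lt hrR, hzR⟩
      have h2 := (hasSum_two_pi_I_cauchyPowerSeries_integral hci hw).const_smul
        (2 * Real.pi * Complex.I : ℂ)⁻¹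
      rw [zero_add, Complex.two_pi_I_inv_smul_circleIntegral_sub_inv_smul_of_differentiable_on_off_countable
        countable_empty (mem_ball_zero_iff.2 hw) hdiff.continuousOn
        (fun x hx => hdiff.differentiableAt (closedBall_mem_nhds_of_mem hx.1))] at h2
      have h3 : HasSum (fun k => w ^ k * g k z) (f (Fin.cons w z)) := by
        refine h2.congr_fun fun k => ?_
        simp only [hg, smul_eq_mul, sub_zero, div_eq_mul_inv, mul_pow, mul_assoc]
        rw [circleIntegral.integral_const_mul]
        ring
      rw [← h1.unique h3]
      exact hsum.hasSum

end

section

open scoped ENNReal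

theorem exists_monomial_weight (σ J : Type*) [Fintype σ] [Fintype J] :
    ∃ (μ : (σ →₀ ℕ) → ℕ) (w : J × (σ →₀ ℕ) → ℕ) (P : ℕ), w.Injective ∧
      (∀ j α β, w (j, α + β) = μ β * w (j, α)) ∧ (∀ j α, μ α ≤ w (j, α)) ∧
      (∀ α, 2 ^ α.degree ≤ μ α) ∧ ∀ α, μ α ≤ P ^ α.degree := by
  classical
  obtain ⟨p, hp, hinj⟩ : ∃ p : σ ⊕ J → ℕ, (∀ x, (p x).Prime) ∧ p.Injective := by
    refine ⟨fun x => Nat.nth Nat.Prime (Fintype.equivFin _ x), fun x => Nat.prime_nth_prime _, ?_⟩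
    exact (Nat.nth_injective Nat.infinite_setOfPred_prime).comp
      (Fin.val_injective.comp (Fintype.equivFin _).injective)
  have hfac : ∀ (F : σ ⊕ J → ℕ) (x), (∏ y, p y ^ F y).factorization (p x) = F x := by
    intro F x
    rw [Nat.factorization_prod fun y _ => pow_ne_zero _ (hp y).ne_zero]
    rcases x with x | x <;> simp [(hp _).factorization, Finsupp.single_apply, hinj.eq_iff]
  let μ : (σ →₀ ℕ) → ℕ := fun α => ∏ i, p (.inl i) ^ α i
  refine ⟨μ, fun e => μ e.2 * p (.inr e.1), ∏ i : σ, p (.inl i), ?_, ?_, ?_, ?_, ?_⟩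
  · rintro ⟨j, α⟩ ⟨j', α'⟩ h
    have hF : ∀ (j : J) (α : σ →₀ ℕ), μ α * p (.inr j) =
        ∏ y, p y ^ (Sum.elim α (Pi.single j 1) : σ ⊕ J → ℕ) y := by
      intro j α
      simp [μ, Fintype.prod_sum_type, Pi.single_apply, pow_ite]
    simp only [hF] at h
    have h2 : ∀ x, (Sum.elim α (Pi.single j 1) : σ ⊕ J → ℕ) x =
        (Sum.elim α' (Pi.single j' 1) : σ ⊕ J → ℕ) x := fun x => by
      rw [← hfac (Sum.elim α (Pi.single j 1)) x, h, hfac]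
    refine Prod.ext ?_ (Finsupp.ext fun i => h2 (.inl i))
    have := h2 (.inr j)
    by_contra hne
    simp [hne] at this
  · intro j α β
    simp only [μ, Finsupp.add_apply, pow_add, Finset.prod_mul_distrib]
    ring
  · intro j α
    exact Nat.le_mul_of_pos_right _ (hp _).pos
  · intro α
    rw [Finsupp.degree_eq_sum, ← Finset.prod_pow_eq_pow_sum]
    exact Finset.prod_le_prod' fun i _ => Nat.pow_le_pow_left (hp _).two_le _
  · intro α
    rw [Finsupp.degree_eq_sum, ← Finset.prod_pow_eq_pow_sum]
    refine Finset.prod_le_prod' fun i _ => Nat.pow_le_pow_left ?_ _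
    exact Nat.le_of_dvd (Finset.prod_pos fun i _ => (hp _).pos) (Finset.dvd_prod_of_mem _ (by simp))

namespace MvPowerSeries

/-- A formal power series is convergent if it converges absolutely on some polydisc. -/
def IsConvergent {σ : Type*} (f : MvPowerSeries σ ℂ) : Prop :=
  ∃ r : ℝ, 0 < r ∧ Summable fun α => ‖coeff α f‖ * r ^ α.degree

namespace IsConvergent

variable {σ : Type*} {f g : MvPowerSeries σ ℂ}

theorem summable_of_le {r s : ℝ} (hs : 0 ≤ s) (hsr : s ≤ r)
    (h : Summable fun α => ‖coeff α f‖ * r ^ α.degree) :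
    Summable fun α => ‖coeff α f‖ * s ^ α.degree :=
  h.of_nonneg_of_le (fun α => by positivity) fun α => by gcongr

theorem of_support_finite (h : {α | coeff α f ≠ 0}.Finite) : IsConvergent f :=
  ⟨1, one_pos, summable_of_hasFiniteSupport (h.subset fun α hα => by
    simp only [Function.mem_support] at hα
    exact fun h0 => hα (by simp [h0]))⟩

theorem zero : IsConvergent (0 : MvPowerSeries σ ℂ) := of_support_finite (by simp)

theorem C (a : ℂ) : IsConvergent (C a : MvPowerSeries σ ℂ) := by
  classical
  refine of_support_finite ((Set.finite_singleton 0).subset fun α hα => ?_)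
  by_contra h
  exact hα (by simpa [coeff_C] using fun h0 : α = 0 => absurd h0 h)

theorem add (hf : IsConvergent f) (hg : IsConvergent g) : IsConvergent (f + g) := by
  obtain ⟨r, hr, hf⟩ := hf
  obtain ⟨s, hs, hg⟩ := hg
  have h0 : 0 < min r s := lt_min hr hs
  refine ⟨min r s, h0, ((summable_of_le h0.le (min_le_left _ _) hf).add
    (summable_of_le h0.le (min_le_right _ _) hg)).of_nonneg_of_le (fun α => by positivity)
    fun α => ?_⟩
  rw [map_add, ← add_mul]
  gcongr
  exact norm_add_le _ _

theorem summable_mul {r : ℝ} (hr : 0 ≤ r) (hf : Summable fun α => ‖coeff α f‖ * r ^ α.degree)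
    (hg : Summable fun α => ‖coeff α g‖ * r ^ α.degree) :
    Summable fun α => ‖coeff α (f * g)‖ * r ^ α.degree := by
  classical
  have h := summable_sum_mul_antidiagonal_of_summable_mul (Summable.mul_of_nonneg hf hg
    (fun α => mul_nonneg (norm_nonneg _) (pow_nonneg hr _))
    (fun α => mul_nonneg (norm_nonneg _) (pow_nonneg hr _)))
  refine h.of_nonneg_of_le (fun α => by positivity) fun α => ?_
  rw [coeff_mul]
  calc _ ≤ (∑ p ∈ Finset.HasAntidiagonal.antidiagonal α, ‖coeff p.1 f * coeff p.2 g‖) *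
        r ^ α.degree := by
        gcongr; exact norm_sum_le _ _
    _ = _ := by
        rw [Finset.sum_mul]
        refine Finset.sum_congr rfl fun p hp => ?_
        rw [← Finset.HasAntidiagonal.mem_antidiagonal.1 hp, norm_mul, map_add, pow_add]
        ring

theorem mul (hf : IsConvergent f) (hg : IsConvergent g) : IsConvergent (f * g) := by
  obtain ⟨r, hr, hf⟩ := hf
  obtain ⟨s, hs, hg⟩ := hg
  have h0 : 0 < min r s := lt_min hr hs
  exact ⟨min r s, h0, summable_mul h0.le (summable_of_le h0.le (min_le_left _ _) hf)
    (summable_of_le h0.le (min_le_right _ _) hg)⟩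

theorem neg (hf : IsConvergent f) : IsConvergent (-f) := by
  simpa [IsConvergent] using hf

theorem sub (hf : IsConvergent f) (hg : IsConvergent g) : IsConvergent (f - g) :=
  sub_eq_add_neg f g ▸ hf.add hg.neg

theorem sum {ι : Type*} {s : Finset ι} {f : ι → MvPowerSeries σ ℂ}
    (h : ∀ i ∈ s, IsConvergent (f i)) : IsConvergent (∑ i ∈ s, f i) :=
  Finset.sum_induction _ _ (fun _ _ => add) zero h

end IsConvergent

/-- The ring of convergent power series. -/
def convergent (σ : Type*) : Subring (MvPowerSeries σ ℂ) where
  carrier := {f | IsConvergent f}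
  mul_mem' := IsConvergent.mul
  one_mem' := by simpa using IsConvergent.C (σ := σ) 1
  add_mem' := IsConvergent.add
  zero_mem' := IsConvergent.zero
  neg_mem' := IsConvergent.neg

theorem isConvergent_of_tsum_ne_top {σ : Type*} {μ : (σ →₀ ℕ) → ℕ} {P s : ℕ}
    (hμ : ∀ α, μ α ≤ P ^ α.degree) {f : MvPowerSeries σ ℂ}
    (hf : ∑' α, (μ α : ℝ≥0∞)⁻¹ ^ s * ‖coeff α f‖ₑ ≠ ∞) : IsConvergent f := by
  refine ⟨((P + 1 : ℝ)⁻¹) ^ s, by positivity, ?_⟩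
  have hle : ∑' α, ENNReal.ofReal (‖coeff α f‖ * (((P + 1 : ℝ)⁻¹) ^ s) ^ α.degree) ≠ ∞ := by
    refine ne_top_of_le_ne_top hf (ENNReal.tsum_le_tsum fun α => ?_)
    rw [ENNReal.ofReal_mul (norm_nonneg _), ofReal_norm, mul_comm, ← pow_mul, mul_comm s, pow_mul,
      ENNReal.ofReal_pow (by positivity), inv_pow, ENNReal.ofReal_inv_of_pos (by positivity)]
    gcongr
    rw [ENNReal.le_ofReal_iff_toReal_le (by simp) (by positivity)]
    simp only [ENNReal.toReal_natCast]
    calc (μ α : ℝ) ≤ (P : ℝ) ^ α.degree := by exact_mod_cast hμ α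
      _ ≤ _ := by gcongr; linarith
  exact summable_of_sum_le (fun α => by positivity) (c := (∑' α, ENNReal.ofReal
    (‖coeff α f‖ * (((P + 1 : ℝ)⁻¹) ^ s) ^ α.degree)).toReal) fun S => by
      have := ENNReal.toReal_mono hle (ENNReal.sum_le_tsum S)
      rwa [← ENNReal.ofReal_sum_of_nonneg (fun α _ => by positivity),
        ENNReal.toReal_ofReal (Finset.sum_nonneg fun α _ => by positivity)] at this

theorem IsConvergent.exists_tsum_ne_top {σ : Type*} {μ : (σ →₀ ℕ) → ℕ}
    (hμ : ∀ α, 2 ^ α.degree ≤ μ α) {f : MvPowerSeries σ ℂ} (hf : IsConvergent f) :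
    ∃ s : ℕ, ∑' α, (μ α : ℝ≥0∞)⁻¹ ^ s * ‖coeff α f‖ₑ ≠ ∞ := by
  obtain ⟨r, hr, hf⟩ := hf
  obtain ⟨s, hs⟩ := exists_pow_lt_of_lt_one hr (by norm_num : (2 : ℝ)⁻¹ < 1)
  refine ⟨s, ne_top_of_le_ne_top hf.tsum_ofReal_ne_top (ENNReal.tsum_le_tsum fun α => ?_)⟩
  rw [ENNReal.ofReal_mul (norm_nonneg _), ofReal_norm, mul_comm]
  gcongr
  calc (μ α : ℝ≥0∞)⁻¹ ^ s ≤ ((2 : ℝ≥0∞) ^ α.degree)⁻¹ ^ s := by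
        gcongr
        exact_mod_cast hμ α
    _ = ENNReal.ofReal (((2 : ℝ)⁻¹ ^ s) ^ α.degree) := by
        rw [← pow_mul, mul_comm s, pow_mul, ENNReal.ofReal_pow (by positivity),
          ENNReal.ofReal_pow (by positivity), ENNReal.ofReal_inv_of_pos two_pos, ← ENNReal.inv_pow]
        simp [ENNReal.inv_pow]
    _ ≤ _ := ENNReal.ofReal_le_ofReal (by gcongr)

end MvPowerSeries

theorem exists_solution_of_strictlyTriangular {ι : Type*} {w : ι → ℕ} (hw : w.Injective)
    (k : ι → ι → ℂ) (g : ι → ℂ) (u : ι → ℝ≥0∞) (hu : ∀ e, u e ≠ ∞)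
    (hk : ∀ e', ∑' e, u e * ‖k e e'‖ₑ ≤ 2⁻¹ * u e') (hg : ∑' e, u e * ‖g e‖ₑ ≠ ∞) :
    ∃ h : ι → ℂ, ∑' e, u e * ‖h e‖ₑ ≠ ∞ ∧
      ∀ e (S : Finset ι), (∀ e', e' ∈ S ↔ w e' < w e) → h e = g e - ∑ e' ∈ S, k e e' * h e' := by
  let F : ℕ → Finset ι := fun n => ((Set.finite_lt_nat n).preimage hw.injOn).toFinset
  have hF : ∀ n e, e ∈ F n ↔ w e < n := fun n e => by simp [F]
  let h : ι → ℂ := (measure w).wf.fix fun e ih =>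
    g e - ∑ e' : F (w e), k e e' * ih e' ((hF _ _).1 e'.2)
  have hh : ∀ e, h e = g e - ∑ e' ∈ F (w e), k e e' * h e' := fun e => by
    rw [← Finset.sum_coe_sort]
    exact (measure w).wf.fix_eq _ e
  refine ⟨h, ?_, fun e S hS => ?_⟩
  · have hb : ∀ n, ∑ e ∈ F n, u e * ‖h e‖ₑ ≤ 2 * ∑' e, u e * ‖g e‖ₑ := by
      intro n
      set A := ∑ e ∈ F n, u e * ‖h e‖ₑ with hA
      have hAtop : A ≠ ∞ := ENNReal.sum_ne_top.2 fun e _ => ENNReal.mul_ne_top (hu e) (by simp)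
      have h1 : A ≤ ∑' e, u e * ‖g e‖ₑ + 2⁻¹ * A := by
        calc A ≤ ∑ e ∈ F n, (u e * ‖g e‖ₑ + ∑ e' ∈ F n, u e * ‖k e e'‖ₑ * ‖h e'‖ₑ) := by
              refine Finset.sum_le_sum fun e he => ?_
              rw [hh e]
              calc u e * ‖g e - ∑ e' ∈ F (w e), k e e' * h e'‖ₑ
                  ≤ u e * (‖g e‖ₑ + ∑ e' ∈ F (w e), ‖k e e' * h e'‖ₑ) := by
                    gcongr
                    exact enorm_sub_le.trans (by gcongr; exact enorm_sum_le _ _)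
                _ = u e * ‖g e‖ₑ + ∑ e' ∈ F (w e), u e * ‖k e e'‖ₑ * ‖h e'‖ₑ := by
                    simp [mul_add, Finset.mul_sum, enorm_mul, mul_assoc]
                _ ≤ _ := by
                    gcongr
                    intro e' he'
                    rw [hF] at *
                    exact he'.trans he
          _ = ∑ e ∈ F n, u e * ‖g e‖ₑ +
                ∑ e' ∈ F n, (∑ e ∈ F n, u e * ‖k e e'‖ₑ) * ‖h e'‖ₑ := by
              rw [Finset.sum_add_distrib, Finset.sum_comm]
              simp [Finset.sum_mul]
          _ ≤ ∑' e, u e * ‖g e‖ₑ + ∑ e' ∈ F n, 2⁻¹ * u e' * ‖h e'‖ₑ := by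
              gcongr with e' he'
              · exact ENNReal.sum_le_tsum _
              · exact (ENNReal.sum_le_tsum _).trans (hk e')
          _ = _ := by simp [hA, Finset.mul_sum, mul_assoc]
      have h2 : A = 2⁻¹ * A + 2⁻¹ * A := by
        rw [← add_mul, ENNReal.inv_two_add_inv_two, one_mul]
      have h3 : 2⁻¹ * A ≤ ∑' e, u e * ‖g e‖ₑ := by
        refine (ENNReal.add_le_add_iff_right (a := 2⁻¹ * A)
          (ENNReal.mul_ne_top (by simp) hAtop)).1 ?_
        rwa [← h2]
      calc A = 2 * (2⁻¹ * A) := by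
            rw [← mul_assoc, ENNReal.mul_inv_cancel (by simp) (by simp), one_mul]
        _ ≤ _ := by gcongr
    refine ne_top_of_le_ne_top (ENNReal.mul_ne_top (a := 2) (by simp) hg)
      (ENNReal.summable.tsum_le_of_sum_le fun S => ?_)
    refine le_trans (Finset.sum_le_sum_of_subset fun e he => ?_) (hb (S.sup w + 1))
    exact (hF _ _).2 (Nat.lt_succ_of_le (Finset.le_sup he))
  · rw [hh e]
    congr 2
    ext e'
    rw [hF, hS]

end

section

open scoped ENNReal

theorem Set.exists_finset_subset_forall_exists_le {α : Type*} [PartialOrder α]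
    [WellQuasiOrderedLE α] (L : Set α) :
    ∃ S : Finset α, (↑S : Set α) ⊆ L ∧ ∀ e ∈ L, ∃ a ∈ S, a ≤ e := by
  have hfin : {a | Minimal (· ∈ L) a}.Finite :=
    WellQuasiOrderedLE.finite_of_isAntichain (setOfPred_minimal_antichain _)
  refine ⟨hfin.toFinset, fun a ha => (hfin.mem_toFinset.1 ha).1, fun e he => ?_⟩
  obtain ⟨b, hb, hmin⟩ := exists_minimal_le_of_wellFoundedLT (· ∈ L) e he
  exact ⟨b, hfin.mem_toFinset.2 hmin, hb⟩

theorem Set.exists_finset_subset_forall_exists_fst_eq_snd_le {J α : Type*} [Fintype J]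
    [PartialOrder α] [WellQuasiOrderedLE α] (L : Set (J × α)) :
    ∃ S : Finset (J × α), (↑S : Set (J × α)) ⊆ L ∧ ∀ e ∈ L, ∃ a ∈ S, a.1 = e.1 ∧ a.2 ≤ e.2 := by
  classical
  choose S hSL hS using fun j =>
    Set.exists_finset_subset_forall_exists_le {α : α | (j, α) ∈ L}
  refine ⟨Finset.univ.biUnion fun j => (S j).image (Prod.mk j), ?_, ?_⟩
  · rintro ⟨j, α⟩ h
    simp only [Finset.coe_biUnion, Finset.coe_image, Set.mem_iUnion] at h
    obtain ⟨j', -, α', hα', h⟩ := h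
    rw [← h]
    exact hSL j' hα'
  · rintro ⟨j, α⟩ h
    obtain ⟨a, ha, hle⟩ := hS j α h
    exact ⟨(j, a), by simpa using ha, rfl, hle⟩

theorem exists_forall_tsum_inv_pow_le_half {ι : Type*} {w : ι → ℕ} {N : ℕ} (hN : 0 < N)
    {c : ι → ℂ} (hc : ∀ e, c e ≠ 0 → N < w e) {s₀ : ℕ}
    (h : ∑' e, (w e : ℝ≥0∞)⁻¹ ^ s₀ * ‖c e‖ₑ ≠ ∞) :
    ∃ s₁, ∀ s ≥ s₁, ∑' e, (w e : ℝ≥0∞)⁻¹ ^ s * ‖c e‖ₑ ≤ 2⁻¹ * (N : ℝ≥0∞)⁻¹ ^ s := by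
  set C := ∑' e, (w e : ℝ≥0∞)⁻¹ ^ s₀ * ‖c e‖ₑ
  have hN0 : (N : ℝ≥0∞) ≠ 0 := by exact_mod_cast hN.ne'
  have hlt : (N : ℝ≥0∞) * ((N + 1 : ℕ) : ℝ≥0∞)⁻¹ < 1 := by
    rw [← div_eq_mul_inv]
    refine ENNReal.div_lt_of_lt_mul ?_
    rw [one_mul]
    exact_mod_cast Nat.lt_succ_self N
  have hlim : Filter.Tendsto (fun t : ℕ => ((N : ℝ≥0∞) * ((N + 1 : ℕ) : ℝ≥0∞)⁻¹) ^ t * C)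
      Filter.atTop (nhds 0) := by
    simpa using ENNReal.Tendsto.mul_const
      (ENNReal.tendsto_pow_atTop_nhds_zero_of_lt_one hlt) (Or.inr h)
  have hpos : 0 < 2⁻¹ * (N : ℝ≥0∞)⁻¹ ^ s₀ := by
    refine ENNReal.mul_pos (by simp) (pow_ne_zero _ ?_)
    simp
  obtain ⟨t₁, ht₁⟩ := Filter.eventually_atTop.1 (hlim.eventually_le_const hpos)
  refine ⟨s₀ + t₁, fun s hs => ?_⟩
  obtain ⟨t, rfl⟩ := Nat.exists_eq_add_of_le (le_of_add_le_left hs)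
  have ht := ht₁ t (by omega)
  calc ∑' e, (w e : ℝ≥0∞)⁻¹ ^ (s₀ + t) * ‖c e‖ₑ
      ≤ ∑' e, ((N + 1 : ℕ) : ℝ≥0∞)⁻¹ ^ t * ((w e : ℝ≥0∞)⁻¹ ^ s₀ * ‖c e‖ₑ) := by
        refine ENNReal.tsum_le_tsum fun e => ?_
        by_cases he : c e = 0
        · simp [he]
        have := hc e he
        rw [pow_add, mul_comm (_ ^ s₀), mul_assoc]
        gcongr
        exact this
    _ = ((N + 1 : ℕ) : ℝ≥0∞)⁻¹ ^ t * C := ENNReal.tsum_mul_left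
    _ = (N : ℝ≥0∞)⁻¹ ^ t * (((N : ℝ≥0∞) * ((N + 1 : ℕ) : ℝ≥0∞)⁻¹) ^ t * C) := by
        rw [mul_pow, ← mul_assoc, ← mul_assoc, ← mul_pow, ENNReal.inv_mul_cancel hN0 (by simp),
          one_pow, one_mul]
    _ ≤ (N : ℝ≥0∞)⁻¹ ^ t * (2⁻¹ * (N : ℝ≥0∞)⁻¹ ^ s₀) := by gcongr
    _ = _ := by rw [pow_add]; ring

namespace MvPowerSeries

theorem exists_forall_tsum_prod_ne_top {σ J : Type*} [Fintype J] {μ : (σ →₀ ℕ) → ℕ}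
    {w : J × (σ →₀ ℕ) → ℕ} (hw : ∀ j α, μ α ≤ w (j, α)) (hμ : ∀ α, 2 ^ α.degree ≤ μ α)
    {v : J → MvPowerSeries σ ℂ} (hv : ∀ j, IsConvergent (v j)) :
    ∃ s₀, ∀ s ≥ s₀, ∑' e, (w e : ℝ≥0∞)⁻¹ ^ s * ‖coeff e.2 (v e.1)‖ₑ ≠ ∞ := by
  choose t ht using fun j => (hv j).exists_tsum_ne_top hμ
  refine ⟨Finset.univ.sup t, fun s hs => ?_⟩
  rw [ENNReal.tsum_prod (f := fun j α => (w (j, α) : ℝ≥0∞)⁻¹ ^ s * ‖coeff α (v j)‖ₑ),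
    tsum_fintype]
  refine ENNReal.sum_ne_top.2 fun j _ => ne_top_of_le_ne_top (ht j) ?_
  refine ENNReal.tsum_le_tsum fun α => ?_
  gcongr ?_ * _
  calc (w (j, α) : ℝ≥0∞)⁻¹ ^ s ≤ (w (j, α) : ℝ≥0∞)⁻¹ ^ t j := by
        refine pow_le_pow_right_of_le_one' ?_ ((Finset.le_sup (Finset.mem_univ j)).trans hs)
        rw [ENNReal.inv_le_one]
        exact_mod_cast Nat.one_le_two_pow.trans ((hμ α).trans (hw j α))
    _ ≤ _ := by
        gcongr
        exact hw j α

end MvPowerSeries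

end

section

open scoped ENNReal

namespace MvPowerSeries

/-- The set of leading exponents, with respect to the weight `w`, of a set `M` of vectors of
power series. -/
def leadingExponents {σ J : Type*} (w : J × (σ →₀ ℕ) → ℕ) (M : Set (J → MvPowerSeries σ ℂ)) :
    Set (J × (σ →₀ ℕ)) :=
  {e | ∃ v ∈ M, coeff e.2 (v e.1) = 1 ∧ ∀ e', w e' < w e → coeff e'.2 (v e'.1) = 0}

theorem exists_mem_coeff_eq_on_leadingExponents {σ J : Type*} [Fintype σ] [Fintype J]
    {μ : (σ →₀ ℕ) → ℕ} {w : J × (σ →₀ ℕ) → ℕ} {P : ℕ} (hinj : w.Injective)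
    (hadd : ∀ j α β, w (j, α + β) = μ β * w (j, α)) (hμw : ∀ j α, μ α ≤ w (j, α))
    (hμ : ∀ α, 2 ^ α.degree ≤ μ α) (hμP : ∀ α, μ α ≤ P ^ α.degree)
    (M : Submodule (convergent σ) (J → MvPowerSeries σ ℂ))
    (hM : ∀ v ∈ M, ∀ j, IsConvergent (v j)) {g : J → MvPowerSeries σ ℂ}
    (hg : ∀ j, IsConvergent (g j)) :
    ∃ v ∈ M, ∀ e ∈ leadingExponents w M, coeff e.2 (v e.1) = coeff e.2 (g e.1) := by
  classical
  set L := leadingExponents w (M : Set (J → MvPowerSeries σ ℂ))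
  have hμ0 : ∀ α, 0 < μ α := fun α => (Nat.pow_pos two_pos).trans_le (hμ α)
  have hw0 : ∀ e, 0 < w e := fun e => (hμ0 e.2).trans_le (hμw e.1 e.2)
  obtain ⟨S, hSL, hS⟩ := Set.exists_finset_subset_forall_exists_fst_eq_snd_le L
  choose! m hmM hm1 hm0 using fun a (ha : a ∈ S) => hSL ha
  choose! l hlS hl1 hl2 using hS
  have hgt : ∀ a ∈ S, ∀ e, coeff e.2 (m a e.1) ≠ 0 → w a ≤ w e := fun a ha e he => by
    by_contra hlt
    exact he (hm0 a ha e (not_le.1 hlt))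
  obtain ⟨s, hsg, hsm⟩ : ∃ s, (∑' e, (w e : ℝ≥0∞)⁻¹ ^ s * ‖coeff e.2 (g e.1)‖ₑ ≠ ∞) ∧
      ∀ a ∈ S, ∑' e, (w e : ℝ≥0∞)⁻¹ ^ s * ‖if e = a then 0 else coeff e.2 (m a e.1)‖ₑ ≤
        2⁻¹ * (w a : ℝ≥0∞)⁻¹ ^ s := by
    obtain ⟨s₀, hs₀⟩ := exists_forall_tsum_prod_ne_top hμw hμ hg
    have : ∀ a ∈ S, ∃ s₁, ∀ s ≥ s₁,
        ∑' e, (w e : ℝ≥0∞)⁻¹ ^ s * ‖if e = a then 0 else coeff e.2 (m a e.1)‖ₑ ≤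
          2⁻¹ * (w a : ℝ≥0∞)⁻¹ ^ s := by
      intro a ha
      obtain ⟨s₁, hs₁⟩ := exists_forall_tsum_prod_ne_top hμw hμ (hM _ (hmM a ha))
      refine exists_forall_tsum_inv_pow_le_half (s₀ := s₁) (hw0 a) (fun e he => ?_)
        (ne_top_of_le_ne_top (hs₁ s₁ le_rfl) (ENNReal.tsum_le_tsum fun e => ?_))
      · rw [ne_eq, ite_eq_left_iff, not_forall] at he
        obtain ⟨hea, he⟩ := he
        exact lt_of_le_of_ne (hgt a ha e he) fun h => hea (hinj h).symm
      · gcongr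
        split_ifs <;> simp
    choose! s₁ hs₁ using this
    exact ⟨max s₀ (S.sup s₁), hs₀ _ (le_max_left _ _), fun a ha =>
      hs₁ a ha _ ((Finset.le_sup ha).trans (le_max_right _ _))⟩
  let u : J × (σ →₀ ℕ) → ℝ≥0∞ := fun e => (w e : ℝ≥0∞)⁻¹ ^ s
  have hu0 : ∀ e, u e ≠ 0 := fun e => pow_ne_zero _ (by simp)
  have hutop : ∀ e, u e ≠ ∞ := fun e => ENNReal.pow_ne_top (by simpa using (hw0 e).ne')
  have huadd : ∀ j α β, u (j, α + β) = (μ β : ℝ≥0∞)⁻¹ ^ s * u (j, α) := fun j α β => by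
    simp only [u]
    rw [hadd, Nat.cast_mul, ENNReal.mul_inv (by simp) (by simp), mul_pow]
  let t : J × (σ →₀ ℕ) → J × (σ →₀ ℕ) → ℂ := fun e' e =>
    if e'.2 - (l e').2 ≤ e.2 then coeff (e.2 - (e'.2 - (l e').2)) (m (l e') e.1) else 0
  let k : J × (σ →₀ ℕ) → J × (σ →₀ ℕ) → ℂ := fun e e' =>
    if e ∈ L ∧ e' ∈ L ∧ e ≠ e' then t e' e else 0
  have hl : ∀ e ∈ L, e = ((l e).1, (l e).2 + (e.2 - (l e).2)) := fun e he =>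
    Prod.ext (hl1 e he).symm (add_tsub_cancel_of_le (hl2 e he)).symm
  have hk : ∀ e', ∑' e, u e * ‖k e e'‖ₑ ≤ 2⁻¹ * u e' := by
    intro e'
    by_cases he' : e' ∈ L
    · set a := l e' with ha
      set β := e'.2 - a.2 with hβ
      have he'a : e' = (a.1, a.2 + β) := hl e' he'
      have hshift : Function.Injective fun e : J × (σ →₀ ℕ) => (e.1, e.2 + β) := by
        rintro ⟨j, α⟩ ⟨j', α'⟩ h
        simpa using h
      have hue' : u e' = (μ β : ℝ≥0∞)⁻¹ ^ s * u a := by rw [he'a, huadd]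
      calc ∑' e, u e * ‖k e e'‖ₑ
          ≤ ∑' e, u e * ‖if e = e' then 0 else t e' e‖ₑ := by
            refine ENNReal.tsum_le_tsum fun e => ?_
            gcongr
            by_cases hee : e = e'
            · simp [k, hee]
            · simp only [k, if_neg hee]
              split_ifs <;> simp
        _ = ∑' e : J × (σ →₀ ℕ), u (e.1, e.2 + β) *
              ‖if (e.1, e.2 + β) = e' then 0 else t e' (e.1, e.2 + β)‖ₑ := by
            refine (hshift.tsum_eq fun e he => ?_).symm
            have hle : β ≤ e.2 := by
              by_contra hn
              refine he ?_
              simp [t, ← ha, ← hβ, hn, -tsub_le_iff_right]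
            exact ⟨(e.1, e.2 - β), Prod.ext rfl (tsub_add_cancel_of_le hle)⟩
        _ = ∑' e, (μ β : ℝ≥0∞)⁻¹ ^ s *
              (u e * ‖if e = a then 0 else coeff e.2 (m a e.1)‖ₑ) := by
            refine tsum_congr fun e => ?_
            have h1 : (e.1, e.2 + β) = e' ↔ e = a := by
              rw [he'a]
              exact hshift.eq_iff
            have h2 : t e' (e.1, e.2 + β) = coeff e.2 (m a e.1) := by
              simp [t, ← ha, ← hβ, -tsub_le_iff_right]
            rw [huadd, h2, mul_assoc]
            simp only [h1]
        _ ≤ (μ β : ℝ≥0∞)⁻¹ ^ s * (2⁻¹ * u a) := by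
            rw [ENNReal.tsum_mul_left]
            gcongr
            exact hsm a (hlS e' he')
        _ = _ := by rw [hue']; ring
    · simp [k, he']
  obtain ⟨h, hfin, hrec⟩ := exists_solution_of_strictlyTriangular hinj k
    (fun e => if e ∈ L then coeff e.2 (g e.1) else 0) u hutop hk
    (ne_top_of_le_ne_top hsg (ENNReal.tsum_le_tsum fun e => by
      gcongr
      split_ifs <;> simp))
  let q : J × (σ →₀ ℕ) → MvPowerSeries σ ℂ := fun a β =>
    if (a.1, a.2 + β) ∈ L ∧ l (a.1, a.2 + β) = a then h (a.1, a.2 + β) else 0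
  have hqc : ∀ a β, coeff β (q a) =
    if (a.1, a.2 + β) ∈ L ∧ l (a.1, a.2 + β) = a then h (a.1, a.2 + β) else 0 := fun a β => rfl
  have hq : ∀ a, IsConvergent (q a) := by
    intro a
    refine isConvergent_of_tsum_ne_top (s := s) hμP fun htop => hfin ?_
    have hshift : Function.Injective fun β : σ →₀ ℕ => (a.1, a.2 + β) := fun β β' h => by
      simpa using h
    rw [← top_le_iff]
    refine le_trans ?_ (ENNReal.tsum_comp_le_tsum_of_injective hshift _)
    calc ∞ = (∑' β, (μ β : ℝ≥0∞)⁻¹ ^ s * ‖coeff β (q a)‖ₑ) * u a := by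
          rw [htop, ENNReal.top_mul (hu0 a)]
      _ = ∑' β, (μ β : ℝ≥0∞)⁻¹ ^ s * ‖coeff β (q a)‖ₑ * u a := ENNReal.tsum_mul_right.symm
      _ ≤ _ := by
          refine ENNReal.tsum_le_tsum fun β => ?_
          rw [huadd, mul_right_comm, hqc]
          gcongr
          split_ifs <;> simp
  refine ⟨∑ a ∈ S, (⟨q a, hq a⟩ : convergent σ) • m a,
    M.sum_mem fun a ha => M.smul_mem _ (hmM a ha), fun e he => ?_⟩
  let F : ℕ → Finset (J × (σ →₀ ℕ)) := fun n => ((Set.finite_lt_nat n).preimage hinj.injOn).toFinset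
  have hF : ∀ n e, e ∈ F n ↔ w e < n := fun n e => by simp [F]
  have hsum : ∀ a ∈ S, ∑ p ∈ Finset.HasAntidiagonal.antidiagonal e.2,
      coeff p.1 (q a) * coeff p.2 (m a e.1) =
      ∑ e' ∈ F (w e + 1), if e' ∈ L ∧ l e' = a then h e' * t e' e else 0 := by
    intro a ha
    refine Finset.sum_bij_ne_zero (fun p _ _ => (a.1, a.2 + p.1)) ?_ ?_ ?_ ?_
    · intro p hp hne
      rw [hF, Nat.lt_succ_iff, hadd, ← Finset.HasAntidiagonal.mem_antidiagonal.1 hp |> fun h =>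
        (Prod.ext rfl (by rw [add_comm, h]) : (e.1, p.2 + p.1) = e), hadd]
      exact Nat.mul_le_mul_left _ (hgt a ha (e.1, p.2) (right_ne_zero_of_mul hne))
    · intro p hp _ p' hp' _ heq
      have h1 : p.1 = p'.1 := by simpa using heq
      rw [Finset.HasAntidiagonal.mem_antidiagonal] at hp hp'
      refine Prod.ext h1 (add_left_cancel (a := p.1) ?_)
      rw [hp, h1, hp']
    · intro e' _ hne
      have hc : e' ∈ L ∧ l e' = a := by
        by_contra hn
        exact hne (if_neg hn)
      rw [if_pos hc] at hne
      have hle : e'.2 - a.2 ≤ e.2 := by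
        by_contra hn
        exact right_ne_zero_of_mul hne (by simp [t, hc.2, hn, -tsub_le_iff_right])
      have hea : (a.1, a.2 + (e'.2 - a.2)) = e' := by
        have := hl e' hc.1
        rw [hc.2] at this
        exact this.symm
      refine ⟨(e'.2 - a.2, e.2 - (e'.2 - a.2)), ?_, ?_, hea⟩
      · exact Finset.HasAntidiagonal.mem_antidiagonal.2 (add_tsub_cancel_of_le hle)
      · rw [hqc, hea, if_pos hc]
        simpa only [t, hc.2, if_pos hle] using hne
    · intro p hp hne
      have hc : (a.1, a.2 + p.1) ∈ L ∧ l (a.1, a.2 + p.1) = a := by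
        by_contra hn
        exact left_ne_zero_of_mul hne (by rw [hqc, if_neg hn])
      rw [Finset.HasAntidiagonal.mem_antidiagonal] at hp
      rw [hqc, if_pos hc, if_pos hc]
      simp [t, hc.2, ← hp, -tsub_le_iff_right]
  have hval : coeff e.2 ((∑ a ∈ S, (⟨q a, hq a⟩ : convergent σ) • m a) e.1) =
      ∑ e' ∈ F (w e + 1), if e' ∈ L then h e' * t e' e else 0 := by
    have : ∀ a, ((⟨q a, hq a⟩ : convergent σ) • m a) e.1 = q a * m a e.1 := fun a => rfl
    rw [Finset.sum_apply, map_sum]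
    simp only [this, coeff_mul]
    rw [Finset.sum_congr rfl hsum, Finset.sum_comm]
    refine Finset.sum_congr rfl fun e' _ => ?_
    by_cases he' : e' ∈ L
    · simp [he', hlS e' he']
    · simp [he']
  have hFe : F (w e + 1) = insert e (F (w e)) := by
    ext e'
    rw [Finset.mem_insert, hF, hF, Nat.lt_succ_iff, le_iff_eq_or_lt, hinj.eq_iff]
  rw [hval, hFe, Finset.sum_insert (by simp [hF]), if_pos he]
  have htt : t e e = 1 := by
    simp only [t]
    rw [if_pos tsub_le_self, tsub_tsub_cancel_of_le (hl2 e he), ← hl1 e he]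
    exact hm1 _ (hlS e he)
  rw [htt, mul_one, hrec e (F (w e)) (hF _), if_pos he, sub_add_eq_add_sub, sub_eq_iff_eq_add]
  congr 1
  refine Finset.sum_congr rfl fun e' he' => ?_
  have hne : e ≠ e' := fun h0 => by
    rw [hF, h0] at he'
    exact lt_irrefl _ he'
  by_cases h' : e' ∈ L <;> simp [k, he, h', hne, mul_comm]

/-- A submodule over the ring of convergent power series is closed in the adic topology. -/
theorem mem_of_forall_exists_coeff_eq {σ J : Type*} [Fintype σ] [Fintype J]
    (M : Submodule (convergent σ) (J → MvPowerSeries σ ℂ))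
    (hM : ∀ v ∈ M, ∀ j, IsConvergent (v j)) {g : J → MvPowerSeries σ ℂ}
    (hg : ∀ j, IsConvergent (g j))
    (happ : ∀ k : ℕ, ∃ v ∈ M, ∀ j (α : σ →₀ ℕ), α.degree < k → coeff α (v j) = coeff α (g j)) :
    g ∈ M := by
  obtain ⟨μ, w, P, hinj, hadd, hμw, hμ, hμP⟩ := exists_monomial_weight σ J
  obtain ⟨v, hvM, hv⟩ := exists_mem_coeff_eq_on_leadingExponents hinj hadd hμw hμ hμP M hM hg
  suffices h : ∀ e : J × (σ →₀ ℕ), coeff e.2 (v e.1) = coeff e.2 (g e.1) by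
    have : v = g := funext fun j => MvPowerSeries.ext fun α => h (j, α)
    exact this ▸ hvM
  by_contra! hne
  obtain ⟨e, he, hmin⟩ := WellFounded.has_min (measure w).wf
    {e : J × (σ →₀ ℕ) | coeff e.2 (v e.1) ≠ coeff e.2 (g e.1)} hne
  obtain ⟨v', hv'M, hv'⟩ := happ (w e)
  have hlow : ∀ e' : J × (σ →₀ ℕ), w e' ≤ w e → coeff e'.2 (v' e'.1) = coeff e'.2 (g e'.1) := by
    intro e' he'
    refine hv' _ _ (Nat.lt_two_pow_self.trans_le ?_)
    exact (hμ _).trans ((hμw e'.1 _).trans he')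
  set c := coeff e.2 (v' e.1) - coeff e.2 (v e.1) with hc
  have hc0 : c ≠ 0 := by
    rw [hc, hlow e le_rfl, sub_ne_zero]
    exact Ne.symm he
  refine he (hv e ⟨(⟨C c⁻¹, .C _⟩ : convergent σ) • (v' - v),
    M.smul_mem _ (M.sub_mem hv'M hvM), ?_, fun e' he' => ?_⟩)
  · change coeff e.2 (C c⁻¹ * (v' e.1 - v e.1)) = 1
    rw [coeff_C_mul, map_sub, ← hc, inv_mul_cancel₀ hc0]
  · change coeff e'.2 (C c⁻¹ * (v' e'.1 - v e'.1)) = 0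
    have : coeff e'.2 (v e'.1) = coeff e'.2 (g e'.1) := by
      by_contra hn
      exact hmin e' hn he'
    rw [coeff_C_mul, map_sub, hlow e' he'.le, this, sub_self, mul_zero]

end MvPowerSeries

end

section

namespace MvPowerSeries

variable {σ ι : Type*} [Fintype ι]

theorem IsConvergent.matrix_mul {F G : Matrix ι ι (MvPowerSeries σ ℂ)}
    (hF : ∀ i j, IsConvergent (F i j)) (hG : ∀ i j, IsConvergent (G i j)) (i j : ι) :
    IsConvergent ((F * G) i j) := by
  rw [Matrix.mul_apply]
  exact .sum fun l _ => (hF i l).mul (hG l j)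

/-- The vectors of the form `H * B - A * H`, where `H` has convergent entries without constant
terms. -/
def commutatorSubmodule (A B : Matrix ι ι (MvPowerSeries σ ℂ)) :
    Submodule (convergent σ) (ι × ι → MvPowerSeries σ ℂ) where
  carrier := {v | ∃ H : Matrix ι ι (MvPowerSeries σ ℂ), (∀ i j, IsConvergent (H i j)) ∧
    (∀ i j, constantCoeff (H i j) = 0) ∧ ∀ p, v p = (H * B - A * H) p.1 p.2}
  zero_mem' := ⟨0, fun _ _ => .zero, by simp, by simp⟩
  add_mem' := by
    rintro v v' ⟨H, hH, h0, hv⟩ ⟨H', hH', h0', hv'⟩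
    refine ⟨H + H', fun i j => (hH i j).add (hH' i j), fun i j => by simp [h0, h0'], fun p => ?_⟩
    rw [Pi.add_apply, hv, hv', ← Matrix.add_apply, add_mul, mul_add, add_sub_add_comm]
  smul_mem' := by
    rintro ⟨c, hc⟩ v ⟨H, hH, h0, hv⟩
    refine ⟨c • H, fun i j => hc.mul (hH i j), fun i j => by simp [h0], fun p => ?_⟩
    change c * v p = _
    rw [hv, Matrix.smul_mul, Matrix.mul_smul, ← smul_sub]
    rfl

theorem exists_isConvergent_mul_eq_mul [Fintype σ] {A B : Matrix ι ι (MvPowerSeries σ ℂ)}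
    (hA : ∀ i j, IsConvergent (A i j)) (hB : ∀ i j, IsConvergent (B i j)) (Φ : Matrix ι ι ℂ)
    (h : ∀ k : ℕ, ∃ H : Matrix ι ι (MvPowerSeries σ ℂ), (∀ i j, IsConvergent (H i j)) ∧
      (∀ i j, constantCoeff (H i j) = Φ i j) ∧
      ∀ i j (α : σ →₀ ℕ), α.degree < k → coeff α ((H * B - A * H) i j) = 0) :
    ∃ H : Matrix ι ι (MvPowerSeries σ ℂ), (∀ i j, IsConvergent (H i j)) ∧
      (∀ i j, constantCoeff (H i j) = Φ i j) ∧ H * B = A * H := by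
  obtain ⟨F, hF, hFΦ⟩ : ∃ F : Matrix ι ι (MvPowerSeries σ ℂ),
      (∀ i j, IsConvergent (F i j)) ∧ ∀ i j, constantCoeff (F i j) = Φ i j :=
    ⟨Matrix.of fun i j => C (Φ i j), fun i j => .C _, fun i j => by simp⟩
  have hsub : ∀ H : Matrix ι ι (MvPowerSeries σ ℂ), (∀ i j, IsConvergent (H i j)) →
      ∀ i j, IsConvergent ((H * B - A * H) i j) :=
    fun H hH i j => (IsConvergent.matrix_mul hH hB i j).sub (IsConvergent.matrix_mul hA hH i j)
  obtain ⟨H, hH, h0, hg⟩ : (fun p : ι × ι => (F * B - A * F) p.1 p.2) ∈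
      commutatorSubmodule A B := by
    refine mem_of_forall_exists_coeff_eq _ ?_ (fun p => hsub _ hF _ _) fun k => ?_
    · rintro v ⟨H, hH, -, hv⟩ p
      rw [hv]
      exact hsub H hH _ _
    · obtain ⟨H, hH, h0, hk⟩ := h k
      refine ⟨fun p => ((F - H) * B - A * (F - H)) p.1 p.2,
        ⟨F - H, fun i j => (hF i j).sub (hH i j), fun i j => by simp [h0, hFΦ], fun p => rfl⟩,
        fun p α hα => ?_⟩
      have hFH : (F - H) * B - A * (F - H) = (F * B - A * F) - (H * B - A * H) := by
        rw [sub_mul, mul_sub, sub_sub_sub_comm]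
      beta_reduce
      rw [hFH, Matrix.sub_apply _ (H * B - A * H), map_sub, hk _ _ _ hα, sub_zero]
  refine ⟨F - H, fun i j => (hF i j).sub (hH i j), fun i j => by simp [h0, hFΦ], ?_⟩
  have hg' : F * B - A * F = H * B - A * H := by
    ext1 i j
    exact hg (i, j)
  rw [sub_mul, mul_sub, sub_eq_sub_iff_sub_eq_sub]
  exact hg'

end MvPowerSeries

end

section

open scoped ComplexConjugate Topology Nat
open Asymptotics

theorem Polynomial.coeff_eq_zero_of_isBigO_pow {p : Polynomial ℂ} {k : ℕ}
    (h : (fun t : ℝ => p.eval (t : ℂ)) =O[𝓝[≠] 0] fun t => t ^ k) {n : ℕ} (hn : n < k) :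
    p.coeff n = 0 := by
  induction k generalizing p n with
  | zero => simp at hn
  | succ k ih =>
    have hev : Filter.Tendsto (fun t : ℝ => p.eval (t : ℂ)) (𝓝[≠] 0) (𝓝 (p.coeff 0)) := by
      have : Continuous fun t : ℝ => p.eval (t : ℂ) := by fun_prop
      rw [Polynomial.coeff_zero_eq_eval_zero]
      simpa using (this.tendsto 0).mono_left nhdsWithin_le_nhds
    have h0 : p.coeff 0 = 0 := by
      refine tendsto_nhds_unique hev (h.trans_tendsto ?_)
      have : Filter.Tendsto (fun t : ℝ => t ^ (k + 1)) (𝓝 0) (𝓝 (0 ^ (k + 1))) :=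
        (continuous_pow _).tendsto 0
      simpa using this.mono_left nhdsWithin_le_nhds
    cases n with
    | zero => exact h0
    | succ n =>
      rw [← Polynomial.coeff_divX]
      refine ih ?_ (Nat.succ_lt_succ_iff.1 hn)
      have hinv : (fun t : ℝ => (t : ℂ)⁻¹) =O[𝓝[≠] 0] fun t : ℝ => t⁻¹ :=
        IsBigO.of_bound 1 (by simp)
      refine (hinv.mul h).congr' ?_ ?_
      · filter_upwards [self_mem_nhdsWithin] with t ht
        have ht : (t : ℂ) ≠ 0 := by simpa using ht
        conv_lhs => rw [← Polynomial.X_mul_divX_add p, h0]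
        simp [ht]
      · filter_upwards [self_mem_nhdsWithin] with t ht
        have ht : t ≠ 0 := by simpa using ht
        rw [pow_succ']
        field_simp

theorem ContDiffAt.isBigO_sub_taylor {E F : Type*} [NormedAddCommGroup E] [NormedSpace ℝ E]
    [NormedAddCommGroup F] [NormedSpace ℝ F] [CompleteSpace F] {f : E → F} {x : E} {n : ℕ}
    (hf : ContDiffAt ℝ (n + 1) f x) :
    (fun y => f (x + y) - ∑ k ∈ Finset.range (n + 1),
      (k ! : ℝ)⁻¹ • iteratedFDeriv ℝ k f x fun _ => y) =O[𝓝 0] fun y => ‖y‖ ^ (n + 1) := by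
  have hcont : ContinuousAt (iteratedFDeriv ℝ (n + 1) f) x :=
    (hf.iteratedFDeriv_right (i := n + 1) (m := 0) (by simp)).continuousAt
  have hbd : ∀ᶠ y in 𝓝 x, ‖iteratedFDeriv ℝ (n + 1) f y‖ < ‖iteratedFDeriv ℝ (n + 1) f x‖ + 1 :=
    hcont.norm.eventually_lt_const (by simp)
  have hcd : ∀ᶠ y in 𝓝 x, ContDiffAt ℝ (n + 1) f y := by
    refine hf.eventually ?_
    exact_mod_cast WithTop.coe_ne_top
  obtain ⟨r, hr, hball⟩ := Metric.eventually_nhds_iff_ball.1 (hbd.and hcd)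
  set C := ‖iteratedFDeriv ℝ (n + 1) f x‖ + 1
  refine IsBigO.of_bound C ?_
  filter_upwards [Metric.ball_mem_nhds 0 hr] with y hy
  have hmem : ∀ t ∈ Set.Icc (0 : ℝ) 1, x + t • y ∈ Metric.ball x r := by
    intro t ht
    rw [mem_ball_zero_iff] at hy
    rw [mem_ball_iff_norm, add_sub_cancel_left, norm_smul, Real.norm_of_nonneg ht.1]
    exact (mul_le_of_le_one_left (norm_nonneg _) ht.2).trans_lt hy
  rw [map_add_eq_sum_add_integral_iteratedFDeriv fun t ht => (hball _ (hmem t ht)).2,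
    add_sub_cancel_left, norm_smul, norm_inv, Real.norm_natCast, norm_pow, norm_norm]
  refine (mul_le_of_le_one_left (norm_nonneg _) ?_).trans ?_
  · exact inv_le_one_of_one_le₀ (by exact_mod_cast Nat.one_le_iff_ne_zero.2 n.factorial_ne_zero)
  · refine (intervalIntegral.norm_integral_le_of_norm_le_const (C := C * ‖y‖ ^ (n + 1))
      fun t ht => ?_).trans (by simp)
    rw [Set.uIoc_of_le zero_le_one] at ht
    have ht' : t ∈ Set.Icc (0 : ℝ) 1 := ⟨ht.1.le, ht.2⟩
    rw [norm_smul, norm_pow, Real.norm_of_nonneg (sub_nonneg.2 ht.2)]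
    refine (mul_le_of_le_one_left (norm_nonneg _)
      (pow_le_one₀ (sub_nonneg.2 ht.2) (by linarith [ht.1]))).trans ?_
    refine (ContinuousMultilinearMap.le_opNorm _ _).trans ?_
    rw [Finset.prod_const, Finset.card_univ, Fintype.card_fin]
    gcongr
    exact (hball _ (hmem t ht')).1.le

namespace MvPolynomial

theorem coeff_aeval_C_mul_X {τ : Type*} [Fintype τ] (x : τ → ℂ) (Q : MvPolynomial τ ℂ) (n : ℕ) :
    (aeval (fun s => Polynomial.C (x s) * Polynomial.X) Q).coeff n =
      eval x (homogeneousComponent n Q) := by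
  induction Q using MvPolynomial.induction_on' with
  | monomial m a =>
    have h1 : aeval (fun s => Polynomial.C (x s) * Polynomial.X) (monomial m a) =
        Polynomial.C (eval x (monomial m a)) * Polynomial.X ^ m.degree := by
      rw [aeval_monomial, eval_monomial, Finsupp.degree_eq_sum, Finsupp.prod_fintype _ _ (by simp),
        Finsupp.prod_fintype _ _ (by simp)]
      simp [mul_pow, Finset.prod_mul_distrib, Finset.prod_pow_eq_pow_sum, mul_assoc]
    rw [h1, Polynomial.coeff_C_mul_X_pow]
    split_ifs with h
    · rw [homogeneousComponent_of_mem (isHomogeneous_monomial a rfl), if_pos h]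
    · rw [homogeneousComponent_of_mem (isHomogeneous_monomial a rfl), if_neg h, map_zero]
  | add p q hp hq => simp [hp, hq]

variable {σ : Type*}

/-- Evaluation of a polynomial in the coordinates of `z` and their complex conjugates. -/
noncomputable def evalConj (z : σ → ℂ) : MvPolynomial (σ ⊕ σ) ℂ →+* ℂ :=
  eval (Sum.elim z fun i => conj (z i))

theorem eq_zero_of_forall_evalConj_eq_zero [Finite σ] {Q : MvPolynomial (σ ⊕ σ) ℂ}
    (h : ∀ z, evalConj z Q = 0) : Q = 0 := by
  let ψ : MvPolynomial (σ ⊕ σ) ℂ →ₐ[ℂ] MvPolynomial (σ ⊕ σ) ℂ :=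
    aeval (Sum.elim (fun i => X (.inl i) + C Complex.I * X (.inr i))
      fun i => X (.inl i) - C Complex.I * X (.inr i))
  have hψ : ∀ a : σ ⊕ σ → ℂ, eval a (ψ Q) = eval (Sum.elim
      (fun i => a (.inl i) + Complex.I * a (.inr i))
      fun i => a (.inl i) - Complex.I * a (.inr i)) Q := by
    intro a
    refine RingHom.congr_fun (f := (eval a).comp ψ.toRingHom) (ringHom_ext ?_ ?_) Q
    · simp
    · rintro (i | i) <;> simp [ψ]
  have hψ0 : ψ Q = 0 := by
    refine funext_set (fun _ => Set.range ((↑) : ℝ → ℂ))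
      (fun _ => Set.infinite_range_of_injective Complex.ofReal_injective) fun a ha => ?_
    rw [map_zero, hψ, ← h fun i => a (.inl i) + Complex.I * a (.inr i), evalConj]
    congr 3
    funext i
    obtain ⟨x, hx⟩ := ha (.inl i) trivial
    obtain ⟨y, hy⟩ := ha (.inr i) trivial
    simp [← hx, ← hy, sub_eq_add_neg]
  refine funext fun b => ?_
  have := hψ (Sum.elim (fun i => (b (.inl i) + b (.inr i)) / 2)
    fun i => (b (.inl i) - b (.inr i)) / (2 * Complex.I))
  rw [hψ0, map_zero] at this
  rw [map_zero, this]
  congr 2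
  funext s
  rcases s with i | i
  · simp
    field_simp
    ring
  · simp
    field_simp
    ring

end MvPolynomial

end

section

open scoped ComplexConjugate Topology Nat
open Asymptotics

namespace MvPolynomial

variable {σ : Type*}

theorem continuous_evalConj (Q : MvPolynomial (σ ⊕ σ) ℂ) : Continuous fun z => evalConj z Q := by
  refine Continuous.comp (g := fun x : σ ⊕ σ → ℂ => eval x Q) (continuous_eval Q)
    (continuous_pi ?_)
  rintro (i | i) <;> simp only [Sum.elim_inl, Sum.elim_inr] <;> fun_prop

theorem evalConj_isBigO_one (Q : MvPolynomial (σ ⊕ σ) ℂ) :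
    (fun z => evalConj z Q) =O[𝓝 0] fun _ => (1 : ℝ) :=
  ((continuous_evalConj Q).tendsto 0).isBigO_one ℝ

variable [Fintype σ]

/-- `Q`, a polynomial in `z` and its conjugate, approximates `f` at the origin to order `k`. -/
def IsJet (k : ℕ) (Q : MvPolynomial (σ ⊕ σ) ℂ) (f : (σ → ℂ) → ℂ) : Prop :=
  (fun z => f z - evalConj z Q) =O[𝓝 0] fun z => ‖z‖ ^ k

namespace IsJet

variable {k : ℕ} {P Q : MvPolynomial (σ ⊕ σ) ℂ} {f g : (σ → ℂ) → ℂ}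

theorem congr (hf : IsJet k Q f) (h : f =ᶠ[𝓝 0] g) : IsJet k Q g :=
  hf.congr' (h.mono fun z hz => by simp [hz]) .rfl

theorem isBigO_one (hf : IsJet k Q f) : f =O[𝓝 0] fun _ => (1 : ℝ) := by
  have h1 : (fun z : σ → ℂ => ‖z‖ ^ k) =O[𝓝 0] fun _ => (1 : ℝ) :=
    (((continuous_norm (E := σ → ℂ)).pow k).tendsto 0).isBigO_one ℝ
  simpa using (hf.trans h1).add (evalConj_isBigO_one Q)

theorem sub (hf : IsJet k P f) (hg : IsJet k Q g) : IsJet k (P - Q) (f - g) := by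
  refine (IsBigO.sub hf hg).congr_left fun z => ?_
  simp only [Pi.sub_apply, map_sub]
  ring

theorem sum {ι : Type*} {s : Finset ι} {P : ι → MvPolynomial (σ ⊕ σ) ℂ} {f : ι → (σ → ℂ) → ℂ}
    (h : ∀ i ∈ s, IsJet k (P i) (f i)) : IsJet k (∑ i ∈ s, P i) (∑ i ∈ s, f i) := by
  refine (IsBigO.sum h).congr_left fun z => ?_
  simp [map_sum]

theorem mul (hf : IsJet k P f) (hg : IsJet k Q g) : IsJet k (P * Q) (f * g) := by
  have h1 := IsBigO.mul hf hg.isBigO_one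
  have h2 := IsBigO.mul (evalConj_isBigO_one P) hg
  simp only [mul_one, one_mul] at h1 h2
  refine (h1.add h2).congr_left fun z => ?_
  simp only [Pi.mul_apply, map_mul]
  ring

theorem coeff_zero (hk : k ≠ 0) (hf : IsJet k Q f) : coeff 0 Q = f 0 := by
  have h : f 0 - evalConj 0 Q = 0 := by
    refine IsBigO.eq_zero_of_norm_pow (f := fun z => f z - evalConj z Q) (n := k) ?_ hk
    simp only [sub_zero]
    exact hf
  have h0 : (Sum.elim (0 : σ → ℂ) fun i => conj ((0 : σ → ℂ) i)) = 0 := by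
    funext s
    rcases s with i | i <;> simp
  rw [sub_eq_zero.1 h, evalConj, h0, eval_zero, constantCoeff_eq]

theorem coeff_eq_zero (h : IsJet k Q 0) {m : σ ⊕ σ →₀ ℕ} (hm : m.degree < k) : coeff m Q = 0 := by
  have hh : homogeneousComponent m.degree Q = 0 := by
    refine eq_zero_of_forall_evalConj_eq_zero fun z => ?_
    rw [evalConj, ← coeff_aeval_C_mul_X]
    refine Polynomial.coeff_eq_zero_of_isBigO_pow (k := k) ?_ hm
    have ht : Filter.Tendsto (fun t : ℝ => (t : ℂ) • z) (𝓝[≠] 0) (𝓝 0) := by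
      have : Continuous fun t : ℝ => (t : ℂ) • z := by fun_prop
      simpa using (this.tendsto 0).mono_left nhdsWithin_le_nhds
    have h1 := (IsBigO.comp_tendsto h ht).neg_left
    have h2 : (fun t : ℝ => ‖(t : ℂ) • z‖ ^ k) =O[𝓝[≠] 0] fun t => t ^ k := by
      refine IsBigO.of_bound (‖z‖ ^ k) (Filter.Eventually.of_forall fun t => ?_)
      simp [norm_smul, mul_pow, mul_comm]
    refine (h1.trans h2).congr_left fun t => ?_
    simp only [Function.comp_apply, Pi.zero_apply, zero_sub, neg_neg]
    rw [evalConj]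
    refine RingHom.congr_fun (f := eval _) (g := (Polynomial.evalRingHom (t : ℂ)).comp
      (aeval fun s => Polynomial.C ((Sum.elim z fun i => conj (z i)) s) * Polynomial.X).toRingHom)
      (ringHom_ext ?_ ?_) Q
    · intro r
      simp only [eval_C, RingHom.comp_apply, AlgHom.toRingHom_eq_coe, RingHom.coe_coe, algHom_C,
        Polynomial.algebraMap_eq, Polynomial.coe_evalRingHom, Polynomial.eval_C]
    · rintro (i | i) <;> simp [mul_comm (t : ℂ)]
  have := coeff_homogeneousComponent m.degree Q m
  rw [hh, if_pos rfl, MvPolynomial.coeff_zero] at this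
  exact this.symm

end IsJet

end MvPolynomial

end

section

open scoped Topology

namespace MvPowerSeries

variable {σ : Type*} [Fintype σ] {F G : MvPowerSeries σ ℂ} {r : ℝ} {z : σ → ℂ}

/-- The sum of a complex power series at a point. -/
noncomputable def evalAt (F : MvPowerSeries σ ℂ) (z : σ → ℂ) : ℂ :=
  ∑' α, coeff α F * ∏ i, z i ^ α i

theorem norm_prod_pow_le (α : σ →₀ ℕ) (z : σ → ℂ) : ‖∏ i, z i ^ α i‖ ≤ ‖z‖ ^ α.degree := by
  rw [norm_prod, Finsupp.degree_eq_sum, ← Finset.prod_pow_eq_pow_sum]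
  refine Finset.prod_le_prod (fun _ _ => norm_nonneg _) fun i _ => ?_
  rw [norm_pow]
  gcongr
  exact norm_le_pi_norm z i

theorem summable_norm_evalAt (hF : Summable fun α => ‖coeff α F‖ * r ^ α.degree) (hz : ‖z‖ ≤ r) :
    Summable fun α => ‖coeff α F * ∏ i, z i ^ α i‖ := by
  refine hF.of_nonneg_of_le (fun _ => norm_nonneg _) fun α => ?_
  rw [norm_mul]
  gcongr
  exact (norm_prod_pow_le α z).trans (by gcongr)

theorem evalAt_coe (p : MvPolynomial σ ℂ) (z : σ → ℂ) :
    evalAt (p : MvPowerSeries σ ℂ) z = MvPolynomial.eval z p := by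
  rw [MvPolynomial.eval_eq', evalAt, tsum_eq_sum (s := p.support)]
  · simp
  · intro α hα
    simp [MvPolynomial.notMem_support_iff.1 hα]

theorem evalAt_zero_right (F : MvPowerSeries σ ℂ) : evalAt F 0 = constantCoeff F := by
  rw [evalAt, tsum_eq_single 0]
  · simp
  · intro α hα
    obtain ⟨i, hi⟩ := Finsupp.ne_iff.1 hα
    rw [Finset.prod_eq_zero (Finset.mem_univ i), mul_zero]
    simpa using hi

theorem evalAt_sum {ι : Type*} {s : Finset ι} {F : ι → MvPowerSeries σ ℂ}
    (hF : ∀ i ∈ s, Summable fun α => ‖coeff α (F i)‖ * r ^ α.degree) (hz : ‖z‖ ≤ r) :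
    evalAt (∑ i ∈ s, F i) z = ∑ i ∈ s, evalAt (F i) z := by
  simp only [evalAt, map_sum, Finset.sum_mul]
  exact Summable.tsum_finsetSum fun i hi => (summable_norm_evalAt (hF i hi) hz).of_norm

theorem evalAt_mul (hF : Summable fun α => ‖coeff α F‖ * r ^ α.degree)
    (hG : Summable fun α => ‖coeff α G‖ * r ^ α.degree) (hz : ‖z‖ ≤ r) :
    evalAt (F * G) z = evalAt F z * evalAt G z := by
  classical
  have hf := summable_norm_evalAt hF hz
  have hg := summable_norm_evalAt hG hz
  have hfg := summable_mul_of_summable_norm hf hg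
  have h := Summable.tsum_mul_tsum_eq_tsum_sum_antidiagonal hf.of_norm hg.of_norm hfg
  refine Eq.trans (tsum_congr fun α => ?_) h.symm
  rw [coeff_mul]
  refine (Finset.sum_mul _ _ _).trans (Finset.sum_congr rfl fun p hp => ?_)
  have hp := Finset.HasAntidiagonal.mem_antidiagonal.1 hp
  simp only [← hp, Finsupp.add_apply, pow_add, Finset.prod_mul_distrib]
  ring

theorem differentiableOn_evalAt (hr : 0 < r) (hF : Summable fun α => ‖coeff α F‖ * r ^ α.degree) :
    DifferentiableOn ℂ (evalAt F) (Metric.ball 0 (r / 2)) := by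
  have hd : ∀ α : σ →₀ ℕ, Differentiable ℂ fun z : σ → ℂ => coeff α F * ∏ i, z i ^ α i :=
    fun α => by fun_prop
  intro z hz
  refine (hasFDerivAt_tsum_of_isPreconnected (u := fun α => 2 * (‖coeff α F‖ * r ^ α.degree) /
    (r / 2)) ((hF.mul_left 2).div_const _) Metric.isOpen_ball
    (convex_ball (0 : σ → ℂ) (r / 2)).isPreconnected (fun α w _ => (hd α w).hasFDerivAt)
    (fun α w hw => ?_) (Metric.mem_ball_self (by positivity)) ?_
    hz).differentiableAt.differentiableWithinAt
  · refine norm_fderiv_le_of_norm_le_on_ball (by positivity) (hd α).differentiableOn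
      fun y hy => ?_
    rw [norm_mul]
    gcongr
    refine (norm_prod_pow_le α y).trans ?_
    gcongr
    rw [Metric.mem_ball, dist_eq_norm] at hy
    rw [mem_ball_zero_iff] at hw
    linarith [norm_le_norm_sub_add y w]
  · exact (summable_norm_evalAt hF (by simpa using hr.le)).of_norm

theorem exists_isConvergent_evalAt_eq {d : ℕ} {f : (Fin d → ℂ) → ℂ}
    (hf : ∀ᶠ z in 𝓝 0, DifferentiableAt ℂ f z) :
    ∃ F : MvPowerSeries (Fin d) ℂ, IsConvergent F ∧ f =ᶠ[𝓝 0] evalAt F := by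
  have hb : ∀ᶠ z in 𝓝 0, ‖f z‖ ≤ ‖f 0‖ + 1 :=
    (hf.self_of_nhds.continuousAt.norm.eventually_lt_const (by simp)).mono fun _ => le_of_lt
  obtain ⟨R, hR, hball⟩ := Metric.eventually_nhds_iff_ball.1 (hf.and hb)
  obtain ⟨c, hc, hsum⟩ := exists_hasSum_monomials_of_differentiableOn_ball (r := R / 2)
    (by positivity) (by linarith) (fun z hz => (hball z hz).1.differentiableWithinAt)
    fun z hz => (hball z hz).2
  let F : MvPowerSeries (Fin d) ℂ := fun α => c α
  have hF : ∀ α, coeff α F = c α := fun _ => rfl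
  refine ⟨F, ⟨R / 4, by positivity, ?_⟩, ?_⟩
  · have hq := (summable_prod_pow_of_lt_one (fun _ : Fin d => (1 / 2 : ℝ)) (by norm_num)
      (by norm_num)).mul_left (‖f 0‖ + 1)
    refine (Finsupp.equivFunOnFinite.summable_iff.2 hq).of_nonneg_of_le (fun α => by positivity)
      fun α => ?_
    have := hc α
    rw [← Finsupp.degree_eq_sum] at this
    have h4 : R / 4 = R / 2 * (1 / 2) := by ring
    simp only [Function.comp_apply, Finsupp.equivFunOnFinite_apply]
    rw [Finset.prod_pow_eq_pow_sum, ← Finsupp.degree_eq_sum, hF, h4, mul_pow, ← mul_assoc]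
    gcongr
  · filter_upwards [Metric.ball_mem_nhds 0 (half_pos hR)] with z hz
    exact ((Finsupp.equivFunOnFinite.hasSum_iff.2 (hsum z hz)).tsum_eq).symm

end MvPowerSeries

end

section

open scoped ComplexConjugate Topology Nat
open Asymptotics

namespace MvPolynomial

variable {σ : Type*}

theorem evalConj_rename_inl (p : MvPolynomial σ ℂ) (z : σ → ℂ) :
    evalConj z (rename Sum.inl p) = eval z p := by
  simp [evalConj, eval_rename]

variable [Fintype σ]

theorem exists_evalConj_eq_continuousMultilinearMap {k : ℕ}
    (L : ContinuousMultilinearMap ℝ (fun _ : Fin k => σ → ℂ) ℂ) :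
    ∃ Q : MvPolynomial (σ ⊕ σ) ℂ, ∀ z, evalConj z Q = L fun _ => z := by
  classical
  let x : σ ⊕ σ → (σ → ℂ) → ℝ := Sum.elim (fun i z => (z i).re) fun i z => (z i).im
  let v : σ ⊕ σ → σ → ℂ := Sum.elim (fun i => Pi.single i 1) fun i => Pi.single i Complex.I
  let p : σ ⊕ σ → MvPolynomial (σ ⊕ σ) ℂ := Sum.elim
    (fun i => C (1 / 2) * (X (.inl i) + X (.inr i)))
    fun i => C (1 / (2 * Complex.I)) * (X (.inl i) - X (.inr i))
  have hp : ∀ s z, evalConj z (p s) = (x s z : ℂ) := by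
    rintro (i | i) z
    · simp only [p, x, evalConj, Sum.elim_inl, map_mul, map_add, eval_C, eval_X, Sum.elim_inr,
        Complex.re_eq_add_conj]
      ring
    · simp only [p, x, evalConj, Sum.elim_inl, map_mul, map_sub, eval_C, eval_X, Sum.elim_inr,
        Complex.im_eq_sub_conj]
      ring
  have hz : ∀ z : σ → ℂ, z = ∑ s, x s z • v s := by
    intro z
    funext j
    simp [x, v, Fintype.sum_sum_type, Pi.single_apply, Finset.sum_apply]
  refine ⟨∑ r : Fin k → σ ⊕ σ, (∏ j, p (r j)) * C (L fun j => v (r j)), fun z => ?_⟩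
  conv_rhs => rw [hz z]
  rw [L.map_sum, map_sum]
  refine Finset.sum_congr rfl fun r _ => ?_
  rw [L.map_smul_univ, map_mul, map_prod]
  simp only [hp]
  simp [evalConj]

theorem exists_isJet_of_contDiffAt {f : (σ → ℂ) → ℂ} {n : ℕ} (hf : ContDiffAt ℝ (n + 1) f 0) :
    ∃ Q, IsJet (n + 1) Q f := by
  choose q hq using fun k => exists_evalConj_eq_continuousMultilinearMap (iteratedFDeriv ℝ k f 0)
  refine ⟨∑ k ∈ Finset.range (n + 1), C ((k ! : ℂ)⁻¹) * q k, hf.isBigO_sub_taylor.congr_left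
    fun z => ?_⟩
  rw [zero_add, map_sum]
  congr 1
  refine Finset.sum_congr rfl fun k _ => ?_
  rw [map_mul, hq, evalConj, eval_C, ← Complex.ofReal_natCast, ← Complex.ofReal_inv]
  exact Complex.real_smul

end MvPolynomial

namespace MvPowerSeries

theorem IsConvergent.isJet_evalAt {σ : Type*} [Fintype σ] {F : MvPowerSeries σ ℂ}
    (hF : IsConvergent F) (k : ℕ) :
    MvPolynomial.IsJet k (MvPolynomial.rename Sum.inl (F.truncTotal k)) (evalAt F) := by
  obtain ⟨r, hr, hF⟩ := hF
  refine Asymptotics.IsBigO.of_bound ((∑' α, ‖coeff α F‖ * r ^ α.degree) / r ^ k) ?_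
  filter_upwards [Metric.ball_mem_nhds 0 hr] with z hz
  rw [mem_ball_zero_iff] at hz
  have hF' := (summable_norm_evalAt hF hz.le).of_norm
  have hT : Summable fun α => coeff α (F.truncTotal k : MvPowerSeries σ ℂ) * ∏ i, z i ^ α i := by
    refine summable_of_hasFiniteSupport ((F.truncTotal k).support.finite_toSet.subset
      fun α hα => ?_)
    simp only [Function.mem_support] at hα
    exact MvPolynomial.mem_support_iff.2 fun h => hα (by simp [h])
  rw [MvPolynomial.evalConj_rename_inl, ← evalAt_coe, evalAt, evalAt, ← hF'.tsum_sub hT, norm_pow,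
    norm_norm, div_mul_eq_mul_div, mul_div_assoc, ← div_pow, ← tsum_mul_right]
  refine tsum_of_norm_bounded (hF.mul_right _).hasSum fun α => ?_
  rw [← sub_mul, MvPolynomial.coeff_coe, norm_mul]
  rcases lt_or_ge α.degree k with h | h
  · rw [coeff_truncTotal _ h, sub_self, norm_zero, zero_mul]
    positivity
  · rw [coeff_truncTotal_eq_zero _ h, sub_zero, mul_assoc]
    gcongr
    refine (norm_prod_pow_le α z).trans ?_
    obtain ⟨m, hm⟩ := Nat.exists_eq_add_of_le h
    rw [hm, pow_add, pow_add, div_pow, mul_comm, mul_right_comm, mul_div_cancel₀ _ (by positivity),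
      mul_comm]
    gcongr

end MvPowerSeries

end

section

open scoped Topology

namespace MvPolynomial

variable {σ : Type*}

theorem coeff_aeval_sumElim_X_zero {R : MvPolynomial (σ ⊕ σ) ℂ} {k : ℕ}
    (hR : ∀ m, m.degree < k → coeff m R = 0) {α : σ →₀ ℕ} (hα : α.degree < k) :
    coeff α (aeval (Sum.elim X 0 : σ ⊕ σ → MvPolynomial σ ℂ) R) = 0 := by
  rw [← support_sum_monomial_coeff R, map_sum, coeff_sum]
  refine Finset.sum_eq_zero fun m hm => ?_
  have h1 := (isHomogeneous_monomial (d := m) (coeff m R) rfl).aeval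
    (Sum.elim X 0 : σ ⊕ σ → MvPolynomial σ ℂ) (n := 1) (by
      rintro (i | i)
      · exact isHomogeneous_X _ _
      · exact isHomogeneous_zero _ _ _)
  refine h1.coeff_eq_zero fun h => mem_support_iff.1 hm (hR m ?_)
  rw [one_mul] at h
  exact h ▸ hα

theorem constantCoeff_aeval_sumElim_X_zero (R : MvPolynomial (σ ⊕ σ) ℂ) :
    constantCoeff (aeval (Sum.elim X 0 : σ ⊕ σ → MvPolynomial σ ℂ) R) = constantCoeff R := by
  refine RingHom.congr_fun (f := constantCoeff.comp (aeval _).toRingHom)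
    (ringHom_ext (fun r => ?_) ?_) R
  · simp [algHom_C]
  · rintro (i | i) <;> simp

theorem aeval_sumElim_X_zero_rename_inl (p : MvPolynomial σ ℂ) :
    aeval (Sum.elim X 0 : σ ⊕ σ → MvPolynomial σ ℂ) (rename Sum.inl p) = p := by
  rw [aeval_rename, Sum.elim_comp_inl, aeval_X_left_apply]

end MvPolynomial

namespace MvPowerSeries

variable {σ ι : Type*}

theorem coeff_mul_truncTotal [Finite σ] (F G : MvPowerSeries σ ℂ) {n : ℕ} {α : σ →₀ ℕ}
    (hα : α.degree < n) : coeff α (F * (G.truncTotal n : MvPowerSeries σ ℂ)) = coeff α (F * G) := by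
  classical
  rw [coeff_mul, coeff_mul]
  refine Finset.sum_congr rfl fun p hp => ?_
  have hp := Finset.HasAntidiagonal.mem_antidiagonal.1 hp
  rw [MvPolynomial.coeff_coe, coeff_truncTotal]
  rw [← hp, map_add] at hα
  omega

theorem isConvergent_coe (p : MvPolynomial σ ℂ) : IsConvergent (p : MvPowerSeries σ ℂ) :=
  .of_support_finite (p.support.finite_toSet.subset fun α hα => by
    simpa [MvPolynomial.mem_support_iff] using hα)

theorem exists_formal_solution_of_contDiffAt [Fintype σ] [Fintype ι]
    {A B : Matrix ι ι (MvPowerSeries σ ℂ)} (hA : ∀ i j, IsConvergent (A i j))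
    (hB : ∀ i j, IsConvergent (B i j)) {T : (σ → ℂ) → Matrix ι ι ℂ}
    (hT : ∀ i j, ContDiffAt ℝ (⊤ : ℕ∞) (fun z => T z i j) 0)
    (h : ∀ᶠ z in 𝓝 0, T z * B.map (evalAt · z) = A.map (evalAt · z) * T z) (k : ℕ) :
    ∃ H : Matrix ι ι (MvPowerSeries σ ℂ), (∀ i j, IsConvergent (H i j)) ∧
      (∀ i j, constantCoeff (H i j) = T 0 i j) ∧
      ∀ i j α, α.degree < k → coeff α ((H * B - A * H) i j) = 0 := by
  have hT' := fun i j => MvPolynomial.exists_isJet_of_contDiffAt (n := k) ((hT i j).of_le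
    (by exact_mod_cast le_top))
  choose Q hQ using hT'
  let ψ : MvPolynomial (σ ⊕ σ) ℂ →ₐ[ℂ] MvPolynomial σ ℂ :=
    MvPolynomial.aeval (Sum.elim MvPolynomial.X 0)
  refine ⟨.of fun i j => (ψ (Q i j) : MvPolynomial σ ℂ), fun i j => isConvergent_coe _,
    fun i j => ?_, fun i j α hα => ?_⟩
  · rw [← (hQ i j).coeff_zero k.succ_ne_zero, Matrix.of_apply,
      ← coeff_zero_eq_constantCoeff_apply, MvPolynomial.coeff_coe,
      ← MvPolynomial.constantCoeff_eq, ← MvPolynomial.constantCoeff_eq]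
    exact MvPolynomial.constantCoeff_aeval_sumElim_X_zero _
  · have h1 := (MvPolynomial.IsJet.sum (s := Finset.univ) fun l _ =>
      (hQ i l).mul ((hB l j).isJet_evalAt (k + 1))).sub
      (MvPolynomial.IsJet.sum (s := Finset.univ) fun l _ =>
      ((hA i l).isJet_evalAt (k + 1)).mul (hQ l j))
    have h2 := h1.congr (g := 0) (by
      filter_upwards [h] with z hz
      have := congrFun (congrFun hz i) j
      simp only [Matrix.mul_apply, Matrix.map_apply] at this
      simp [Finset.sum_apply, this])
    have h3 := MvPolynomial.coeff_aeval_sumElim_X_zero (fun m hm => h2.coeff_eq_zero hm)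
      (hα.trans k.lt_succ_self)
    simp only [map_sub, map_sum, map_mul, MvPolynomial.aeval_sumElim_X_zero_rename_inl] at h3
    simp only [Matrix.sub_apply, Matrix.mul_apply, Matrix.of_apply, map_sub, map_sum]
    rw [← h3]
    simp only [MvPolynomial.coeff_sub, MvPolynomial.coeff_sum]
    congr 1
    · refine Finset.sum_congr rfl fun l _ => ?_
      rw [← coeff_mul_truncTotal _ _ (hα.trans k.lt_succ_self), ← MvPolynomial.coe_mul,
        MvPolynomial.coeff_coe]
    · refine Finset.sum_congr rfl fun l _ => ?_
      rw [mul_comm, ← coeff_mul_truncTotal _ _ (hα.trans k.lt_succ_self), ← MvPolynomial.coe_mul,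
        MvPolynomial.coeff_coe,
        mul_comm]

end MvPowerSeries

end

section

open scoped Topology

namespace MvPowerSeries.IsConvergent

variable {σ ι : Type*}

theorem eventually_summable {F : MvPowerSeries σ ℂ} (hF : IsConvergent F) :
    ∀ᶠ r : ℝ in 𝓝[>] 0, Summable fun α => ‖coeff α F‖ * r ^ α.degree := by
  obtain ⟨s, hs, hF⟩ := hF
  filter_upwards [Ioc_mem_nhdsGT hs] with r hr
  exact summable_of_le hr.1.le hr.2 hF

theorem eventually_differentiableAt_evalAt [Fintype σ] {F : MvPowerSeries σ ℂ}
    (hF : IsConvergent F) : ∀ᶠ z in 𝓝 0, DifferentiableAt ℂ (evalAt F) z := by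
  obtain ⟨r, hr, hF⟩ := hF
  filter_upwards [Metric.ball_mem_nhds 0 (half_pos hr)] with z hz
  exact (differentiableOn_evalAt hr hF).differentiableAt (Metric.isOpen_ball.mem_nhds hz)

theorem eventually_evalAt_matrix_mul [Fintype σ] [Fintype ι] {F G : Matrix ι ι (MvPowerSeries σ ℂ)}
    (hF : ∀ i j, IsConvergent (F i j)) (hG : ∀ i j, IsConvergent (G i j)) :
    ∀ᶠ z in 𝓝 0, (F * G).map (evalAt · z) = F.map (evalAt · z) * G.map (evalAt · z) := by
  have h1 := fun {F : Matrix ι ι (MvPowerSeries σ ℂ)} (hF : ∀ i j, IsConvergent (F i j)) =>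
    Filter.eventually_all.2 fun i => Filter.eventually_all.2 fun j => (hF i j).eventually_summable
  obtain ⟨r, hr0, hrF, hrG⟩ := (eventually_mem_nhdsWithin.and ((h1 hF).and (h1 hG))).exists
  have hr0 : 0 < r := hr0
  filter_upwards [Metric.closedBall_mem_nhds 0 hr0] with z hz
  rw [mem_closedBall_zero_iff] at hz
  ext i j
  rw [Matrix.map_apply, Matrix.mul_apply, Matrix.mul_apply,
    evalAt_sum (fun l _ => summable_mul hr0.le (hrF i l) (hrG l j)) hz]
  exact Finset.sum_congr rfl fun l _ => evalAt_mul (hrF i l) (hrG l j) hz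

end MvPowerSeries.IsConvergent

theorem MvPowerSeries.exists_matrix_map_evalAt_eq {ι : Type*} [Finite ι] {d : ℕ}
    {X : Set (Fin d → ℂ)} (hX : IsOpen X) {ξ : Fin d → ℂ} (hξ : ξ ∈ X)
    {A : (Fin d → ℂ) → Matrix ι ι ℂ} (hA : ∀ i j, DifferentiableOn ℂ (fun ζ => A ζ i j) X) :
    ∃ F : Matrix ι ι (MvPowerSeries (Fin d) ℂ), (∀ i j, IsConvergent (F i j)) ∧
      ∀ᶠ z in 𝓝 0, A (ξ + z) = F.map (evalAt · z) := by
  have htr : Filter.Tendsto (fun z => ξ + z) (𝓝 0) (𝓝 ξ) := by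
    simpa using (continuous_const_add ξ).tendsto 0
  have h : ∀ i j, ∃ F : MvPowerSeries (Fin d) ℂ, IsConvergent F ∧
      (fun z => A (ξ + z) i j) =ᶠ[𝓝 0] evalAt F := fun i j => by
    refine exists_isConvergent_evalAt_eq ?_
    filter_upwards [htr.eventually (hX.mem_nhds hξ)] with z hz
    exact ((hA i j).differentiableAt (hX.mem_nhds hz)).comp z (by fun_prop)
  choose F hF hAF using h
  refine ⟨.of F, hF, ?_⟩
  filter_upwards [Filter.eventually_all.2 fun i => Filter.eventually_all.2 fun j => hAF i j]
    with z hz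
  ext i j
  exact hz i j

end

open scoped Topology

/-- Spallek's criterion: if `A, B : X → Mat(n×n,ℂ)` are holomorphic on an open `X ⊆ ℂᵈ`, and
near `ξ ∈ X` there is a real-`C^∞` map `T` with `T(ξ) = Φ` and `TB = AT`, then there is a
holomorphic `H` near `ξ` with `H(ξ) = Φ` and `HB = AH`. -/
theorem spallek_criterion (d n : ℕ) (X : Set (Fin d → ℂ)) (hX : IsOpen X)
    (A B : (Fin d → ℂ) → Matrix (Fin n) (Fin n) ℂ)
    (hA : ∀ i j, DifferentiableOn ℂ (fun ζ => A ζ i j) X)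
    (hB : ∀ i j, DifferentiableOn ℂ (fun ζ => B ζ i j) X)
    (ξ : Fin d → ℂ) (hξ : ξ ∈ X)
    (Φ : Matrix (Fin n) (Fin n) ℂ)
    (hT : ∃ V : Set (Fin d → ℂ), IsOpen V ∧ ξ ∈ V ∧ V ⊆ X ∧
      ∃ T : (Fin d → ℂ) → Matrix (Fin n) (Fin n) ℂ,
        (∀ i j, ContDiffOn ℝ (⊤ : ℕ∞) (fun ζ => T ζ i j) V) ∧
        T ξ = Φ ∧ ∀ ζ ∈ V, T ζ * B ζ = A ζ * T ζ) :
    ∃ U : Set (Fin d → ℂ), IsOpen U ∧ ξ ∈ U ∧ U ⊆ X ∧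
      ∃ H : (Fin d → ℂ) → Matrix (Fin n) (Fin n) ℂ,
        (∀ i j, DifferentiableOn ℂ (fun ζ => H ζ i j) U) ∧
        H ξ = Φ ∧ ∀ ζ ∈ U, H ζ * B ζ = A ζ * H ζ := by
  obtain ⟨V, hV, hξV, hVX, T, hTs, hTξ, hTV⟩ := hT
  have htr : Filter.Tendsto (fun z => ξ + z) (𝓝 0) (𝓝 ξ) := by
    simpa using (continuous_const_add ξ).tendsto 0
  obtain ⟨A', hA', hAe⟩ := MvPowerSeries.exists_matrix_map_evalAt_eq hX hξ hA
  obtain ⟨B', hB', hBe⟩ := MvPowerSeries.exists_matrix_map_evalAt_eq hX hξ hB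
  obtain ⟨H, hH, hHΦ, hHe⟩ := MvPowerSeries.exists_isConvergent_mul_eq_mul hA' hB' Φ fun k => by
    have h := MvPowerSeries.exists_formal_solution_of_contDiffAt hA' hB' (T := fun z => T (ξ + z))
      (fun i j => by
        have h1 := (hTs i j).contDiffAt (hV.mem_nhds hξV)
        rw [← add_zero ξ] at h1
        exact h1.comp 0 (by fun_prop)) (by
      filter_upwards [hAe, hBe, htr.eventually (hV.mem_nhds hξV)] with z h1 h2 h3
      rw [← h1, ← h2]
      exact hTV _ h3) k
    simpa only [add_zero, hTξ] using h
  have hev : ∀ᶠ z in 𝓝 0, ξ + z ∈ X ∧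
      (∀ i j, DifferentiableAt ℂ (MvPowerSeries.evalAt (H i j)) z) ∧
      H.map (MvPowerSeries.evalAt · z) * B (ξ + z) =
        A (ξ + z) * H.map (MvPowerSeries.evalAt · z) := by
    filter_upwards [hAe, hBe, htr.eventually (hX.mem_nhds hξ),
      Filter.eventually_all.2 fun i => Filter.eventually_all.2 fun j =>
        (hH i j).eventually_differentiableAt_evalAt,
      MvPowerSeries.IsConvergent.eventually_evalAt_matrix_mul hH hB',
      MvPowerSeries.IsConvergent.eventually_evalAt_matrix_mul hA' hH] with z h1 h2 h3 h4 h5 h6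
    exact ⟨h3, h4, by rw [h1, h2, ← h5, ← h6, hHe]⟩
  obtain ⟨W, hW, hWo, hW0⟩ := eventually_nhds_iff.1 hev
  refine ⟨(fun ζ => ζ - ξ) ⁻¹' W, hWo.preimage (by fun_prop), by simpa using hW0, fun ζ hζ => ?_,
    fun ζ => H.map (MvPowerSeries.evalAt · (ζ - ξ)), fun i j ζ hζ => ?_, ?_, fun ζ hζ => ?_⟩
  · simpa using (hW _ hζ).1
  · exact (DifferentiableAt.comp (g := MvPowerSeries.evalAt (H i j)) (f := fun ζ => ζ - ξ) ζ
      ((hW _ hζ).2.1 i j) (by fun_prop)).differentiableWithinAt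
  · ext i j
    simp [MvPowerSeries.evalAt_zero_right, hHΦ]
  · simpa using (hW _ hζ).2.2
end

section
/- Let X ⊆ ℂ be open and M : X → Mat(n×m,ℂ) holomorphic. Then for each ξ ∈ X there exist a neighborhood U of ξ and a holomorphic map P : U → Mat(m×m,ℂ) such that: P(ζ)² = P(ζ) for all ζ ∈ U; the range of P(ζ) (as a linear map ℂᵐ → ℂᵐ) equals the kernel of M(ζ) (as a linear map ℂᵐ → ℂⁿ) for all ζ ∈ U \ {ξ}; and the range of P(ξ) is contained in the kernel of M(ξ). -/
open Filter Topology in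
/-- Adjoining one row `r` to a system whose kernel is described by the holomorphic projection `P`:
there is a holomorphic projection `Q` with range in that of `P` and in the kernel of `r`, which off
`ξ` fixes every vector of `range P` killed by `r`. -/
theorem exists_analytic_projection_inf_ker {m : ℕ} {ξ : ℂ} {r : ℂ → Fin m → ℂ}
    {P : ℂ → Matrix (Fin m) (Fin m) ℂ}
    (hr : ∀ j, AnalyticAt ℂ (fun ζ => r ζ j) ξ)
    (hP : ∀ i j, AnalyticAt ℂ (fun ζ => P ζ i j) ξ)
    (hPP : ∀ᶠ ζ in 𝓝 ξ, P ζ * P ζ = P ζ) :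
    ∃ Q : ℂ → Matrix (Fin m) (Fin m) ℂ,
      (∀ i j, AnalyticAt ℂ (fun ζ => Q ζ i j) ξ) ∧
      (∀ᶠ ζ in 𝓝 ξ, Q ζ * Q ζ = Q ζ) ∧
      (∀ᶠ ζ in 𝓝 ξ, P ζ * Q ζ = Q ζ) ∧
      (∀ᶠ ζ in 𝓝 ξ, Matrix.vecMul (r ζ) (Q ζ) = 0) ∧
      (∀ᶠ ζ in 𝓝[≠] ξ, ∀ x, (P ζ).mulVec x = x → r ζ ⬝ᵥ x = 0 → (Q ζ).mulVec x = x) := by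
  have analytic_vecMul : ∀ {v : ℂ → Fin m → ℂ}, (∀ j, AnalyticAt ℂ (fun ζ => v ζ j) ξ) →
      ∀ j, AnalyticAt ℂ (fun ζ => Matrix.vecMul (v ζ) (P ζ) j) ξ := fun hv j => by
    simp only [Matrix.vecMul, dotProduct]
    exact Finset.analyticAt_fun_sum _ fun i _ => (hv i).mul (hP i j)
  by_cases h0 : ∀ᶠ ζ in 𝓝 ξ, Matrix.vecMul (r ζ) (P ζ) = 0
  · exact ⟨P, hP, hPP, hPP, h0, .of_forall fun ζ x hx _ => hx⟩
  have hrP : AnalyticAt ℂ (fun ζ => Matrix.vecMul (r ζ) (P ζ)) ξ :=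
    analyticAt_pi_iff.2 (analytic_vecMul hr)
  obtain ⟨k, s, hs, hs0, hk⟩ := hrP.exists_eventuallyEq_pow_smul_nonzero_iff.2 h0
  have hs' := analyticAt_pi_iff.1 hs
  obtain ⟨j, hj⟩ := Function.ne_iff.1 hs0
  have hne : ∀ᶠ ζ in 𝓝 ξ, s ζ j ≠ 0 := (hs' j).continuousAt.eventually_ne hj
  have hsP : ∀ᶠ ζ in 𝓝 ξ, Matrix.vecMul (s ζ) (P ζ) = s ζ := by
    refine (AnalyticAt.frequently_eq_iff_eventually_eq
      (analyticAt_pi_iff.2 (analytic_vecMul hs')) hs).1 (Eventually.frequently ?_)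
    filter_upwards [hk.filter_mono nhdsWithin_le_nhds, hPP.filter_mono nhdsWithin_le_nhds,
      self_mem_nhdsWithin] with ζ h1 h2 h3
    have h4 : (ζ - ξ) ^ k ≠ 0 := pow_ne_zero _ (sub_ne_zero.2 h3)
    apply smul_right_injective _ h4
    simp only
    rw [← Matrix.smul_vecMul, ← h1, Matrix.vecMul_vecMul, h2]
  have hsv : ∀ ζ, Matrix.vecMul (s ζ) (P ζ) = s ζ → s ζ ⬝ᵥ (P ζ).col j = s ζ j := fun ζ h =>
    congrFun h j
  refine ⟨fun ζ => P ζ - (s ζ j)⁻¹ • Matrix.vecMulVec ((P ζ).col j) (s ζ), fun a b => ?_,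
    ?_, ?_, ?_, ?_⟩
  · simp only [Matrix.sub_apply, Matrix.smul_apply, Matrix.vecMulVec_apply, smul_eq_mul,
      Matrix.col_apply]
    exact (hP a b).sub (((hs' j).inv hj).mul ((hP a j).mul (hs' b)))
  · filter_upwards [hPP, hsP, hne] with ζ h1 h2 h3
    have hPv : (P ζ).mulVec ((P ζ).col j) = (P ζ).col j := by
      ext i; exact congrFun (congrFun h1 i) j
    simp only [sub_mul, mul_sub, h1, Matrix.mul_smul, Matrix.smul_mul, Matrix.mul_vecMulVec,
      Matrix.vecMulVec_mul, hPv, h2, Matrix.smul_mulVec, Matrix.vecMulVec_mulVec, hsv ζ h2]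
    ext a b
    simp [Matrix.vecMulVec_apply, h3]
  · filter_upwards [hPP] with ζ h1
    have hPv : (P ζ).mulVec ((P ζ).col j) = (P ζ).col j := by
      ext i; exact congrFun (congrFun h1 i) j
    simp only [mul_sub, h1, Matrix.mul_smul, Matrix.mul_vecMulVec, hPv]
  · filter_upwards [hPP, hsP, hne, hk] with ζ h1 h2 h3 h4
    have h5 : r ζ ⬝ᵥ (P ζ).col j = (ζ - ξ) ^ k * s ζ j := congrFun h4 j
    rw [Matrix.vecMul_sub, Matrix.vecMul_smul, Matrix.vecMul_vecMulVec, h4, h5]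
    ext a
    simp
    field_simp
    simp
  · filter_upwards [hk.filter_mono nhdsWithin_le_nhds, self_mem_nhdsWithin] with ζ h1 h2 x hx hrx
    have h4 : (ζ - ξ) ^ k ≠ 0 := pow_ne_zero _ (sub_ne_zero.2 h2)
    have h5 : s ζ ⬝ᵥ x = 0 := by
      have := Matrix.dotProduct_mulVec (r ζ) (P ζ) x
      rw [hx, hrx, h1, smul_dotProduct, eq_comm, smul_eq_zero] at this
      exact this.resolve_left h4
    simp [Matrix.sub_mulVec, Matrix.smul_mulVec, Matrix.vecMulVec_mulVec, h5, hx]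

open Filter Topology in
/-- A finite family of holomorphic row vectors admits, near `ξ`, a holomorphic projection whose
range lies in their common kernel, with equality off `ξ`. -/
theorem exists_analytic_projection_ker {ι : Type*} {m : ℕ} {ξ : ℂ} {M : ℂ → Matrix ι (Fin m) ℂ}
    (hM : ∀ i j, AnalyticAt ℂ (fun ζ => M ζ i j) ξ) (s : Finset ι) :
    ∃ P : ℂ → Matrix (Fin m) (Fin m) ℂ,
      (∀ i j, AnalyticAt ℂ (fun ζ => P ζ i j) ξ) ∧
      (∀ᶠ ζ in 𝓝 ξ, P ζ * P ζ = P ζ) ∧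
      (∀ᶠ ζ in 𝓝 ξ, ∀ i ∈ s, Matrix.vecMul (M ζ i) (P ζ) = 0) ∧
      (∀ᶠ ζ in 𝓝[≠] ξ, ∀ x, (∀ i ∈ s, M ζ i ⬝ᵥ x = 0) → (P ζ).mulVec x = x) := by
  classical
  induction s using Finset.induction_on with
  | empty => exact ⟨fun _ => 1, fun _ _ => analyticAt_const, by simp, by simp, by simp⟩
  | insert a s _ ih =>
    obtain ⟨P, hP, hPP, hMP, hfix⟩ := ih
    obtain ⟨Q, hQ, hQQ, hPQ, hrQ, hQfix⟩ := exists_analytic_projection_inf_ker (hM a) hP hPP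
    refine ⟨Q, hQ, hQQ, ?_, ?_⟩
    · filter_upwards [hMP, hPQ, hrQ] with ζ h1 h2 h3
      simp only [Finset.forall_mem_insert]
      refine ⟨h3, fun i hi => ?_⟩
      rw [← h2, ← Matrix.vecMul_vecMul, h1 i hi, Matrix.zero_vecMul]
    · filter_upwards [hfix, hQfix] with ζ h1 h2 x hx
      rw [Finset.forall_mem_insert] at hx
      exact h2 x (h1 x hx.2) hx.1

/-- Near each point `ξ` of an open `X ⊆ ℂ`, a holomorphic `M : X → Mat(n×m,ℂ)` admits a
holomorphic family of projections `P` whose range equals `ker M(ζ)` off `ξ` and is contained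
in `ker M(ξ)` at `ξ`. -/
theorem holomorphic_kernel_projection (n m : ℕ) (X : Set ℂ) (hX : IsOpen X)
    (M : ℂ → Matrix (Fin n) (Fin m) ℂ)
    (hM : ∀ i j, DifferentiableOn ℂ (fun ζ => M ζ i j) X)
    (ξ : ℂ) (hξ : ξ ∈ X) :
    ∃ U : Set ℂ, IsOpen U ∧ ξ ∈ U ∧ U ⊆ X ∧
      ∃ P : ℂ → Matrix (Fin m) (Fin m) ℂ,
        (∀ i j, DifferentiableOn ℂ (fun ζ => P ζ i j) U) ∧
        (∀ ζ ∈ U, P ζ * P ζ = P ζ) ∧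
        (∀ ζ ∈ U, ζ ≠ ξ →
          LinearMap.range (Matrix.toLin' (P ζ)) = LinearMap.ker (Matrix.toLin' (M ζ))) ∧
        LinearMap.range (Matrix.toLin' (P ξ)) ≤ LinearMap.ker (Matrix.toLin' (M ξ)) := by
  obtain ⟨P, hP, hPP, hMP, hfix⟩ := exists_analytic_projection_ker
    (fun i j => (hM i j).analyticAt (hX.mem_nhds hξ)) Finset.univ
  have hPan : ∀ᶠ ζ in nhds ξ, ∀ i j, AnalyticAt ℂ (fun ζ => P ζ i j) ζ :=
    Filter.eventually_all.2 fun i => Filter.eventually_all.2 fun j =>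
      (hP i j).eventually_analyticAt
  obtain ⟨U, hU, hUo, hξU⟩ := eventually_nhds_iff.1
    ((hX.eventually_mem hξ).and
      (hPan.and (hPP.and (hMP.and (eventually_nhdsWithin_iff.1 hfix)))))
  have hle : ∀ ζ ∈ U,
      LinearMap.range (Matrix.toLin' (P ζ)) ≤ LinearMap.ker (Matrix.toLin' (M ζ)) := by
    rintro ζ hζ _ ⟨x, rfl⟩
    rw [LinearMap.mem_ker, Matrix.toLin'_apply, Matrix.toLin'_apply]
    ext i
    change M ζ i ⬝ᵥ (P ζ).mulVec x = 0
    rw [Matrix.dotProduct_mulVec, (hU ζ hζ).2.2.2.1 i (Finset.mem_univ i), zero_dotProduct]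
  refine ⟨U, hUo, hξU, fun ζ hζ => (hU ζ hζ).1, P,
    fun i j ζ hζ => ((hU ζ hζ).2.1 i j).differentiableAt.differentiableWithinAt,
    fun ζ hζ => (hU ζ hζ).2.2.1, fun ζ hζ hne => (hle ζ hζ).antisymm fun x hx => ?_, hle ξ hξU⟩
  exact ⟨x, (hU ζ hζ).2.2.2.2 hne x fun i _ => congrFun hx i⟩
end

section
/- Let X ⊆ ℂᵈ be open, let A : X → Mat(n×n,ℂ) be holomorphic, and let ξ ∈ X be a Jordan stable point of A. Then there exist a neighborhood U of ξ and a holomorphic map H : U → Mat(n×n,ℂ) with H(ζ) invertible for every ζ ∈ U, such that H(ζ)⁻¹·(Com A(ζ))·H(ζ) = Com A(ξ) (equality of subsets of Mat(n×n,ℂ)) for all ζ ∈ U. -/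
/-- A point `ξ` of an open set `X ⊆ ℂᵈ` is Jordan stable for a holomorphic
`A : X → Mat(n×n,ℂ)` if on some neighborhood `U ⊆ X` of `ξ` there are holomorphic functions
`λ₁,…,λ_m` whose values at each `ζ ∈ U` are pairwise distinct and are exactly the eigenvalues
of `A(ζ)`, and such that for each `j` and each `1 ≤ k ≤ n` the dimension of
`ker((A(ζ) − λ_j(ζ)·I)^k)` is independent of `ζ ∈ U`. -/
def JordanStable {d n : ℕ} (X : Set (Fin d → ℂ))
    (A : (Fin d → ℂ) → Matrix (Fin n) (Fin n) ℂ) (ξ : Fin d → ℂ) : Prop :=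
  ∃ U : Set (Fin d → ℂ), IsOpen U ∧ ξ ∈ U ∧ U ⊆ X ∧
    ∃ m : ℕ, ∃ lam : Fin m → (Fin d → ℂ) → ℂ,
      (∀ j, DifferentiableOn ℂ (lam j) U) ∧
      (∀ ζ ∈ U, Function.Injective fun j => lam j ζ) ∧
      (∀ ζ ∈ U, (Set.range fun j => lam j ζ) = spectrum ℂ (A ζ)) ∧
      (∀ j : Fin m, ∀ k : ℕ, 1 ≤ k → k ≤ n → ∀ ζ₁ ∈ U, ∀ ζ₂ ∈ U,
        Module.finrank ℂ
            (LinearMap.ker (Matrix.toLin' ((A ζ₁ - lam j ζ₁ • (1 : Matrix (Fin n) (Fin n) ℂ)) ^ k))) =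
          Module.finrank ℂ
            (LinearMap.ker (Matrix.toLin' ((A ζ₂ - lam j ζ₂ • (1 : Matrix (Fin n) (Fin n) ℂ)) ^ k))))

open scoped Matrix

theorem differentiableOn_matrix_mul {E l m n : Type*} [NormedAddCommGroup E] [NormedSpace ℂ E]
    [Fintype m] {M : E → Matrix l m ℂ} {N : E → Matrix m n ℂ} {U : Set E}
    (hM : ∀ i j, DifferentiableOn ℂ (fun ζ => M ζ i j) U)
    (hN : ∀ i j, DifferentiableOn ℂ (fun ζ => N ζ i j) U) (i : l) (j : n) :
    DifferentiableOn ℂ (fun ζ => (M ζ * N ζ) i j) U := by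
  simp only [Matrix.mul_apply]
  exact DifferentiableOn.fun_sum fun k _ => (hM i k).mul (hN k j)

theorem differentiableOn_matrix_mulVec {E l m : Type*} [NormedAddCommGroup E] [NormedSpace ℂ E]
    [Fintype m] {M : E → Matrix l m ℂ} {v : E → m → ℂ} {U : Set E}
    (hM : ∀ i j, DifferentiableOn ℂ (fun ζ => M ζ i j) U)
    (hv : ∀ j, DifferentiableOn ℂ (fun ζ => v ζ j) U) (i : l) :
    DifferentiableOn ℂ (fun ζ => (M ζ).mulVec (v ζ) i) U := by
  simp only [Matrix.mulVec, dotProduct]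
  exact DifferentiableOn.fun_sum fun k _ => (hM i k).mul (hv k)

theorem differentiableOn_matrix_pow {E n : Type*} [NormedAddCommGroup E] [NormedSpace ℂ E]
    [Fintype n] [DecidableEq n] {M : E → Matrix n n ℂ} {U : Set E}
    (hM : ∀ i j, DifferentiableOn ℂ (fun ζ => M ζ i j) U) (k : ℕ) (i j : n) :
    DifferentiableOn ℂ (fun ζ => (M ζ ^ k) i j) U := by
  induction k generalizing i j with
  | zero => simp
  | succ k ih =>
    simp only [pow_succ]
    exact differentiableOn_matrix_mul ih hM i j

theorem differentiableOn_matrix_det {E n : Type*} [NormedAddCommGroup E] [NormedSpace ℂ E]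
    [Fintype n] [DecidableEq n] {M : E → Matrix n n ℂ} {U : Set E}
    (hM : ∀ i j, DifferentiableOn ℂ (fun ζ => M ζ i j) U) :
    DifferentiableOn ℂ (fun ζ => (M ζ).det) U := by
  simp only [Matrix.det_apply']
  exact DifferentiableOn.fun_sum fun σ _ =>
    DifferentiableOn.const_mul (fun ζ hζ => (HasFDerivWithinAt.finsetProd fun i _ =>
      (hM (σ i) i ζ hζ).hasFDerivWithinAt).differentiableWithinAt) _

theorem differentiableOn_matrix_inv {E n : Type*} [NormedAddCommGroup E] [NormedSpace ℂ E]
    [Fintype n] [DecidableEq n] {M : E → Matrix n n ℂ} {U : Set E}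
    (hM : ∀ i j, DifferentiableOn ℂ (fun ζ => M ζ i j) U) (hU : ∀ ζ ∈ U, (M ζ).det ≠ 0)
    (i j : n) : DifferentiableOn ℂ (fun ζ => (M ζ)⁻¹ i j) U := by
  simp only [Matrix.inv_def, Ring.inverse_eq_inv', Matrix.smul_apply, smul_eq_mul,
    Matrix.adjugate_apply]
  refine ((differentiableOn_matrix_det hM).fun_inv hU).mul (differentiableOn_matrix_det ?_)
  intro a b
  by_cases h : a = j
  · simp [Matrix.updateRow_apply, h]
  · simpa [Matrix.updateRow_apply, h] using hM a b

/-- The invertibility locus of a holomorphic matrix is open. -/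
theorem isOpen_inter_det_ne_zero {E n : Type*} [NormedAddCommGroup E] [NormedSpace ℂ E]
    [Fintype n] [DecidableEq n] {M : E → Matrix n n ℂ} {U : Set E} (hU : IsOpen U)
    (hM : ∀ i j, DifferentiableOn ℂ (fun ζ => M ζ i j) U) :
    IsOpen (U ∩ {ζ | (M ζ).det ≠ 0}) :=
  (differentiableOn_matrix_det hM).continuousOn.isOpen_inter_preimage hU isOpen_ne

/-- Every endomorphism of a vector space has a generalized inverse. -/
theorem exists_mul_mul_self_eq {K V : Type*} [Field K] [AddCommGroup V] [Module K V]
    (f : Module.End K V) : ∃ g : Module.End K V, f * g * f = f := by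
  obtain ⟨g, hg⟩ := f.rangeRestrict.exists_rightInverse_of_surjective f.range_rangeRestrict
  obtain ⟨g', hg'⟩ := LinearMap.exists_extend g
  refine ⟨g', LinearMap.ext fun x => ?_⟩
  have h1 : g' (f x) = g (f.rangeRestrict x) := by
    rw [← hg']; rfl
  have h2 := congrArg Subtype.val (LinearMap.congr_fun hg (f.rangeRestrict x))
  simpa [h1] using h2

/-- If the kernels of a holomorphic family of matrices have constant dimension, then every vector
of one kernel extends locally to a holomorphic section of the kernels. -/
theorem exists_differentiableOn_section_ker {E n : Type*} [NormedAddCommGroup E]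
    [NormedSpace ℂ E] [Fintype n] [DecidableEq n] {L : E → Matrix n n ℂ} {U : Set E}
    (hU : IsOpen U) (hL : ∀ i j, DifferentiableOn ℂ (fun ζ => L ζ i j) U) {ξ : E} (hξ : ξ ∈ U)
    (hdim : ∀ ζ ∈ U, Module.finrank ℂ (LinearMap.ker (Matrix.toLin' (L ζ))) =
      Module.finrank ℂ (LinearMap.ker (Matrix.toLin' (L ξ))))
    {w : n → ℂ} (hw : (L ξ).mulVec w = 0) :
    ∃ V : Set E, IsOpen V ∧ ξ ∈ V ∧ V ⊆ U ∧ ∃ v : E → n → ℂ,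
      (∀ i, DifferentiableOn ℂ (fun ζ => v ζ i) V) ∧ v ξ = w ∧
      ∀ ζ ∈ V, (L ζ).mulVec (v ζ) = 0 := by
  obtain ⟨s, hs⟩ := exists_mul_mul_self_eq (Matrix.toLin' (L ξ))
  obtain ⟨S, rfl⟩ := Matrix.toLin'.surjective s
  have hS : L ξ * S * L ξ = L ξ := by
    apply Matrix.toLin'.injective
    simpa [Matrix.toLin'_mul, Module.End.mul_eq_comp] using hs
  set G : E → Matrix n n ℂ := fun ζ => S * L ζ + (1 - S * L ξ) with hGdef
  have hG : ∀ i j, DifferentiableOn ℂ (fun ζ => G ζ i j) U := by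
    intro i j
    simp only [hGdef, Matrix.add_apply]
    exact (differentiableOn_matrix_mul (M := fun _ => S)
      (fun _ _ => differentiableOn_const _) hL i j).add_const _
  have hGξ : G ξ = 1 := by simp [hGdef]
  have hV : ∀ ζ ∈ U ∩ {ζ | (G ζ).det ≠ 0}, (G ζ).det ≠ 0 := fun ζ h => h.2
  refine ⟨_, isOpen_inter_det_ne_zero hU hG, ⟨hξ, by simp [hGξ]⟩, Set.inter_subset_left,
    fun ζ => (G ζ)⁻¹.mulVec w, ?_, by simp [hGξ], ?_⟩
  · exact differentiableOn_matrix_mulVec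
      (differentiableOn_matrix_inv (fun i j => (hG i j).mono Set.inter_subset_left) hV)
      (fun _ => differentiableOn_const _)
  · rintro ζ ⟨hζ, hdet⟩
    have hunit : IsUnit (G ζ).det := isUnit_iff_ne_zero.2 hdet
    have hinj : Function.Injective (Matrix.toLin' (G ζ)) := by
      intro x y hxy
      have := congrArg (G ζ)⁻¹.mulVec hxy
      simpa [Matrix.mulVec_mulVec, Matrix.nonsing_inv_mul _ hunit] using this
    have hle : (LinearMap.ker (Matrix.toLin' (L ζ))).map (Matrix.toLin' (G ζ)) ≤
        LinearMap.ker (Matrix.toLin' (L ξ)) := by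
      rintro _ ⟨x, hx, rfl⟩
      have hx : (L ζ).mulVec x = 0 := hx
      have hGx : G ζ *ᵥ x = (1 - S * L ξ) *ᵥ x := by
        simp [hGdef, Matrix.add_mulVec, ← Matrix.mulVec_mulVec, hx]
      have h0 : L ξ * (1 - S * L ξ) = 0 := by
        rw [mul_sub, ← mul_assoc, hS, mul_one, sub_self]
      simp [hGx, Matrix.mulVec_mulVec, h0]
    have heq := Submodule.eq_of_le_of_finrank_eq hle (by
      rw [← hdim ζ hζ]
      exact (Submodule.equivMapOfInjective _ hinj _).finrank_eq.symm)
    have hwmem : w ∈ LinearMap.ker (Matrix.toLin' (L ξ)) := hw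
    rw [← heq] at hwmem
    obtain ⟨x, hx, rfl⟩ := hwmem
    have hx : (L ζ).mulVec x = 0 := hx
    simpa [Matrix.mulVec_mulVec, Matrix.nonsing_inv_mul _ hunit] using hx

/-- A matrix commuting with the sum of a diagonal matrix and a nilpotent matrix that commute with
each other commutes with the diagonal matrix. -/
theorem commute_diagonal_of_commute_add {K n : Type*} [Field K] [Fintype n] [DecidableEq n]
    {d : n → K} {N T : Matrix n n K} (hN : IsNilpotent N) (hdN : Commute (Matrix.diagonal d) N)
    (h : Commute T (Matrix.diagonal d + N)) : Commute T (Matrix.diagonal d) := by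
  let D := Matrix.diagonal d
  set δ : Module.End K (Matrix n n K) := LinearMap.mulLeft K D - LinearMap.mulRight K D with hδ
  set ν : Module.End K (Matrix n n K) := LinearMap.mulRight K N - LinearMap.mulLeft K N with hν
  have hνnil : IsNilpotent ν := by
    refine (LinearMap.commute_mulLeft_right (R := K) N N).symm.isNilpotent_sub ?_ ?_
    · exact (LinearMap.isNilpotent_mulRight_iff K N).2 hN
    · exact (LinearMap.isNilpotent_mulLeft_iff K N).2 hN
  have hcomm : Commute δ ν := by
    refine LinearMap.ext fun x => ?_
    have hDN : D * N = N * D := hdN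
    simp only [hδ, hν, Module.End.mul_apply, LinearMap.sub_apply, LinearMap.mulLeft_apply,
      LinearMap.mulRight_apply, mul_sub, sub_mul, mul_assoc, hDN]
    simp only [← mul_assoc, hDN]
    abel
  have hT : δ T = ν T := by
    have := h.eq
    simp only [hδ, hν, LinearMap.sub_apply, LinearMap.mulLeft_apply,
      LinearMap.mulRight_apply]
    rw [mul_add, add_mul] at this
    rw [sub_eq_sub_iff_add_eq_add, ← this, add_comm]
  have hpow : ∀ k : ℕ, (δ ^ k) T = (ν ^ k) T := by
    intro k
    induction k with
    | zero => simp
    | succ k ih =>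
      rw [pow_succ', Module.End.mul_apply, ih, ← Module.End.mul_apply,
        (hcomm.pow_right k).eq, Module.End.mul_apply, hT, ← Module.End.mul_apply, ← pow_succ]
  have hentry : ∀ (k : ℕ) (i j : n), (δ ^ k) T i j = (d i - d j) ^ k * T i j := by
    intro k
    induction k with
    | zero => simp
    | succ k ih =>
      intro i j
      rw [pow_succ', Module.End.mul_apply]
      simp only [hδ, D] at ih ⊢
      simp only [LinearMap.sub_apply, LinearMap.mulLeft_apply,
        LinearMap.mulRight_apply, Matrix.sub_apply, Matrix.diagonal_mul, Matrix.mul_diagonal, ih]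
      ring
  obtain ⟨k, hk⟩ := hνnil
  ext i j
  have h0 : (d i - d j) ^ k * T i j = 0 := by
    rw [← hentry, hpow, hk]; rfl
  rw [Matrix.mul_diagonal, Matrix.diagonal_mul]
  rcases mul_eq_zero.1 h0 with h1 | h1
  · rw [sub_eq_zero.1 (eq_zero_of_pow_eq_zero h1), mul_comm]
  · simp [h1]

/-- The commutant of `diagonal d + N` depends only on `N` and on the partition of the indices into
level sets of `d`. -/
theorem commute_diagonal_add_congr {K n : Type*} [Field K] [Fintype n] [DecidableEq n]
    {d d' : n → K} {N T : Matrix n n K} (hN : IsNilpotent N)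
    (hdN : Commute (Matrix.diagonal d) N) (hdd' : ∀ i j, d i = d j → d' i = d' j)
    (h : Commute T (Matrix.diagonal d + N)) : Commute T (Matrix.diagonal d' + N) := by
  have h1 := commute_diagonal_of_commute_add hN hdN h
  have h2 : Commute T N := by simpa using h.sub_right h1
  refine Commute.add_right ?_ h2
  ext i j
  have h3 := congrFun (congrFun h1.eq i) j
  rw [Matrix.mul_diagonal, Matrix.diagonal_mul] at h3 ⊢
  by_cases hij : d i = d j
  · rw [hdd' i j hij, mul_comm]
  · have : (d i - d j) * T i j = 0 := by rw [sub_mul, ← h3]; ring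
    rcases mul_eq_zero.1 this with h4 | h4
    · exact absurd (sub_eq_zero.1 h4) hij
    · simp [h4]

theorem DFinsupp.basis_apply {R ι : Type*} {M η : ι → Type*} [Semiring R]
    [∀ i, AddCommMonoid (M i)] [∀ i, Module R (M i)] [DecidableEq ι]
    (b : ∀ i, Module.Basis (η i) R (M i)) (x : Σ i, η i) :
    DFinsupp.basis b x = DFinsupp.single x.1 (b x.1 x.2) := by
  refine (DFinsupp.basis b).apply_eq_iff.2 ?_
  change (sigmaFinsuppLequivDFinsupp R).symm
    (DFinsupp.mapRange.linearEquiv (fun i => (b i).repr) _) = _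
  rw [LinearEquiv.symm_apply_eq]
  ext1 i
  simp [DFinsupp.mapRange_single]

open Polynomial in
/-- Over an algebraically closed field, the quotient of the polynomial ring by a power of an
irreducible polynomial has a basis of powers of a linear polynomial. -/
theorem exists_basis_quotient_span_pow {K : Type*} [Field K] [IsAlgClosed K] {p : K[X]}
    (hp : Irreducible p) (e : ℕ) :
    ∃ (μ : K) (b : Module.Basis (Fin e) K (K[X] ⧸ Submodule.span K[X] {p ^ e})),
      (∀ a, b a = Submodule.Quotient.mk ((X - C μ) ^ (a : ℕ))) ∧
      (X - C μ) ^ e ∈ Submodule.span K[X] {p ^ e} := by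
  obtain ⟨μ, hμ⟩ := IsAlgClosed.exists_root p hp.degree_pos.ne'
  have hassoc : Associated (p ^ e) ((X - C μ) ^ e) :=
    ((irreducible_X_sub_C μ).associated_of_dvd hp (dvd_iff_isRoot.2 hμ)).symm.pow_pow
  have hspan : Submodule.span K[X] {p ^ e} = Ideal.span {(X - C μ) ^ e} :=
    Ideal.span_singleton_eq_span_singleton.2 hassoc
  rw [hspan]
  have hmem : (X - C μ) ^ e ∈ Ideal.span {(X - C μ) ^ e} := Ideal.mem_span_singleton_self _
  refine ⟨μ, basisOfTopLeSpanOfCardEqFinrank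
    (fun a : Fin e => Submodule.Quotient.mk ((X - C μ) ^ (a : ℕ))) ?_ ?_, ?_, hmem⟩
  · rintro x -
    obtain ⟨q, rfl⟩ := Submodule.Quotient.mk_surjective _ x
    rw [← sum_taylor_eq q μ, Polynomial.sum, ← Submodule.mkQ_apply, map_sum]
    refine Submodule.sum_mem _ fun a _ => ?_
    rw [← smul_eq_C_mul, Submodule.mkQ_apply, Submodule.Quotient.mk_smul]
    refine Submodule.smul_mem _ _ ?_
    rcases lt_or_ge a e with h | h
    · exact Submodule.subset_span ⟨⟨a, h⟩, rfl⟩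
    · rw [(Submodule.Quotient.mk_eq_zero _).2]
      · exact Submodule.zero_mem _
      · exact Ideal.mem_span_singleton.2 (pow_dvd_pow _ h)
  · rw [finrank_quotient_span_eq_natDegree]
    simp
  · intro a
    simp

open Polynomial DirectSum in
/-- Existence of a Jordan basis, organized in chains `w, (f - μ) w, (f - μ)² w, …`. -/
theorem exists_jordan_basis.{u, v} {K : Type u} {V : Type v} [Field K]
    [IsAlgClosed K] [AddCommGroup V] [Module K V] [FiniteDimensional K V] (f : Module.End K V) :
    ∃ (ι : Type u) (_ : Fintype ι) (e : ι → ℕ) (μ : ι → K) (w : ι → V)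
      (b : Module.Basis (Σ i, Fin (e i)) K V),
      (∀ i, 0 < e i) ∧ (∀ i, ((f - algebraMap K _ (μ i)) ^ e i) (w i) = 0) ∧
      ∀ x, b x = ((f - algebraMap K _ (μ x.1)) ^ (x.2 : ℕ)) (w x.1) := by
  classical
  obtain ⟨ι, _, p, hp, e, ⟨E⟩⟩ := Module.equiv_directSum_of_isTorsion
    (Module.AEval.isTorsion_of_finiteDimensional K V f)
  choose μ c hc hmem using fun i => exists_basis_quotient_span_pow (hp i) (e i)
  let E' : V ≃ₗ[K] Π₀ i, K[X] ⧸ Submodule.span K[X] {p i ^ e i} :=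
    (Module.AEval.of K V f).trans (E.restrictScalars K)
  have hE : ∀ (q : K[X]) (v : Π₀ i, K[X] ⧸ Submodule.span K[X] {p i ^ e i}),
      E'.symm (q • v) = aeval f q (E'.symm v) := by
    intro q v
    have h : E.symm (q • v) = q • E.symm v := map_smul E.symm q v
    change (Module.AEval.of K V f).symm (E.symm (q • v)) = _
    rw [h, Module.AEval.of_symm_smul]
    rfl
  let w : ι → V := fun i => E'.symm (DFinsupp.single i (Submodule.Quotient.mk 1))
  let b₀ : Module.Basis (Σ i, Fin (e i)) K V := (DFinsupp.basis c).map E'.symm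
  have haeval : ∀ i (a : ℕ), aeval f ((X - C (μ i)) ^ a) = (f - algebraMap K _ (μ i)) ^ a := by
    intro i a; simp
  have hw : ∀ i (a : ℕ), ((f - algebraMap K _ (μ i)) ^ a) (w i) =
      E'.symm (DFinsupp.single i (Submodule.Quotient.mk ((X - C (μ i)) ^ a))) := by
    intro i a
    rw [← haeval, ← hE, ← DFinsupp.single_smul, ← Submodule.Quotient.mk_smul, smul_eq_mul, mul_one]
  let σ : (Σ i : {i // 0 < e i}, Fin (e i)) ≃ Σ i, Fin (e i) :=
    { toFun := fun x => ⟨x.1, x.2⟩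
      invFun := fun x => ⟨⟨x.1, x.2.pos⟩, x.2⟩
      left_inv := fun _ => rfl
      right_inv := fun _ => rfl }
  refine ⟨{i // 0 < e i}, inferInstance, fun i => e i, fun i => μ i, fun i => w i,
    b₀.reindex σ.symm, fun i => i.2, fun i => ?_, fun x => ?_⟩
  · rw [hw, (Submodule.Quotient.mk_eq_zero _).2 (hmem i)]
    simp
  · rw [hw]
    rw [Module.Basis.reindex_apply]
    have hσ : b₀ (σ.symm.symm x) = b₀ ⟨x.1, x.2⟩ := rfl
    rw [hσ, Module.Basis.map_apply, DFinsupp.basis_apply, hc]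

/-- A matrix supported on a superdiagonal of a grading is nilpotent. -/
theorem isNilpotent_of_apply_ne_zero {R n : Type*} [Semiring R] [Fintype n] [DecidableEq n]
    {N : Matrix n n R} (g : n → ℕ) (hN : ∀ x y, N x y ≠ 0 → g x = g y + 1) : IsNilpotent N := by
  have h : ∀ (k : ℕ) (x y : n), (N ^ k) x y ≠ 0 → g x = g y + k := by
    intro k
    induction k with
    | zero =>
      intro x y hxy
      by_contra hne
      exact hxy (by rw [pow_zero, Matrix.one_apply_ne (fun h => hne (by simp [h]))])
    | succ k ih =>
      intro x y hxy
      rw [pow_succ, Matrix.mul_apply] at hxy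
      obtain ⟨z, -, hz⟩ := Finset.exists_ne_zero_of_sum_ne_zero hxy
      have h1 := ih x z (left_ne_zero_of_mul hz)
      have h2 := hN z y (right_ne_zero_of_mul hz)
      omega
  refine ⟨Finset.univ.sup g + 1, ?_⟩
  ext x y
  by_contra hne
  have h1 := h _ x y hne
  have h2 : g x ≤ Finset.univ.sup g := Finset.le_sup (Finset.mem_univ x)
  omega

/-- If `P` intertwines `A` with `J`, conjugation by `P` carries the commutant of `J` to that of `A`. -/
theorem commute_conj_iff {R n : Type*} [CommRing R] [Fintype n] [DecidableEq n]
    {A J P T : Matrix n n R} (hP : IsUnit P.det) (h : A * P = P * J) :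
    Commute (P * T * P⁻¹) A ↔ Commute T J := by
  have hA : A = P * J * P⁻¹ := by rw [← h, Matrix.mul_nonsing_inv_cancel_right _ _ hP]
  have key : ∀ S S' : Matrix n n R, P * S * P⁻¹ * (P * S' * P⁻¹) = P * (S * S') * P⁻¹ := by
    intro S S'
    simp only [mul_assoc, Matrix.nonsing_inv_mul_cancel_left _ _ hP]
  rw [hA, commute_iff_eq, commute_iff_eq, key, key]
  refine ⟨fun hc => ?_, fun hc => by rw [hc]⟩
  have h1 := congrArg (fun S => P⁻¹ * S * P) hc
  simpa [mul_assoc, Matrix.nonsing_inv_mul_cancel_left _ _ hP, Matrix.nonsing_inv_mul _ hP] using h1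

/-- Conjugation by `P * Q⁻¹` identifies the commutants of two matrices whose normal forms have the
same commutant. -/
theorem image_conj_commutant_eq {R n : Type*} [CommRing R] [Fintype n] [DecidableEq n]
    {A B J J' P Q : Matrix n n R} (hP : IsUnit P.det) (hQ : IsUnit Q.det)
    (hA : A * P = P * J) (hB : B * Q = Q * J') (hJ : ∀ T, Commute T J ↔ Commute T J') :
    (fun Θ => (P * Q⁻¹)⁻¹ * Θ * (P * Q⁻¹)) '' {Θ | Θ * A = A * Θ} = {Θ | Θ * B = B * Θ} := by
  have hinv : (P * Q⁻¹)⁻¹ = Q * P⁻¹ := by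
    rw [Matrix.mul_inv_rev, Matrix.nonsing_inv_nonsing_inv _ hQ]
  have hPQ : ∀ T, Commute (P * T * P⁻¹) A ↔ Commute (Q * T * Q⁻¹) B := fun T => by
    rw [commute_conj_iff hP hA, commute_conj_iff hQ hB, hJ]
  rw [hinv]
  ext Θ
  constructor
  · rintro ⟨S, hS, rfl⟩
    have h1 := (hPQ (P⁻¹ * S * P)).1 (by
      simpa [mul_assoc, Matrix.mul_nonsing_inv_cancel_left _ _ hP, Matrix.mul_nonsing_inv _ hP]
        using (show Commute S A from hS))
    simpa [mul_assoc] using h1.eq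
  · intro hΘ
    have h1 := (hPQ (Q⁻¹ * Θ * Q)).2 (by
      simpa [mul_assoc, Matrix.mul_nonsing_inv_cancel_left _ _ hQ, Matrix.mul_nonsing_inv _ hQ]
        using (show Commute Θ B from hΘ))
    refine ⟨_, h1.eq, ?_⟩
    simp [mul_assoc, Matrix.nonsing_inv_mul_cancel_left _ _ hP,
      Matrix.mul_nonsing_inv_cancel_left _ _ hQ, Matrix.mul_nonsing_inv _ hQ]

/-- Chains of vectors assemble into an intertwiner with a Jordan matrix. -/
theorem mul_of_chain_eq {R n ι : Type*} [CommRing R] [Fintype n] [DecidableEq n] [DecidableEq ι]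
    {e : ι → ℕ} (σ : n ≃ Σ i, Fin (e i)) (A : Matrix n n R) (μ : ι → R)
    (C : (Σ i, Fin (e i)) → n → R)
    (hsucc : ∀ (i : ι) (a : ℕ) (h : a + 1 < e i),
      A *ᵥ C ⟨i, ⟨a, a.lt_succ_self.trans h⟩⟩ =
        C ⟨i, ⟨a + 1, h⟩⟩ + μ i • C ⟨i, ⟨a, a.lt_succ_self.trans h⟩⟩)
    (hlast : ∀ (i : ι) (a : Fin (e i)), (a : ℕ) + 1 = e i → A *ᵥ C ⟨i, a⟩ = μ i • C ⟨i, a⟩) :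
    A * Matrix.of (fun r c => C (σ c) r) = Matrix.of (fun r c => C (σ c) r) *
      (Matrix.diagonal (fun c => μ (σ c).1) + Matrix.of fun x c =>
        if (σ x).1 = (σ c).1 ∧ ((σ x).2 : ℕ) = (σ c).2 + 1 then 1 else 0) := by
  ext r c
  have hleft : (A * Matrix.of (fun r c => C (σ c) r)) r c = (A *ᵥ C (σ c)) r := by
    simp [Matrix.mul_apply, Matrix.mulVec, dotProduct]
  rw [hleft, mul_add, Matrix.add_apply, Matrix.mul_diagonal, Matrix.mul_apply]
  simp only [Matrix.of_apply]
  obtain ⟨i, a⟩ := σ c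
  rcases Nat.lt_or_ge (a + 1) (e i) with h | h
  · obtain ⟨x₀, hx₀⟩ := σ.surjective ⟨i, ⟨a + 1, h⟩⟩
    rw [hsucc i a h, Finset.sum_eq_single x₀]
    · rw [hx₀]
      simp [mul_comm, add_comm]
    · intro x _ hx
      rw [if_neg, mul_zero]
      refine fun hkb => hx (σ.injective (Eq.trans ?_ hx₀.symm))
      revert hkb
      generalize σ x = y
      obtain ⟨k, b⟩ := y
      rintro ⟨hk, hb⟩
      dsimp only at hk hb
      subst hk
      exact congrArg _ (Fin.ext hb)
    · simp
  · have ha : (a : ℕ) + 1 = e i := le_antisymm a.2 h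
    rw [hlast i a ha, Finset.sum_eq_zero]
    · simp [mul_comm]
    · intro x _
      rw [if_neg, mul_zero]
      generalize σ x = y
      obtain ⟨k, b⟩ := y
      rintro ⟨hk, hb⟩
      dsimp only at hk hb
      subst hk
      have := b.2
      omega

/-- The powers of `A - μ` applied to generalized eigenvectors form an intertwiner of `A` with a
Jordan matrix. -/
theorem mul_of_pow_mulVec_eq {R n ι : Type*} [CommRing R] [Fintype n] [DecidableEq n]
    [DecidableEq ι] {e : ι → ℕ} (σ : n ≃ Σ i, Fin (e i)) (A : Matrix n n R) (μ : ι → R)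
    (v : ι → n → R) (hv : ∀ i, ((A - μ i • (1 : Matrix n n R)) ^ e i) *ᵥ v i = 0) :
    A * Matrix.of (fun r c =>
        (((A - μ (σ c).1 • (1 : Matrix n n R)) ^ ((σ c).2 : ℕ)) *ᵥ v (σ c).1) r) =
      Matrix.of (fun r c =>
        (((A - μ (σ c).1 • (1 : Matrix n n R)) ^ ((σ c).2 : ℕ)) *ᵥ v (σ c).1) r) *
      (Matrix.diagonal (fun c => μ (σ c).1) + Matrix.of fun x c =>
        if (σ x).1 = (σ c).1 ∧ ((σ x).2 : ℕ) = (σ c).2 + 1 then 1 else 0) := by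
  have hstep : ∀ (i : ι) (a : ℕ), A *ᵥ ((A - μ i • (1 : Matrix n n R)) ^ a *ᵥ v i) =
      (A - μ i • (1 : Matrix n n R)) ^ (a + 1) *ᵥ v i +
        μ i • ((A - μ i • (1 : Matrix n n R)) ^ a *ᵥ v i) := by
    intro i a
    rw [pow_succ', ← Matrix.mulVec_mulVec, Matrix.sub_mulVec, Matrix.smul_mulVec,
      Matrix.one_mulVec, sub_add_cancel]
  refine mul_of_chain_eq σ A μ
    (fun x => ((A - μ x.1 • (1 : Matrix n n R)) ^ (x.2 : ℕ)) *ᵥ v x.1)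
    (fun i a _ => hstep i a) fun i a ha => ?_
  dsimp only
  rw [hstep, ha, hv, zero_add]

/-- At a Jordan stable point `ξ` of a holomorphic `A : X → Mat(n×n,ℂ)`, there is a holomorphic
invertible-valued `H` near `ξ` with `H(ζ)⁻¹·(Com A(ζ))·H(ζ) = Com A(ξ)` for all `ζ` near `ξ`. -/
theorem com_conjugation_at_jordan_stable_point (d n : ℕ)
    (X : Set (Fin d → ℂ)) (hX : IsOpen X)
    (A : (Fin d → ℂ) → Matrix (Fin n) (Fin n) ℂ)
    (hA : ∀ i j, DifferentiableOn ℂ (fun ζ => A ζ i j) X)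
    (ξ : Fin d → ℂ) (hξ : ξ ∈ X) (hJ : JordanStable X A ξ) :
    ∃ U : Set (Fin d → ℂ), IsOpen U ∧ ξ ∈ U ∧ U ⊆ X ∧
      ∃ H : (Fin d → ℂ) → Matrix (Fin n) (Fin n) ℂ,
        (∀ i j, DifferentiableOn ℂ (fun ζ => H ζ i j) U) ∧
        (∀ ζ ∈ U, IsUnit (H ζ)) ∧
        (∀ ζ ∈ U,
          (fun Θ => (H ζ)⁻¹ * Θ * H ζ) '' {Θ | Θ * A ζ = A ζ * Θ} =
            {Θ | Θ * A ξ = A ξ * Θ}) := by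
  classical
  obtain ⟨U, hU, hξU, hUX, m, lam, hlam, hinj, hspec, hdim⟩ := hJ
  obtain ⟨ι, _, e, μ, w, b, he, hw, hb⟩ := exists_jordan_basis (Matrix.toLin' (A ξ))
  have hpow : ∀ (c : ℂ) (k : ℕ) (x : Fin n → ℂ),
      ((Matrix.toLin' (A ξ) - algebraMap ℂ _ c) ^ k) x =
        ((A ξ - c • (1 : Matrix (Fin n) (Fin n) ℂ)) ^ k) *ᵥ x := by
    intro c k x
    rw [← Matrix.toLin'_apply, Matrix.toLin'_pow, map_sub, map_smul, Matrix.toLin'_one,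
      Algebra.algebraMap_eq_smul_one]
    rfl
  simp only [hpow] at hw hb
  have hcard : Fintype.card (Σ i, Fin (e i)) = n := by
    rw [← Module.finrank_eq_card_basis b, Module.finrank_fin_fun]
  have hle : ∀ i, e i ≤ n := by
    intro i
    rw [← hcard, Fintype.card_sigma]
    simpa using Finset.single_le_sum (f := e) (fun _ _ => Nat.zero_le _) (Finset.mem_univ i)
  have hμ : ∀ i, ∃ j, lam j ξ = μ i := by
    intro i
    have hmem : μ i ∈ spectrum ℂ (A ξ) := by
      rw [← Matrix.spectrum_toLin']
      refine Module.End.HasEigenvalue.mem_spectrum (Module.End.hasEigenvalue_of_hasEigenvector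
        (x := b ⟨i, ⟨e i - 1, Nat.sub_lt (he i) one_pos⟩⟩)
        ⟨Module.End.mem_eigenspace_iff.2 ?_, b.ne_zero _⟩)
      have h0 := hw i
      rw [← Nat.sub_add_cancel (he i), pow_succ', ← Matrix.mulVec_mulVec, Matrix.sub_mulVec,
        sub_eq_zero, Matrix.smul_mulVec, Matrix.one_mulVec] at h0
      rw [hb]
      exact h0
    rw [← hspec ξ hξU] at hmem
    exact hmem
  choose j hj using hμ
  have hB : ∀ i r c, DifferentiableOn ℂ
      (fun ζ => (A ζ - lam (j i) ζ • (1 : Matrix (Fin n) (Fin n) ℂ)) r c) U := by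
    intro i r c
    simp only [Matrix.sub_apply, Matrix.smul_apply, smul_eq_mul]
    exact ((hA r c).mono hUX).sub ((hlam (j i)).mul_const _)
  choose V hV hξV hVU v hv hvξ hvker using fun i => exists_differentiableOn_section_ker
    (L := fun ζ => (A ζ - lam (j i) ζ • (1 : Matrix (Fin n) (Fin n) ℂ)) ^ e i) hU
    (differentiableOn_matrix_pow (hB i) (e i)) hξU
    (fun ζ hζ => hdim (j i) (e i) (he i) (hle i) ζ hζ ξ hξU) (w := w i) (by rw [hj]; exact hw i)
  let σ : Fin n ≃ Σ i, Fin (e i) := (Fintype.equivFinOfCardEq hcard).symm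
  let P : (Fin d → ℂ) → Matrix (Fin n) (Fin n) ℂ := fun ζ => Matrix.of fun r c =>
    (((A ζ - lam (j (σ c).1) ζ • (1 : Matrix (Fin n) (Fin n) ℂ)) ^ ((σ c).2 : ℕ)) *ᵥ
      v (σ c).1 ζ) r
  let N : Matrix (Fin n) (Fin n) ℂ := Matrix.of fun x c =>
    if (σ x).1 = (σ c).1 ∧ ((σ x).2 : ℕ) = (σ c).2 + 1 then 1 else 0
  let D : (Fin d → ℂ) → Fin n → ℂ := fun ζ c => lam (j (σ c).1) ζ
  have hN : IsNilpotent N := isNilpotent_of_apply_ne_zero (fun x => ((σ x).2 : ℕ))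
    fun x c h => by
      by_contra hne
      exact h (if_neg fun hh => hne hh.2)
  have hDN : ∀ ζ, Commute (Matrix.diagonal (D ζ)) N := by
    intro ζ
    ext x c
    rw [Matrix.diagonal_mul, Matrix.mul_diagonal]
    by_cases h : (σ x).1 = (σ c).1
    · simp [D, h, mul_comm]
    · simp [N, h]
  let W : Set (Fin d → ℂ) := U ∩ ⋂ i, V i
  have hW : IsOpen W := hU.inter (isOpen_iInter_of_finite hV)
  have hWU : W ⊆ U := Set.inter_subset_left
  have hWV : ∀ i, W ⊆ V i := fun i => Set.inter_subset_right.trans (Set.iInter_subset _ i)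
  have hξW : ξ ∈ W := ⟨hξU, Set.mem_iInter.2 hξV⟩
  have hP : ∀ r c, DifferentiableOn ℂ (fun ζ => P ζ r c) W := fun r c =>
    differentiableOn_matrix_mulVec
      (differentiableOn_matrix_pow (fun a a' => (hB _ a a').mono hWU) _)
      (fun a => (hv _ a).mono (hWV _)) r
  have hPξ : IsUnit (P ξ).det := by
    have hPb : P ξ = (Pi.basisFun ℂ (Fin n)).toMatrix (b.reindex σ.symm) := by
      ext r c
      simp [P, Module.Basis.toMatrix_apply, hb, hj, hvξ]
    rw [hPb, ← Module.Basis.det_apply]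
    exact (Pi.basisFun ℂ (Fin n)).isUnit_det _
  have hPJ : ∀ ζ ∈ W, A ζ * P ζ = P ζ * (Matrix.diagonal (D ζ) + N) := fun ζ hζ =>
    mul_of_pow_mulVec_eq σ (A ζ) (fun i => lam (j i) ζ) (fun i => v i ζ) fun i => hvker i ζ (hWV i hζ)
  have hD : ∀ ζ ∈ U, ∀ ζ' x c, D ζ x = D ζ c → D ζ' x = D ζ' c := fun ζ hζ ζ' x c h =>
    congrArg (fun k => lam k ζ') (hinj ζ hζ h)
  refine ⟨W ∩ {ζ | (P ζ).det ≠ 0}, isOpen_inter_det_ne_zero hW hP, ⟨hξW, hPξ.ne_zero⟩,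
    fun ζ hζ => hUX (hWU hζ.1), fun ζ => P ζ * (P ξ)⁻¹, ?_, ?_, ?_⟩
  · exact differentiableOn_matrix_mul (N := fun _ => (P ξ)⁻¹)
      (fun r c => (hP r c).mono Set.inter_subset_left) fun _ _ => differentiableOn_const _
  · rintro ζ ⟨-, hζ⟩
    refine ((Matrix.isUnit_iff_isUnit_det _).2 (isUnit_iff_ne_zero.2 hζ)).mul ?_
    exact Matrix.isUnit_nonsing_inv_iff.2 ((Matrix.isUnit_iff_isUnit_det _).2 hPξ)
  · rintro ζ ⟨hζW, hζ⟩
    exact image_conj_commutant_eq (isUnit_iff_ne_zero.2 hζ) hPξ (hPJ ζ hζW) (hPJ ξ hξW) fun T =>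
      ⟨commute_diagonal_add_congr hN (hDN ζ) (hD ζ (hWU hζW) ξ),
        commute_diagonal_add_congr hN (hDN ξ) (hD ξ hξU ζ)⟩
end

section
/- Fix ℓ ∈ ℕ. Suppose U is an open neighborhood of the origin in ℂ² and α, β, γ : U → ℂ are holomorphic functions such that α(z,w)·z^{ℓ+3} + β(z,w)·w^{ℓ+3} + γ(z,w)·z^{ℓ+2}·w^{ℓ+2} = 0 for all (z,w) ∈ U. Then α(0,0) = β(0,0) = γ(0,0) = 0. -/
open Filter Topology in
/-- If `f` is continuous at `0` and `f z * z ^ n` vanishes near `0`, then `f 0 = 0`. -/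
theorem ContinuousAt.eq_zero_of_eventually_mul_pow_eq_zero {f : ℂ → ℂ} (n : ℕ)
    (hf : ContinuousAt f 0) (h : ∀ᶠ z in 𝓝 0, f z * z ^ n = 0) : f 0 = 0 := by
  refine tendsto_nhds_unique (hf.tendsto.mono_left nhdsWithin_le_nhds : Tendsto f (𝓝[≠] 0) _)
    (tendsto_const_nhds.congr' ?_)
  filter_upwards [h.filter_mono nhdsWithin_le_nhds, self_mem_nhdsWithin] with z hz hz0
  exact ((mul_eq_zero.1 hz).resolve_right (pow_ne_zero _ hz0)).symm

/-- If `a·z^{n+1} + b·w^{n+1} + c·z^n·w^n` vanishes on a disc of radius `r` and `b` is bounded by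
`M` there, then the maximum principle, applied to `c + z·a / w^n`, bounds `c 0`. -/
theorem Complex.norm_le_of_relation {a b c : ℂ → ℂ} {r M : ℝ} {w : ℂ} (n : ℕ) (hr : 0 < r)
    (hw : w ≠ 0) (ha : DifferentiableOn ℂ a (Metric.closedBall 0 r))
    (hc : DifferentiableOn ℂ c (Metric.closedBall 0 r))
    (hb : ∀ z ∈ Metric.closedBall (0 : ℂ) r, ‖b z‖ ≤ M)
    (h : ∀ z ∈ Metric.closedBall (0 : ℂ) r,
      a z * z ^ (n + 1) + b z * w ^ (n + 1) + c z * z ^ n * w ^ n = 0) :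
    ‖c 0‖ ≤ M / r ^ n * ‖w‖ := by
  have hd : DifferentiableOn ℂ (fun z => c z + z * a z / w ^ n) (Metric.closedBall 0 r) :=
    hc.add ((differentiableOn_id.mul ha).div_const _)
  have hmax := Complex.norm_le_of_forall_mem_frontier_norm_le (C := M / r ^ n * ‖w‖)
    (Metric.isBounded_ball (x := (0 : ℂ)) (r := r))
    (DifferentiableOn.diffContOnCl (hd.mono Metric.closure_ball_subset_closedBall)) ?_
    (subset_closure (Metric.mem_ball_self hr))
  · simpa using hmax
  · intro z hz
    rw [frontier_ball _ hr.ne'] at hz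
    have hzr : ‖z‖ = r := by simpa using hz
    have hz0 : z ≠ 0 := norm_pos_iff.1 (hzr ▸ hr)
    have hzB := Metric.sphere_subset_closedBall hz
    have key : c z + z * a z / w ^ n = -(b z / z ^ n * w) := by
      have := h z hzB
      field_simp
      linear_combination this
    rw [key, norm_neg, norm_mul, norm_div, norm_pow, hzr]
    gcongr
    exact hb z hzB


/-- If `α, β, γ` are holomorphic near the origin of `ℂ²` and
`α·z^{ℓ+3} + β·w^{ℓ+3} + γ·z^{ℓ+2}·w^{ℓ+2} = 0` near the origin, then
`α(0,0) = β(0,0) = γ(0,0) = 0`. -/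
theorem forster_ramspott_relation (ℓ : ℕ) (U : Set (ℂ × ℂ)) (hU : IsOpen U)
    (h0 : (0, 0) ∈ U) (α β γ : ℂ × ℂ → ℂ)
    (hα : DifferentiableOn ℂ α U) (hβ : DifferentiableOn ℂ β U)
    (hγ : DifferentiableOn ℂ γ U)
    (heq : ∀ p ∈ U,
      α p * p.1 ^ (ℓ + 3) + β p * p.2 ^ (ℓ + 3) + γ p * p.1 ^ (ℓ + 2) * p.2 ^ (ℓ + 2) = 0) :
    α (0, 0) = 0 ∧ β (0, 0) = 0 ∧ γ (0, 0) = 0 := by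
  have hUn : U ∈ nhds ((0, 0) : ℂ × ℂ) := hU.mem_nhds h0
  have hfst : ContinuousAt (fun z : ℂ => (z, (0 : ℂ))) 0 := by fun_prop
  have hsnd : ContinuousAt (fun w : ℂ => ((0 : ℂ), w)) 0 := by fun_prop
  refine ⟨?_, ?_, ?_⟩
  · refine ContinuousAt.eq_zero_of_eventually_mul_pow_eq_zero (f := fun z => α (z, 0)) (ℓ + 3)
      (ContinuousAt.comp (g := α) (hα.continuousOn.continuousAt hUn) hfst) ?_
    filter_upwards [hfst.eventually_mem hUn] with z hz
    simpa using heq _ hz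
  · refine ContinuousAt.eq_zero_of_eventually_mul_pow_eq_zero (f := fun w => β (0, w)) (ℓ + 3)
      (ContinuousAt.comp (g := β) (hβ.continuousOn.continuousAt hUn) hsnd) ?_
    filter_upwards [hsnd.eventually_mem hUn] with w hw
    simpa using heq _ hw
  · obtain ⟨r, hr, hrU⟩ := Metric.nhds_basis_closedBall.mem_iff.1 hUn
    obtain ⟨M, hM⟩ := (isCompact_closedBall ((0, 0) : ℂ × ℂ) r).exists_bound_of_continuousOn
      (hβ.continuousOn.mono hrU)
    have hγc : ContinuousAt (fun w => γ (0, w)) 0 :=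
      ContinuousAt.comp (g := γ) (hγ.continuousOn.continuousAt hUn) hsnd
    have hlim : Filter.Tendsto (fun w : ℂ => M / r ^ (ℓ + 2) * ‖w‖) (nhdsWithin 0 {0}ᶜ)
        (nhds 0) := by
      have : Continuous (fun w : ℂ => M / r ^ (ℓ + 2) * ‖w‖) := by fun_prop
      simpa using (this.tendsto 0).mono_left nhdsWithin_le_nhds
    refine norm_le_zero_iff.1 (le_of_tendsto_of_tendsto
      (hγc.norm.tendsto.mono_left nhdsWithin_le_nhds) hlim ?_)
    filter_upwards [self_mem_nhdsWithin,
      nhdsWithin_le_nhds (Metric.closedBall_mem_nhds (0 : ℂ) hr)] with w hw hwr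
    have hmaps : Set.MapsTo (fun z : ℂ => (z, w)) (Metric.closedBall 0 r)
        (Metric.closedBall (0, 0) r) := fun z hz => by
      rw [← closedBall_prod_same]
      exact ⟨hz, hwr⟩
    have hdiff : DifferentiableOn ℂ (fun z : ℂ => (z, w)) (Metric.closedBall 0 r) := by fun_prop
    exact Complex.norm_le_of_relation (a := fun z => α (z, w)) (b := fun z => β (z, w))
      (c := fun z => γ (z, w)) (ℓ + 2) hr hw
      (hα.comp hdiff (hmaps.mono_right hrU)) (hγ.comp hdiff (hmaps.mono_right hrU))
      (fun z hz => hM _ (hmaps hz)) (fun z hz => heq _ (hrU (hmaps hz)))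
end

section
/- Fix ℓ ∈ ℕ. Let U be an open neighborhood of the origin in ℂ² and H : U → Mat(2×2,ℂ) holomorphic. If A(ζ)H(ζ) = H(ζ)B(ζ) for all ζ ∈ U, or H(ζ)A(ζ) = B(ζ)H(ζ) for all ζ ∈ U, then H(0,0) = 0 (the zero matrix). -/
/-- `A(z,w) = [[z^{2+ℓ}·w^{2+ℓ}, z^{3+ℓ}],[w^{3+ℓ}, 0]]`. -/
noncomputable def matA (ℓ : ℕ) (p : ℂ × ℂ) : Matrix (Fin 2) (Fin 2) ℂ :=
  !![p.1 ^ (2 + ℓ) * p.2 ^ (2 + ℓ), p.1 ^ (3 + ℓ); p.2 ^ (3 + ℓ), 0]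

/-- `B(z,w) = [[0, z^{3+ℓ}],[w^{3+ℓ}, z^{2+ℓ}·w^{2+ℓ}]]`. -/
noncomputable def matB (ℓ : ℕ) (p : ℂ × ℂ) : Matrix (Fin 2) (Fin 2) ℂ :=
  !![0, p.1 ^ (3 + ℓ); p.2 ^ (3 + ℓ), p.1 ^ (2 + ℓ) * p.2 ^ (2 + ℓ)]

open Filter Topology in
/-- A continuous function vanishing at all nonzero points near the origin vanishes there. -/
lemma eq_zero_of_eventually_nhdsNE {k : ℂ → ℂ} (hk : ContinuousAt k 0)
    (h : ∀ᶠ z in 𝓝[≠] 0, k z = 0) : k 0 = 0 :=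
  tendsto_nhds_unique (hk.tendsto.mono_left nhdsWithin_le_nhds)
    (tendsto_const_nhds.congr' (h.mono fun _ hz => hz.symm))

open Filter Topology in
/-- If `z ^ m * k(z, 0) = 0` near the origin, then `k` vanishes at the origin. -/
lemma eq_zero_of_pow_fst_mul {U : Set (ℂ × ℂ)} (hU : IsOpen U) (h0 : (0, 0) ∈ U)
    {k : ℂ × ℂ → ℂ} (hk : DifferentiableOn ℂ k U) (m : ℕ)
    (h : ∀ z, (z, 0) ∈ U → z ^ m * k (z, 0) = 0) : k (0, 0) = 0 := by
  have hc : ContinuousAt (fun z : ℂ => k (z, 0)) 0 :=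
    ContinuousAt.comp (f := fun z : ℂ => (z, (0 : ℂ)))
      (hk.continuousOn.continuousAt (hU.mem_nhds h0)) (by fun_prop)
  refine eq_zero_of_eventually_nhdsNE hc ?_
  have hcont : ContinuousAt (fun z : ℂ => (z, (0 : ℂ))) 0 := by fun_prop
  filter_upwards [self_mem_nhdsWithin, nhdsWithin_le_nhds (hcont (hU.mem_nhds h0))] with z hz hzU
  exact (mul_eq_zero.mp (h z hzU)).resolve_left (pow_ne_zero _ hz)

open Filter Topology in
/-- If `w ^ m * k(0, w) = 0` near the origin, then `k` vanishes at the origin. -/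
lemma eq_zero_of_pow_snd_mul {U : Set (ℂ × ℂ)} (hU : IsOpen U) (h0 : (0, 0) ∈ U)
    {k : ℂ × ℂ → ℂ} (hk : DifferentiableOn ℂ k U) (m : ℕ)
    (h : ∀ w, (0, w) ∈ U → w ^ m * k (0, w) = 0) : k (0, 0) = 0 :=
  eq_zero_of_pow_fst_mul (U := Prod.swap ⁻¹' U) (k := k ∘ Prod.swap)
    (hU.preimage continuous_swap) h0
    (hk.comp (differentiable_snd.prodMk differentiable_fst).differentiableOn fun _ hx => hx) m h

open Filter Topology Metric in
/-- The monomial `z ^ n * w ^ n` does not lie in the ideal `(w ^ (n + 1), z ^ (n + 1))` of germs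
of holomorphic functions: any multiple of it lying there has a cofactor vanishing at the origin. -/
lemma eq_zero_of_pow_mul_pow_mul_eq {U : Set (ℂ × ℂ)} (hU : IsOpen U) (h0 : (0, 0) ∈ U)
    {f g h : ℂ × ℂ → ℂ} (hf : DifferentiableOn ℂ f U) (hg : DifferentiableOn ℂ g U)
    (hh : ContinuousOn h U) (n : ℕ)
    (heq : ∀ p ∈ U, p.1 ^ n * p.2 ^ n * f p = p.2 ^ (n + 1) * g p + p.1 ^ (n + 1) * h p) :
    f (0, 0) = 0 := by
  obtain ⟨r, hr, hrU⟩ := nhds_basis_closedBall.mem_iff.mp (hU.mem_nhds h0)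
  obtain ⟨M, hM⟩ := (isCompact_closedBall ((0, 0) : ℂ × ℂ) r).exists_bound_of_continuousOn
    (hh.mono hrU)
  have hmem : ∀ z w : ℂ, ‖z‖ ≤ r → ‖w‖ ≤ r → (z, w) ∈ closedBall ((0, 0) : ℂ × ℂ) r := by
    intro z w hz hw
    simp [← closedBall_prod_same, hz, hw]
  have bound : ∀ z : ℂ, ‖z‖ ≤ r → z ≠ 0 → ‖f (z, 0)‖ ≤ ‖z‖ * (M / r ^ n) := by
    intro z hz hz0
    have hmaps : Set.MapsTo (fun w : ℂ => (z, w)) (closedBall 0 r) U := fun w hw =>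
      hrU (hmem z w hz (by simpa using hw))
    have hslice : Differentiable ℂ fun w : ℂ => (z, w) := by fun_prop
    have hk : DifferentiableOn ℂ (fun w => z ^ n * f (z, w) - w * g (z, w)) (closedBall 0 r) :=
      ((hf.comp hslice.differentiableOn hmaps).const_mul _).sub
        (differentiableOn_id.mul (hg.comp hslice.differentiableOn hmaps))
    have key := Complex.norm_le_of_forall_mem_frontier_norm_le (C := ‖z‖ ^ (n + 1) * (M / r ^ n))
      isBounded_ball (hk.diffContOnCl_ball subset_rfl) (fun w hw => ?_)
      (subset_closure (mem_ball_self hr))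
    · simp only [zero_mul, sub_zero, norm_mul, norm_pow, pow_succ, mul_assoc] at key
      exact le_of_mul_le_mul_left key (by positivity)
    · rw [frontier_ball _ hr.ne'] at hw
      have hwr : ‖w‖ = r := by simpa using hw
      have hw0 : w ≠ 0 := norm_pos_iff.mp (hwr ▸ hr)
      have hp := hmem z w hz hwr.le
      have e : w ^ n * (z ^ n * f (z, w) - w * g (z, w)) = z ^ (n + 1) * h (z, w) := by
        linear_combination heq _ (hrU hp)
      have e' := congrArg norm e
      rw [norm_mul, norm_mul, norm_pow, norm_pow, hwr] at e'
      rw [← mul_div_assoc, le_div_iff₀ (by positivity), mul_comm, e']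
      exact mul_le_mul_of_nonneg_left (hM _ hp) (by positivity)
  have hc : ContinuousAt (fun z : ℂ => f (z, 0)) 0 :=
    ContinuousAt.comp (f := fun z : ℂ => (z, (0 : ℂ)))
      (hf.continuousOn.continuousAt (hU.mem_nhds h0)) (by fun_prop)
  have hlim : Tendsto (fun z : ℂ => ‖z‖ * (M / r ^ n)) (𝓝[≠] 0) (𝓝 0) := by
    have : Continuous fun z : ℂ => ‖z‖ * (M / r ^ n) := by fun_prop
    simpa using (this.tendsto 0).mono_left nhdsWithin_le_nhds
  refine tendsto_nhds_unique (hc.tendsto.mono_left nhdsWithin_le_nhds)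
    (squeeze_zero_norm' ?_ hlim)
  filter_upwards [self_mem_nhdsWithin, nhdsWithin_le_nhds (closedBall_mem_nhds (0 : ℂ) hr)]
    with z hz hzr
  exact bound z (by simpa using hzr) hz

/-- The entrywise system satisfied by the intertwiners forces all entries to vanish at the
origin. -/
lemma entries_eq_zero {U : Set (ℂ × ℂ)} (hU : IsOpen U) (h0 : (0, 0) ∈ U)
    {a b c d : ℂ × ℂ → ℂ} (ha : DifferentiableOn ℂ a U) (hb : DifferentiableOn ℂ b U)
    (hc : DifferentiableOn ℂ c U) (hd : DifferentiableOn ℂ d U) {n : ℕ} (hn : n ≠ 0)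
    (had : ∀ p ∈ U, p.1 ^ (n + 1) * d p = p.1 ^ (n + 1) * a p)
    (heq : ∀ p ∈ U, p.1 ^ n * p.2 ^ n * a p = p.2 ^ (n + 1) * b p + p.1 ^ (n + 1) * c p) :
    a (0, 0) = 0 ∧ b (0, 0) = 0 ∧ c (0, 0) = 0 ∧ d (0, 0) = 0 := by
  have ha0 := eq_zero_of_pow_mul_pow_mul_eq hU h0 ha hb hc.continuousOn n heq
  refine ⟨ha0, eq_zero_of_pow_snd_mul hU h0 hb (n + 1) fun w hw => ?_,
    eq_zero_of_pow_fst_mul hU h0 hc (n + 1) fun z hz => ?_, ?_⟩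
  · simpa [hn] using (heq _ hw).symm
  · simpa [hn] using (heq _ hz).symm
  · have := eq_zero_of_pow_fst_mul hU h0 (hd.sub ha) (n + 1) fun z hz => by
      simpa [mul_sub, sub_eq_zero] using had _ hz
    simpa [ha0] using this

/-- If `H` is holomorphic near the origin of `ℂ²` and `AH = HB` or `HA = BH` near the origin,
then `H(0,0) = 0`. -/
theorem intertwiner_vanishes_at_origin (ℓ : ℕ) (U : Set (ℂ × ℂ)) (hU : IsOpen U)
    (h0 : (0, 0) ∈ U) (H : ℂ × ℂ → Matrix (Fin 2) (Fin 2) ℂ)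
    (hH : ∀ i j, DifferentiableOn ℂ (fun ζ => H ζ i j) U)
    (heq : (∀ ζ ∈ U, matA ℓ ζ * H ζ = H ζ * matB ℓ ζ) ∨
           (∀ ζ ∈ U, H ζ * matA ℓ ζ = matB ℓ ζ * H ζ)) :
    H (0, 0) = 0 := by
  suffices h : H (0, 0) 0 0 = 0 ∧ H (0, 0) 0 1 = 0 ∧ H (0, 0) 1 0 = 0 ∧ H (0, 0) 1 1 = 0 by
    obtain ⟨h00, h01, h10, h11⟩ := h
    ext i j
    fin_cases i <;> fin_cases j <;> assumption
  have hn : 2 + ℓ ≠ 0 := by lia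
  rcases heq with heq | heq
  · have entry : ∀ i j, ∀ p ∈ U, (matA ℓ p * H p) i j = (H p * matB ℓ p) i j :=
      fun i j p hp => by rw [heq p hp]
    simp only [matA, matB, Matrix.mul_apply, Fin.sum_univ_two] at entry
    have := entries_eq_zero hU h0 (hH 0 0) (hH 0 1) (hH 1 0).neg (hH 1 1) hn
      (fun p hp => by
        have := entry 0 1 p hp
        simp at this
        linear_combination this)
      (fun p hp => by
        have := entry 0 0 p hp
        simp at this
        simp only [Pi.neg_apply]
        linear_combination this)
    simpa using this
  · have entry : ∀ i j, ∀ p ∈ U, (H p * matA ℓ p) i j = (matB ℓ p * H p) i j :=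
      fun i j p hp => by rw [heq p hp]
    simp only [matA, matB, Matrix.mul_apply, Fin.sum_univ_two] at entry
    have := entries_eq_zero hU h0 (hH 0 0) (hH 0 1).neg (hH 1 0) (hH 1 1) hn
      (fun p hp => by
        have := entry 0 1 p hp
        simp at this
        linear_combination -this)
      (fun p hp => by
        have := entry 0 0 p hp
        simp at this
        simp only [Pi.neg_apply]
        linear_combination this)
    simpa using this
end

section
/- Fix ℓ ∈ ℕ. Let U be an open neighborhood of the origin in ℂ² and H : U → Mat(2×2,ℂ) holomorphic. If A(ζ)H(ζ) = H(ζ)A(ζ) for all ζ ∈ U, or B(ζ)H(ζ) = H(ζ)B(ζ) for all ζ ∈ U, then there exists λ ∈ ℂ with H(0,0) = λ·I₂, where I₂ is the 2×2 identity matrix. -/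
open Filter Topology in
/-- A function on an open set of `ℂ²` that is continuous there and vanishes at the nonzero points
of a continuous curve through the origin vanishes at the origin. -/
lemma eq_zero_at_origin_of_curve {U : Set (ℂ × ℂ)} (hU : IsOpen U) (h0 : (0, 0) ∈ U)
    {f : ℂ × ℂ → ℂ} (hf : ContinuousOn f U) {γ : ℂ → ℂ × ℂ} (hγ : Continuous γ)
    (hγ0 : γ 0 = (0, 0)) (hz : ∀ t, t ≠ 0 → γ t ∈ U → f (γ t) = 0) : f (0, 0) = 0 := by
  have hUγ : U ∈ 𝓝 (γ 0) := hγ0 ▸ hU.mem_nhds h0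
  have hfγ : Tendsto (fun t => f (γ t)) (𝓝[≠] 0) (𝓝 (f (0, 0))) := by
    have hc : ContinuousAt (fun t => f (γ t)) 0 :=
      ContinuousAt.comp (hf.continuousAt hUγ) hγ.continuousAt
    simpa [hγ0] using hc.tendsto.mono_left nhdsWithin_le_nhds
  have hev : ∀ᶠ t in 𝓝[≠] (0 : ℂ), f (γ t) = 0 := by
    filter_upwards [self_mem_nhdsWithin,
      nhdsWithin_le_nhds (hγ.continuousAt.preimage_mem_nhds hUγ)] with t ht htU
    exact hz t ht htU
  exact tendsto_nhds_unique hfγ (tendsto_const_nhds.congr' (hev.mono fun _ h => h.symm))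

/-- On the axis `w = 0`, commuting with `A` or `B` forces the lower-left entry and the difference of
the diagonal entries to vanish away from the origin. -/
lemma entries_of_commute_fst_axis {ℓ : ℕ} {t : ℂ} (ht : t ≠ 0) {M : Matrix (Fin 2) (Fin 2) ℂ}
    (h : matA ℓ (t, 0) * M = M * matA ℓ (t, 0) ∨ matB ℓ (t, 0) * M = M * matB ℓ (t, 0)) :
    M 1 0 = 0 ∧ M 0 0 - M 1 1 = 0 := by
  have ht' : t ^ (3 + ℓ) ≠ 0 := pow_ne_zero _ ht
  rcases h with h | h <;>
  · have h00 := congrFun (congrFun h 0) 0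
    have h01 := congrFun (congrFun h 0) 1
    simp [matA, matB, Matrix.mul_apply, Fin.sum_univ_two, ht] at h00 h01
    refine ⟨h00, mul_left_cancel₀ ht' ?_⟩
    linear_combination -h01

/-- On the axis `z = 0`, commuting with `A` or `B` forces the upper-right entry to vanish away from
the origin. -/
lemma entry_of_commute_snd_axis {ℓ : ℕ} {t : ℂ} (ht : t ≠ 0) {M : Matrix (Fin 2) (Fin 2) ℂ}
    (h : matA ℓ (0, t) * M = M * matA ℓ (0, t) ∨ matB ℓ (0, t) * M = M * matB ℓ (0, t)) :
    M 0 1 = 0 := by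
  rcases h with h | h <;>
  · have h00 := congrFun (congrFun h 0) 0
    simpa [matA, matB, Matrix.mul_apply, Fin.sum_univ_two, ht] using h00

/-- If `H` is holomorphic near the origin of `ℂ²` and `AH = HA` or `BH = HB` near the origin,
then `H(0,0)` is a scalar multiple of the identity. -/
theorem commutant_is_scalar_at_origin (ℓ : ℕ) (U : Set (ℂ × ℂ)) (hU : IsOpen U)
    (h0 : (0, 0) ∈ U) (H : ℂ × ℂ → Matrix (Fin 2) (Fin 2) ℂ)
    (hH : ∀ i j, DifferentiableOn ℂ (fun ζ => H ζ i j) U)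
    (heq : (∀ ζ ∈ U, matA ℓ ζ * H ζ = H ζ * matA ℓ ζ) ∨
           (∀ ζ ∈ U, matB ℓ ζ * H ζ = H ζ * matB ℓ ζ)) :
    ∃ lam : ℂ, H (0, 0) = lam • (1 : Matrix (Fin 2) (Fin 2) ℂ) := by
  have hcomm : ∀ ζ ∈ U, matA ℓ ζ * H ζ = H ζ * matA ℓ ζ ∨ matB ℓ ζ * H ζ = H ζ * matB ℓ ζ :=
    fun ζ hζ => heq.imp (fun h => h ζ hζ) (fun h => h ζ hζ)
  have hc : ∀ i j, ContinuousOn (fun ζ => H ζ i j) U := fun i j => (hH i j).continuousOn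
  have h10 : H (0, 0) 1 0 = 0 :=
    eq_zero_at_origin_of_curve hU h0 (hc 1 0) (γ := fun t => (t, 0)) (by fun_prop) rfl
      fun t ht htU => (entries_of_commute_fst_axis ht (hcomm _ htU)).1
  have hdiag : H (0, 0) 0 0 - H (0, 0) 1 1 = 0 :=
    eq_zero_at_origin_of_curve hU h0 ((hc 0 0).sub (hc 1 1)) (γ := fun t => (t, 0))
      (by fun_prop) rfl fun t ht htU => (entries_of_commute_fst_axis ht (hcomm _ htU)).2
  have h01 : H (0, 0) 0 1 = 0 :=
    eq_zero_at_origin_of_curve hU h0 (hc 0 1) (γ := fun t => (0, t)) (by fun_prop) rfl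
      fun t ht htU => entry_of_commute_snd_axis ht (hcomm _ htU)
  refine ⟨H (0, 0) 0 0, ?_⟩
  ext i j
  fin_cases i <;> fin_cases j <;> simp [h10, h01, (sub_eq_zero.mp hdiag)]
end

section
/- Fix ℓ ∈ ℕ. Let t₁, …, t_{2ℓ+5} be pairwise distinct complex numbers and let X = ⋃_{j=1}^{2ℓ+5} {(z,w) ∈ ℂ² : w = t_j·z}. Suppose U is an open neighborhood of the origin in ℂ² and α, β, γ : U → ℂ are holomorphic functions such that α(z,w)·z^{ℓ+3} + β(z,w)·w^{ℓ+3} + γ(z,w)·z^{ℓ+2}·w^{ℓ+2} = 0 for all (z,w) ∈ X ∩ U. Then α(0,0) = β(0,0) = γ(0,0) = 0. -/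
open Filter Topology Asymptotics Metric

/-- Taylor expansion at the origin of a bounded holomorphic function on a disc, with a remainder
bound depending only on the radius, the bound and the order. -/
lemma exists_taylor_remainder_bound {R : ℝ} (hR : 0 < R) (n : ℕ) : ∀ M : ℝ, 0 ≤ M →
    ∃ C : ℝ, ∀ h : ℂ → ℂ, DifferentiableOn ℂ h (ball 0 R) → (∀ w ∈ ball 0 R, ‖h w‖ ≤ M) →
      ∃ a : ℕ → ℂ, ∀ w ∈ ball (0 : ℂ) R,
        ‖h w - ∑ m ∈ Finset.range n, a m * w ^ m‖ ≤ C * ‖w‖ ^ n := by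
  induction n with
  | zero =>
    intro M hM
    exact ⟨M, fun h _ hb ↦ ⟨0, fun w hw ↦ by simpa using hb w hw⟩⟩
  | succ n ih =>
    intro M hM
    obtain ⟨C, H⟩ := ih ((2 * M) / R) (by positivity)
    refine ⟨C, fun h hd hb ↦ ?_⟩
    have h0 : (0 : ℂ) ∈ ball (0 : ℂ) R := mem_ball_self hR
    have hmaps : Set.MapsTo h (ball 0 R) (closedBall (h 0) (2 * M)) := fun w hw ↦ by
      rw [mem_closedBall, dist_eq_norm]
      linarith [norm_sub_le (h w) (h 0), hb w hw, hb 0 h0]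
    obtain ⟨a, ha⟩ := H (dslope h 0)
      ((Complex.differentiableOn_dslope (ball_mem_nhds 0 hR)).2 hd)
      (fun w hw ↦ Complex.norm_dslope_le_div_of_mapsTo_ball hd hmaps hw)
    refine ⟨fun m ↦ Nat.casesOn m (h 0) a, fun w hw ↦ ?_⟩
    have key : h w - ∑ m ∈ Finset.range (n + 1), (Nat.casesOn m (h 0) a : ℂ) * w ^ m
        = w * (dslope h 0 w - ∑ m ∈ Finset.range n, a m * w ^ m) := by
      have hs := sub_smul_dslope h 0 w
      simp only [sub_zero, smul_eq_mul] at hs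
      rw [Finset.sum_range_succ', mul_sub, hs, Finset.mul_sum]
      simp only [pow_succ, pow_zero, mul_one]
      rw [Finset.sum_congr rfl fun m _ ↦ (by ring : a m * (w ^ m * w) = w * (a m * w ^ m))]
      change h w - (_ + h 0) = h w - h 0 - _
      ring
    rw [key, norm_mul, pow_succ]
    nlinarith [mul_le_mul_of_nonneg_left (ha w hw) (norm_nonneg w)]

/-- A linear functional supported on the points `t j` that kills all polynomials of degree less
than `n` sends `s ↦ f (z, s * z)` to a quantity of order `z ^ n`. -/
lemma isBigO_sum_lines {ι : Type*} [Fintype ι] {U : Set (ℂ × ℂ)} (hU : IsOpen U)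
    (h0 : (0, 0) ∈ U) {f : ℂ × ℂ → ℂ} (hf : DifferentiableOn ℂ f U) (t c : ι → ℂ) (n : ℕ)
    (hc : ∀ m < n, ∑ j, c j * t j ^ m = 0) :
    (fun z : ℂ ↦ ∑ j, c j * f (z, t j * z)) =O[𝓝 0] fun z ↦ z ^ n := by
  have hcont : ContinuousAt f (0, 0) := (hf.differentiableAt (hU.mem_nhds h0)).continuousAt
  have hev : ∀ᶠ p in 𝓝 ((0 : ℂ), (0 : ℂ)), p ∈ U ∧ ‖f p‖ < ‖f (0, 0)‖ + 1 :=
    (hU.eventually_mem h0).and (hcont.norm.eventually_lt_const (lt_add_one _))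
  obtain ⟨R, hR, hball⟩ := Metric.eventually_nhds_iff_ball.1 hev
  obtain ⟨C, H⟩ := exists_taylor_remainder_bound hR n (‖f (0, 0)‖ + 1) (by positivity)
  have hsmall : ∀ᶠ z : ℂ in 𝓝 0, ∀ j, t j * z ∈ ball (0 : ℂ) R := by
    rw [eventually_all]
    intro j
    have : Tendsto (fun z : ℂ ↦ t j * z) (𝓝 0) (𝓝 0) := by
      simpa using (continuous_const_mul (t j)).tendsto 0
    exact this (ball_mem_nhds 0 hR)
  refine IsBigO.of_bound (∑ j, ‖c j‖ * (C * ‖t j‖ ^ n)) ?_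
  filter_upwards [hsmall, ball_mem_nhds (0 : ℂ) hR] with z hz hzR
  have hmem : ∀ w ∈ ball (0 : ℂ) R, (z, w) ∈ ball ((0 : ℂ), (0 : ℂ)) R := fun w hw ↦ by
    rw [← ball_prod_same]
    exact ⟨hzR, hw⟩
  obtain ⟨a, ha⟩ := H (fun w ↦ f (z, w))
    (hf.comp (by fun_prop) fun w hw ↦ (hball _ (hmem w hw)).1)
    (fun w hw ↦ (hball _ (hmem w hw)).2.le)
  have hzero : ∑ j, c j * ∑ m ∈ Finset.range n, a m * (t j * z) ^ m = 0 := by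
    simp_rw [Finset.mul_sum]
    rw [Finset.sum_comm]
    refine Finset.sum_eq_zero fun m hm ↦ ?_
    rw [Finset.sum_congr rfl fun j _ ↦ (by ring :
      c j * (a m * (t j * z) ^ m) = a m * z ^ m * (c j * t j ^ m)), ← Finset.mul_sum,
      hc m (Finset.mem_range.1 hm), mul_zero]
  rw [← sub_zero (∑ j, c j * f (z, t j * z)), ← hzero, ← Finset.sum_sub_distrib, Finset.sum_mul]
  refine norm_sum_le_of_le _ fun j _ ↦ ?_
  rw [← mul_sub, norm_mul, norm_pow, mul_assoc]
  refine mul_le_mul_of_nonneg_left ((ha _ (hz j)).trans_eq ?_) (norm_nonneg _)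
  rw [norm_mul, mul_pow]
  ring

/-- Coefficient extraction on polynomials of degree less than `n` is a combination of evaluations
at any `n` distinct points. -/
lemma exists_sum_mul_pow_eq_ite {K : Type*} [Field K] {n : ℕ} {t : Fin n → K}
    (ht : Function.Injective t) (k : ℕ) (hk : k < n) :
    ∃ c : Fin n → K, ∀ m < n, ∑ j, c j * t j ^ m = if m = k then 1 else 0 := by
  have hdet : IsUnit (Matrix.vandermonde t).det :=
    isUnit_iff_ne_zero.2 (Matrix.det_vandermonde_ne_zero_iff.2 ht)
  refine ⟨Matrix.vecMul (Pi.single ⟨k, hk⟩ 1) (Matrix.vandermonde t)⁻¹, fun m hm ↦ ?_⟩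
  have h : Matrix.vecMul (Matrix.vecMul (Pi.single ⟨k, hk⟩ 1) (Matrix.vandermonde t)⁻¹)
      (Matrix.vandermonde t) = Pi.single ⟨k, hk⟩ 1 := by
    rw [Matrix.vecMul_vecMul, Matrix.nonsing_inv_mul _ hdet, Matrix.vecMul_one]
  have := congrFun h ⟨m, hm⟩
  simpa [Matrix.vecMul, dotProduct, Matrix.vandermonde_apply, Pi.single_apply] using this

/-- If `α, β, γ` are holomorphic near the origin of `ℂ²` and
`α·z^{ℓ+3} + β·w^{ℓ+3} + γ·z^{ℓ+2}·w^{ℓ+2} = 0` near the origin on a union of `2ℓ+5`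
pairwise distinct lines `{w = t_j·z}`, then `α(0,0) = β(0,0) = γ(0,0) = 0`. -/
theorem relation_on_lines (ℓ : ℕ) (t : Fin (2 * ℓ + 5) → ℂ) (ht : Function.Injective t)
    (U : Set (ℂ × ℂ)) (hU : IsOpen U) (h0 : (0, 0) ∈ U)
    (α β γ : ℂ × ℂ → ℂ)
    (hα : DifferentiableOn ℂ α U) (hβ : DifferentiableOn ℂ β U)
    (hγ : DifferentiableOn ℂ γ U)
    (heq : ∀ ζ ∈ U, (∃ j, ζ.2 = t j * ζ.1) →
      α ζ * ζ.1 ^ (ℓ + 3) + β ζ * ζ.2 ^ (ℓ + 3) + γ ζ * ζ.1 ^ (ℓ + 2) * ζ.2 ^ (ℓ + 2) = 0) :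
    α (0, 0) = 0 ∧ β (0, 0) = 0 ∧ γ (0, 0) = 0 := by
  have h0' : U ∈ 𝓝 ((0 : ℂ), (0 : ℂ)) := hU.mem_nhds h0
  have hline : ∀ s : ℂ, Tendsto (fun z : ℂ ↦ (z, s * z)) (𝓝[≠] 0) (𝓝 (0, 0)) := fun s ↦ by
    have : Continuous fun z : ℂ ↦ (z, s * z) := by fun_prop
    simpa using (this.tendsto 0).mono_left nhdsWithin_le_nhds
  have hlim : ∀ {f : ℂ × ℂ → ℂ}, DifferentiableOn ℂ f U → ∀ s : ℂ,
      Tendsto (fun z : ℂ ↦ f (z, s * z)) (𝓝[≠] 0) (𝓝 (f (0, 0))) := fun hf s ↦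
    (hf.differentiableAt h0').continuousAt.tendsto.comp (hline s)
  have hz : Tendsto (fun z : ℂ ↦ z) (𝓝[≠] 0) (𝓝 0) := tendsto_id.mono_left nhdsWithin_le_nhds
  have hrel : ∀ᶠ z : ℂ in 𝓝[≠] 0, ∀ j, α (z, t j * z) + β (z, t j * z) * t j ^ (ℓ + 3)
      + γ (z, t j * z) * t j ^ (ℓ + 2) * z ^ (ℓ + 1) = 0 := by
    rw [eventually_all]
    intro j
    filter_upwards [hline (t j) h0', self_mem_nhdsWithin] with z hzU hz0
    have h := heq _ hzU ⟨j, rfl⟩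
    have hz0' : z ^ (ℓ + 3) ≠ 0 := pow_ne_zero _ hz0
    refine (mul_eq_zero.1 (?_ : z ^ (ℓ + 3) * _ = 0)).resolve_left hz0'
    rw [← h]
    simp only
    ring
  have hconst : ∀ j, α (0, 0) + β (0, 0) * t j ^ (ℓ + 3) = 0 := fun j ↦ by
    have h1 := ((hlim hα (t j)).add ((hlim hβ (t j)).mul_const (t j ^ (ℓ + 3)))).add
      (((hlim hγ (t j)).mul_const (t j ^ (ℓ + 2))).mul (hz.pow (ℓ + 1)))
    have h2 := tendsto_nhds_unique_of_eventuallyEq h1 tendsto_const_nhds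
      (hrel.mono fun z hz ↦ hz j)
    simpa using h2
  have hαβ : ∀ c : Fin (2 * ℓ + 5) → ℂ,
      α (0, 0) * ∑ j, c j * t j ^ 0 + β (0, 0) * ∑ j, c j * t j ^ (ℓ + 3) = 0 := fun c ↦ by
    rw [Finset.mul_sum, Finset.mul_sum, ← Finset.sum_add_distrib]
    refine Finset.sum_eq_zero fun j _ ↦ ?_
    linear_combination c j * hconst j
  refine ⟨?_, ?_, ?_⟩
  · obtain ⟨c, hc⟩ := exists_sum_mul_pow_eq_ite ht 0 (by lia)
    have h := hαβ c
    rw [hc 0 (by lia), hc (ℓ + 3) (by lia)] at h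
    simpa using h
  · obtain ⟨c, hc⟩ := exists_sum_mul_pow_eq_ite ht (ℓ + 3) (by lia)
    have h := hαβ c
    rw [hc 0 (by lia), hc (ℓ + 3) (by lia)] at h
    simpa using h
  · obtain ⟨c, hc⟩ := exists_sum_mul_pow_eq_ite ht (ℓ + 2) (by lia)
    have hA := isBigO_sum_lines hU h0 hα t c (ℓ + 2) fun m hm ↦ by
      rw [hc m (by lia), if_neg (by lia)]
    have hB := isBigO_sum_lines hU h0 hβ t (fun j ↦ c j * t j ^ (ℓ + 3)) (ℓ + 2) fun m hm ↦ by
      simp_rw [mul_assoc, ← pow_add]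
      rw [hc _ (by lia), if_neg (by lia)]
    have hsmall : (fun z : ℂ ↦ z ^ (ℓ + 2)) =o[𝓝 0] fun z ↦ z ^ (ℓ + 1) :=
      isLittleO_pow_pow (by lia)
    have hAB := (((hA.add hB).trans_isLittleO hsmall).mono
      (nhdsWithin_le_nhds (s := {0}ᶜ))).tendsto_div_nhds_zero
    have hG : Tendsto (fun z : ℂ ↦ ∑ j, c j * t j ^ (ℓ + 2) * γ (z, t j * z)) (𝓝[≠] 0)
        (𝓝 (γ (0, 0))) := by
      have h := tendsto_finsetSum Finset.univ fun j _ ↦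
        (hlim hγ (t j)).const_mul (c j * t j ^ (ℓ + 2))
      rwa [← Finset.sum_mul, hc _ (by lia), if_pos rfl, one_mul] at h
    have hsum := hAB.add hG
    rw [zero_add] at hsum
    refine tendsto_nhds_unique_of_eventuallyEq hsum tendsto_const_nhds ?_
    filter_upwards [hrel, self_mem_nhdsWithin] with z hz hz0
    have hz0' : z ^ (ℓ + 1) ≠ 0 := pow_ne_zero _ hz0
    rw [div_add' _ _ _ hz0', div_eq_zero_iff]
    left
    rw [Finset.sum_mul, ← Finset.sum_add_distrib, ← Finset.sum_add_distrib]
    refine Finset.sum_eq_zero fun j _ ↦ ?_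
    linear_combination c j * hz j
end
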